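/- Let 0 < θ ≤ 1, α > −1/2, and r > α + 1/2. Then there exist positive constants c₁ and C₂ depending only on α, θ, r such that for every n ∈ ℕ, c₁ n^{−(r+1/θ−1/2)} ≤ σ_n(A^r_{α,θ}, B_α)_∞ ≤ C₂ n^{−(r+1/θ−1/2)}. -/

import Mathlib

open MeasureTheory Real

noncomputable section

/-- The normalized Gegenbauer weight `v_α(x) = c_α (1 - x²)^α`,
`c_α = (∫_{-1}^1 (1-t²)^α dt)⁻¹`. -/
def gegWeight (α : ℝ) (x : ℝ) : ℝ :=
  (∫ t in Set.Ioo (-1 : ℝ) 1, (1 - t ^ 2) ^ α)⁻¹ * (1 - x ^ 2) ^ α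

/-- The `L₂(μ_α)` norm of a function on `[-1,1]`. -/
def l2geg (α : ℝ) (f : ℝ → ℂ) : ℝ :=
  (∫ x in Set.Ioo (-1 : ℝ) 1, ‖f x‖ ^ 2 * gegWeight α x) ^ (1 / 2 : ℝ)

/-- The orthonormalized Gegenbauer polynomial `L_n^α` as a complex-valued function. -/
def gegFun (L : ℕ → Polynomial ℝ) (n : ℕ) : ℝ → ℂ :=
  fun x => (((L n).eval x : ℝ) : ℂ)

/-- Clamp a real number into `[-1,1]`. -/
def clampI (x : ℝ) : (Set.Icc (-1 : ℝ) 1) :=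
  ⟨max (-1) (min 1 x),
    Set.mem_Icc.mpr ⟨le_max_left _ _, max_le (by norm_num) (min_le_left _ _)⟩⟩

/-- The orthonormalized Gegenbauer polynomial `L_n^α` as an element of `C([-1,1],ℂ)`. -/
def gegCM (L : ℕ → Polynomial ℝ) (n : ℕ) : C(Set.Icc (-1 : ℝ) 1, ℂ) :=
  ⟨fun x => (((L n).eval (x : ℝ) : ℝ) : ℂ),
    Complex.continuous_ofReal.comp ((L n).continuous.comp continuous_subtype_val)⟩

/-- `Σ_n(B_α)`: the set of `n`-term approximants with respect to the full system
of Gegenbauer polynomials. -/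
def gegSparseAll (L : ℕ → Polynomial ℝ) (n : ℕ) : Set C(Set.Icc (-1 : ℝ) 1, ℂ) :=
  {h | ∃ J : Finset ℕ, J.card = n ∧ h ∈ Submodule.span ℂ (gegCM L '' ↑J)}

/-- The Gegenbauer coefficient `⟨f, L_n^α⟩_{L₂(μ_α)}`. -/
def gegCoef (α : ℝ) (L : ℕ → Polynomial ℝ) (f : C(Set.Icc (-1 : ℝ) 1, ℂ)) (n : ℕ) : ℂ :=
  ∫ x in Set.Ioo (-1 : ℝ) 1, f (clampI x) * (((L n).eval x : ℝ) : ℂ) * ((gegWeight α x : ℝ) : ℂ)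

/-- The nonperiodic Wiener-type class `A^r_{α,θ}`:
`{f ∈ C[-1,1] : ∑_n ((1+n)^r |⟨f, L_n^α⟩|)^θ ≤ 1}`. -/
def gegWienerClass (α r θ : ℝ) (L : ℕ → Polynomial ℝ) : Set C(Set.Icc (-1 : ℝ) 1, ℂ) :=
  {f | Summable (fun n : ℕ => ((1 + (n : ℝ)) ^ r * ‖gegCoef α L f n‖) ^ θ) ∧
    ∑' n : ℕ, ((1 + (n : ℝ)) ^ r * ‖gegCoef α L f n‖) ^ θ ≤ 1}


section

open Polynomial in
lemma seq_span (P : ℕ → ℝ[X]) (hd : ∀ n, (P n).natDegree = n) (h0 : ∀ n, P n ≠ 0) :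
    ∀ (N : ℕ) (q : ℝ[X]), q.degree < N → ∃ b : ℕ → ℝ, q = ∑ k ∈ Finset.range N, C (b k) * P k := by
  intro N
  induction N with
  | zero =>
    intro q hq
    refine ⟨0, ?_⟩
    have : q = 0 := by
      rw [← Polynomial.degree_eq_bot]
      exact (Nat.WithBot.lt_zero_iff).1 (by simpa using hq)
    simp [this]
  | succ N ih =>
    intro q hq
    have hlc : (P N).coeff N ≠ 0 := by
      have := Polynomial.leadingCoeff_ne_zero.2 (h0 N)
      rwa [Polynomial.leadingCoeff, hd] at this
    set c := q.coeff N / (P N).coeff N with hc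
    obtain ⟨b, hb⟩ := ih (q - C c * P N) (by
      rw [Polynomial.degree_lt_iff_coeff_zero]
      intro m hm
      rw [Polynomial.coeff_sub, Polynomial.coeff_C_mul]
      rcases hm.eq_or_lt with rfl | hm
      · rw [hc]; field_simp; simp
      · have h1 : q.coeff m = 0 := (Polynomial.degree_lt_iff_coeff_zero _ _).1 hq m hm
        have h2 : (P N).coeff m = 0 := Polynomial.coeff_eq_zero_of_natDegree_lt (by rw [hd]; exact hm)
        simp [h1, h2])
    refine ⟨fun k => if k = N then c else b k, ?_⟩
    rw [Finset.sum_range_succ]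
    beta_reduce
    rw [if_pos rfl]
    rw [Finset.sum_congr rfl (g := fun k => C (b k) * P k), ← hb]
    · ring
    · intro k hk
      rw [if_neg (Finset.mem_range.1 hk).ne]

/-- weighted inner product on the angular side -/
def gip (l : ℝ) (p q : Polynomial ℝ) : ℝ :=
  ∫ t in (0:ℝ)..π, p.eval (cos t) * q.eval (cos t) * (sin t) ^ (2 * l)

lemma cont_sin_rpow {a : ℝ} (ha : 0 ≤ a) : Continuous (fun t : ℝ => (sin t) ^ a) :=
  continuous_sin.rpow_const (fun _ => Or.inr ha)

lemma cont_eval_cos (p : Polynomial ℝ) : Continuous (fun t : ℝ => p.eval (cos t)) :=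
  p.continuous.comp continuous_cos

lemma gip_integrable {l : ℝ} (hl : 0 < l) (p q : Polynomial ℝ) (a b : ℝ) :
    IntervalIntegrable (fun t => p.eval (cos t) * q.eval (cos t) * (sin t) ^ (2 * l)) volume a b :=
  (((cont_eval_cos p).mul (cont_eval_cos q)).mul (cont_sin_rpow (by positivity))).intervalIntegrable _ _

lemma gip_comm (l : ℝ) (p q : Polynomial ℝ) : gip l p q = gip l q p := by
  unfold gip; congr 1; ext t; ring

lemma gip_add {l : ℝ} (hl : 0 < l) (p p' q : Polynomial ℝ) :
    gip l (p + p') q = gip l p q + gip l p' q := by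
  unfold gip
  rw [← intervalIntegral.integral_add (gip_integrable hl _ _ _ _) (gip_integrable hl _ _ _ _)]
  congr 1; ext t; simp; ring

lemma gip_smul (l : ℝ) (c : ℝ) (p q : Polynomial ℝ) :
    gip l (Polynomial.C c * p) q = c * gip l p q := by
  unfold gip
  rw [← intervalIntegral.integral_const_mul]
  congr 1; ext t; simp; ring

lemma gip_zero (l : ℝ) (q : Polynomial ℝ) : gip l 0 q = 0 := by
  unfold gip; simp

lemma gip_sum {l : ℝ} (hl : 0 < l) {ι : Type*} (s : Finset ι) (p : ι → Polynomial ℝ) (q : Polynomial ℝ) :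
    gip l (∑ i ∈ s, p i) q = ∑ i ∈ s, gip l (p i) q := by
  classical
  induction s using Finset.induction_on with
  | empty => simp [gip_zero]
  | insert a s ha ih => rw [Finset.sum_insert ha, Finset.sum_insert ha, gip_add hl, ih]

/-- standing assumptions for the orthogonal system -/
structure GSys (l κ : ℝ) (L : ℕ → Polynomial ℝ) : Prop where
  hl : 0 < l
  hκ : 0 < κ
  hd : ∀ n, (L n).natDegree = n
  h0 : ∀ n, L n ≠ 0
  orth : ∀ i j, gip l (L i) (L j) = if i = j then κ else 0

namespace GSys
variable {l κ : ℝ} {L : ℕ → Polynomial ℝ}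

lemma coef (S : GSys l κ L) (N : ℕ) (b : ℕ → ℝ) (j : ℕ) (hj : j < N) :
    gip l (∑ k ∈ Finset.range N, Polynomial.C (b k) * L k) (L j) = κ * b j := by
  rw [gip_sum S.hl]
  simp_rw [gip_smul, S.orth]
  simp [hj, mul_comm]

lemma coef_ge (S : GSys l κ L) (q : Polynomial ℝ) (j : ℕ) (hj : q.degree < j) :
    gip l q (L j) = 0 := by
  obtain ⟨b, rfl⟩ := seq_span L S.hd S.h0 j q hj
  rw [gip_sum S.hl]
  apply Finset.sum_eq_zero
  intro k hk
  rw [gip_smul, S.orth, if_neg (Finset.mem_range.1 hk).ne, mul_zero]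

lemma parseval (S : GSys l κ L) (N : ℕ) (b : ℕ → ℝ) :
    gip l (∑ k ∈ Finset.range N, Polynomial.C (b k) * L k)
      (∑ k ∈ Finset.range N, Polynomial.C (b k) * L k) = κ * ∑ k ∈ Finset.range N, b k ^ 2 := by
  conv_lhs => rw [gip_sum S.hl]
  rw [Finset.mul_sum]
  apply Finset.sum_congr rfl
  intro k hk
  rw [gip_smul, gip_comm, S.coef N b k (Finset.mem_range.1 hk)]; ring

end GSys

/-- the Gegenbauer operator -/
def gD (l : ℝ) (p : Polynomial ℝ) : Polynomial ℝ :=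
  (1 - Polynomial.X ^ 2) * p.derivative.derivative - Polynomial.C (2 * l + 1) * Polynomial.X * p.derivative

lemma hasDeriv_eval_cos (p : Polynomial ℝ) (t : ℝ) :
    HasDerivAt (fun t => p.eval (cos t)) (-(sin t * p.derivative.eval (cos t))) t := by
  have := (p.hasDerivAt (cos t)).comp t (Real.hasDerivAt_cos t)
  exact this.congr_deriv (by ring)

lemma hasDeriv_sin_rpow {a : ℝ} (ha : 1 ≤ a) (t : ℝ) :
    HasDerivAt (fun t => (sin t) ^ a) (a * (sin t) ^ (a - 1) * cos t) t := by
  have := (Real.hasDerivAt_sin t).rpow_const (p := a) (Or.inr ha)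
  convert this using 1; ring

lemma gD_ibp {l : ℝ} (hl : 0 < l) (p q : Polynomial ℝ) :
    gip l (gD l p) q = - ∫ t in (0:ℝ)..π,
      (sin t * p.derivative.eval (cos t)) * (sin t * q.derivative.eval (cos t)) * (sin t) ^ (2 * l) := by
  have hder : ∀ t ∈ Set.uIcc 0 π, HasDerivAt
      (fun t => -((sin t) ^ (2 * l + 1) * p.derivative.eval (cos t) * q.eval (cos t)))
      ((gD l p).eval (cos t) * q.eval (cos t) * (sin t) ^ (2 * l)
        + (sin t * p.derivative.eval (cos t)) * (sin t * q.derivative.eval (cos t)) * (sin t) ^ (2 * l)) t := by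
    intro t ht
    rw [Set.uIcc_of_le pi_pos.le] at ht
    have hs : 0 ≤ sin t := sin_nonneg_of_mem_Icc ht
    have h := (((hasDeriv_sin_rpow (a := 2 * l + 1) (by linarith) t).mul
      (hasDeriv_eval_cos p.derivative t)).mul (hasDeriv_eval_cos q t)).neg
    refine h.congr_deriv ?_
    have e1 : (sin t) ^ (2 * l + 1) = (sin t) ^ (2 * l) * sin t := by
      rw [rpow_add_one' hs (by linarith)]
    have e2 : (sin t) ^ (2 * l + 1 - 1) = (sin t) ^ (2 * l) := by rw [add_sub_cancel_right]
    have e3 : sin t ^ 2 = 1 - cos t ^ 2 := by rw [← sin_sq_add_cos_sq t]; ring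
    simp only [gD, Polynomial.eval_sub, Polynomial.eval_mul, Polynomial.eval_pow, Polynomial.eval_X,
      Polynomial.eval_C, Polynomial.eval_one, e1, e2, Pi.mul_apply]
    rw [← e3]; ring
  have hi1 := gip_integrable hl (gD l p) q 0 π
  have hi2 : IntervalIntegrable (fun t => (sin t * p.derivative.eval (cos t)) * (sin t * q.derivative.eval (cos t)) * (sin t) ^ (2 * l)) volume 0 π :=
    (((continuous_sin.mul (cont_eval_cos _)).mul (continuous_sin.mul (cont_eval_cos _))).mul
      (cont_sin_rpow (by positivity))).intervalIntegrable _ _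
  have := intervalIntegral.integral_eq_sub_of_hasDerivAt hder (hi1.add hi2)
  rw [intervalIntegral.integral_add hi1 hi2] at this
  have z : (0:ℝ) ^ (2 * l + 1) = 0 := zero_rpow (by linarith)
  simp [z] at this
  unfold gip
  linarith

lemma gD_symm {l : ℝ} (hl : 0 < l) (p q : Polynomial ℝ) : gip l (gD l p) q = gip l p (gD l q) := by
  rw [gD_ibp hl, gip_comm, gD_ibp hl]
  congr 2; ext t; ring

lemma gD_coeff (l : ℝ) (p : Polynomial ℝ) (n : ℕ) (hp : p.natDegree ≤ n) (m : ℕ) (hm : n ≤ m) :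
    (gD l p).coeff m = -((m:ℝ) * (m + 2 * l)) * p.coeff m := by
  have e : gD l p = p.derivative.derivative - p.derivative.derivative * Polynomial.X ^ 2
      - Polynomial.C (2 * l + 1) * (p.derivative * Polynomial.X) := by unfold gD; ring
  have z : ∀ j, m < j → p.coeff j = 0 := fun j hj => Polynomial.coeff_eq_zero_of_natDegree_lt (by omega)
  rw [e, Polynomial.coeff_sub, Polynomial.coeff_sub, Polynomial.coeff_C_mul]
  rcases m with _ | m
  · simp [Polynomial.coeff_derivative, z]
  · rw [Polynomial.coeff_mul_X, Polynomial.coeff_derivative, Polynomial.coeff_derivative, z _ (by omega),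
      Polynomial.coeff_derivative]
    rcases m with _ | m
    · rw [Polynomial.coeff_mul_X_pow', if_neg (by norm_num)]
      push_cast; ring
    · rw [Polynomial.coeff_mul_X_pow', if_pos (by omega)]
      simp only [Polynomial.coeff_derivative]
      have : m + 1 + 1 - 2 + 1 + 1 = m + 1 + 1 := by omega
      rw [this]
      have : m + 1 + 1 - 2 = m := by omega
      rw [this]
      push_cast; ring

namespace GSys
variable {l κ : ℝ} {L : ℕ → Polynomial ℝ}

lemma ode_poly (S : GSys l κ L) (n : ℕ) : gD l (L n) = Polynomial.C (-((n:ℝ) * (n + 2 * l))) * L n := by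
  set q := gD l (L n) + Polynomial.C ((n:ℝ) * (n + 2 * l)) * L n with hq
  have hdeg : q.degree < n := by
    rw [Polynomial.degree_lt_iff_coeff_zero]
    intro m hm
    rw [hq, Polynomial.coeff_add, Polynomial.coeff_C_mul, gD_coeff l _ n (S.hd n).le m hm]
    rcases hm.eq_or_lt with rfl | hm
    · ring
    · rw [Polynomial.coeff_eq_zero_of_natDegree_lt (by rw [S.hd]; exact hm)]; ring
  obtain ⟨b, hb⟩ := seq_span L S.hd S.h0 n q hdeg
  have hb0 : ∀ k ∈ Finset.range n, b k = 0 := by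
    intro k hk
    have hk' := Finset.mem_range.1 hk
    have h1 : gip l q (L k) = κ * b k := by rw [hb]; exact S.coef n b k hk'
    have h2 : gip l q (L k) = 0 := by
      rw [hq, gip_add S.hl, gip_smul, S.orth, if_neg hk'.ne', gD_symm S.hl, gip_comm,
        S.coef_ge _ n]
      · ring
      · rw [Polynomial.degree_lt_iff_coeff_zero]
        intro m hm
        rw [gD_coeff l _ k (S.hd k).le m (by omega), Polynomial.coeff_eq_zero_of_natDegree_lt (by rw [S.hd]; omega)]
        ring
    have := S.hκ
    rw [h1] at h2
    rcases mul_eq_zero.1 h2 with h | h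
    · linarith
    · exact h
  have hq0 : q = 0 := by
    rw [hb]; apply Finset.sum_eq_zero; intro k hk; rw [hb0 k hk]; simp
  rw [hq] at hq0
  rw [eq_neg_of_add_eq_zero_left hq0]; simp

lemma ode (S : GSys l κ L) (n : ℕ) (x : ℝ) :
    (1 - x ^ 2) * (L n).derivative.derivative.eval x - (2 * l + 1) * x * (L n).derivative.eval x
      = -((n:ℝ) * (n + 2 * l)) * (L n).eval x := by
  have := congrArg (Polynomial.eval x) (S.ode_poly n)
  simpa [gD] using this

lemma energy (S : GSys l κ L) (n : ℕ) : ∫ t in (0:ℝ)..π,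
      (sin t * (L n).derivative.eval (cos t)) ^ 2 * (sin t) ^ (2 * l) = (n:ℝ) * (n + 2 * l) * κ := by
  have h := gD_ibp S.hl (L n) (L n)
  rw [S.ode_poly, gip_smul, S.orth, if_pos rfl] at h
  have : ∀ t, (sin t * (L n).derivative.eval (cos t)) ^ 2 * (sin t) ^ (2 * l) =
    (sin t * (L n).derivative.eval (cos t)) * (sin t * (L n).derivative.eval (cos t)) * (sin t) ^ (2 * l) := by
      intro t; ring
  simp_rw [this]; linarith

end GSys

end

section

lemma gron {F F' E E' : ℝ → ℝ} {a b : ℝ} (hab : a ≤ b)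
    (hF : ∀ t ∈ Set.Icc a b, HasDerivAt F (F' t) t) (hE : ∀ t ∈ Set.Icc a b, HasDerivAt E (E' t) t)
    (h : ∀ t ∈ Set.Icc a b, |F' t| ≤ E' t * F t) :
    F a * exp (E a) ≤ F b * exp (E b) ∧ F b * exp (-E b) ≤ F a * exp (-E a) := by
  have ha : a ∈ Set.Icc a b := ⟨le_rfl, hab⟩
  have hb : b ∈ Set.Icc a b := ⟨hab, le_rfl⟩
  constructor
  · have hd : ∀ t ∈ Set.Icc a b, HasDerivAt (fun t => F t * exp (E t))
        (F' t * exp (E t) + F t * (exp (E t) * E' t)) t := fun t ht => (hF t ht).mul (hE t ht).exp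
    have hm : MonotoneOn (fun t => F t * exp (E t)) (Set.Icc a b) := by
      apply monotoneOn_of_hasDerivWithinAt_nonneg (convex_Icc a b)
        (fun t ht => (hd t ht).continuousAt.continuousWithinAt)
        (fun t ht => (hd t (interior_subset ht)).hasDerivWithinAt)
      intro t ht
      have h1 := (abs_le.1 (h t (interior_subset ht))).1
      have : 0 ≤ exp (E t) * (F' t + E' t * F t) := mul_nonneg (exp_pos _).le (by linarith)
      linarith
    exact hm ha hb hab
  · have hd : ∀ t ∈ Set.Icc a b, HasDerivAt (fun t => F t * exp (-E t))
        (F' t * exp (-E t) + F t * (exp (-E t) * -E' t)) t := fun t ht => (hF t ht).mul (hE t ht).fun_neg.exp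
    have hm : AntitoneOn (fun t => F t * exp (-E t)) (Set.Icc a b) := by
      apply antitoneOn_of_hasDerivWithinAt_nonpos (convex_Icc a b)
        (fun t ht => (hd t ht).continuousAt.continuousWithinAt)
        (fun t ht => (hd t (interior_subset ht)).hasDerivWithinAt)
      intro t ht
      have h1 := (abs_le.1 (h t (interior_subset ht))).2
      have : 0 ≤ exp (-E t) * (E' t * F t - F' t) := mul_nonneg (exp_pos _).le (by linarith)
      linarith
    exact hm ha hb hab

def pU (l : ℝ) (p : Polynomial ℝ) (t : ℝ) : ℝ := (sin t) ^ l * p.eval (cos t)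
def pU1 (l : ℝ) (p : Polynomial ℝ) (t : ℝ) : ℝ :=
  (sin t) ^ l * (-(sin t * p.derivative.eval (cos t)) + l * (cos t / sin t) * p.eval (cos t))
def pPhi (l n t : ℝ) : ℝ := (n + l) ^ 2 + l * (1 - l) / (sin t) ^ 2
def pF (l n : ℝ) (p : Polynomial ℝ) (t : ℝ) : ℝ := pU1 l p t ^ 2 + pPhi l n t * pU l p t ^ 2

def PODE (l n : ℝ) (p : Polynomial ℝ) : Prop := ∀ x : ℝ,
  (1 - x ^ 2) * p.derivative.derivative.eval x - (2 * l + 1) * x * p.derivative.eval x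
      = -(n * (n + 2 * l)) * p.eval x

lemma hasDeriv_sin_rpow' (a : ℝ) {t : ℝ} (h : 0 < sin t) :
    HasDerivAt (fun t => (sin t) ^ a) (a * ((sin t) ^ a / sin t) * cos t) t := by
  have := (Real.hasDerivAt_sin t).rpow_const (p := a) (Or.inl h.ne')
  rw [rpow_sub_one h.ne'] at this
  exact this.congr_deriv (by ring)

lemma pU_deriv (l : ℝ) (p : Polynomial ℝ) {t : ℝ} (h : 0 < sin t) :
    HasDerivAt (pU l p) (pU1 l p t) t := by
  have := (hasDeriv_sin_rpow' l h).mul (hasDeriv_eval_cos p t)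
  refine this.congr_deriv ?_
  unfold pU1
  field_simp; ring

lemma pU1_deriv {l n : ℝ} {p : Polynomial ℝ} (hp : PODE l n p) {t : ℝ} (h : 0 < sin t) :
    HasDerivAt (pU1 l p) (-(pPhi l n t * pU l p t)) t := by
  have := (hasDeriv_sin_rpow' l h).mul
    (((Real.hasDerivAt_sin t).mul (hasDeriv_eval_cos p.derivative t)).neg.add
      ((((Real.hasDerivAt_cos t).div (Real.hasDerivAt_sin t) h.ne').const_mul l).mul
        (hasDeriv_eval_cos p t)))
  refine this.congr_deriv ?_
  have e := hp (cos t)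
  have e3 : 1 - cos t ^ 2 = sin t ^ 2 := by rw [← sin_sq_add_cos_sq t]; ring
  have e4 : cos t ^ 2 = 1 - sin t ^ 2 := by rw [← sin_sq_add_cos_sq t]; ring
  rw [e3] at e
  have e5 : sin t ^ 2 * p.derivative.derivative.eval (cos t) =
    (2 * l + 1) * cos t * p.derivative.eval (cos t) -(n * (n + 2 * l)) * p.eval (cos t) := by linarith
  unfold pU pPhi
  simp only [Pi.add_apply, Pi.neg_apply, Pi.mul_apply, Pi.div_apply]
  generalize p.derivative.derivative.eval (cos t) = d2 at *
  generalize p.derivative.eval (cos t) = d1 at *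
  generalize p.eval (cos t) = d0 at *
  generalize sin t ^ l = w at *
  generalize cos t = x at *
  generalize sin t = s at *
  field_simp
  linear_combination (w * s ^ 2) * e5 + (w * l * d0 * (l - 1)) * e4

lemma pF_deriv {l n : ℝ} {p : Polynomial ℝ} (hp : PODE l n p) {t : ℝ} (h : 0 < sin t) :
    HasDerivAt (pF l n p) (-(2 * (l * (1 - l)) * cos t / sin t ^ 3) * pU l p t ^ 2) t := by
  have hphi : HasDerivAt (pPhi l n) (-(2 * (l * (1 - l)) * cos t / sin t ^ 3)) t := by
    have := ((((Real.hasDerivAt_sin t).pow 2).inv (by simpa using h.ne')).const_mul (l * (1 - l))).const_add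
      ((n + l) ^ 2)
    have e : pPhi l n = fun x => (n + l) ^ 2 + l * (1 - l) * (sin ^ 2)⁻¹ x := by
      funext x; simp [pPhi, div_eq_mul_inv]
    rw [e]
    refine this.congr_deriv ?_
    simp; field_simp
  have := ((pU1_deriv hp h).pow 2).add (hphi.mul ((pU_deriv l p h).pow 2))
  refine this.congr_deriv ?_
  simp; ring

lemma pwF {l n c A : ℝ} {p : Polynomial ℝ} (hA : A = |l * (1 - l)|) (hc : c = 1 + 2 * A)
    (hn : 0 < n) (hl : 0 < l) (hp : PODE l n p) {t : ℝ} (h0 : 0 < t) (h1 : t ≤ π / 2)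
    (hs : c / n ≤ sin t) :
    n ^ 2 / 2 * pU l p t ^ 2 ≤ pF l n p t ∧ pU1 l p t ^ 2 ≤ pF l n p t ∧
    pF l n p t ≤ exp 1 * pF l n p (π / 2) ∧ pF l n p (π / 2) ≤ exp 1 * pF l n p t := by
  have hA0 : 0 ≤ A := hA ▸ abs_nonneg _
  have hc1 : 1 ≤ c := by linarith
  have hcA : 2 * A ≤ c ^ 2 := by nlinarith
  have key : ∀ x ∈ Set.Icc t (π / 2), 0 < sin x ∧ A / sin x ^ 2 ≤ n ^ 2 / 2 ∧ 0 ≤ cos x := by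
    intro x hx
    have hsx : sin t ≤ sin x := sin_le_sin_of_le_of_le_pi_div_two (by linarith) hx.2 hx.1
    have hp1 : 0 < c / n := by positivity
    have hsx0 : 0 < sin x := by linarith
    refine ⟨hsx0, ?_, cos_nonneg_of_neg_pi_div_two_le_of_le (by linarith [hx.1]) hx.2⟩
    have h3 : c ≤ sin x * n := by
      rw [div_le_iff₀ hn] at hs
      nlinarith
    rw [div_le_iff₀ (by positivity)]
    have : c ^ 2 ≤ (sin x * n) ^ 2 := by gcongr
    nlinarith
  have keyphi : ∀ x ∈ Set.Icc t (π / 2), n ^ 2 / 2 ≤ pPhi l n x := by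
    intro x hx
    obtain ⟨a1, a2, a3⟩ := key x hx
    unfold pPhi
    have : -(A / sin x ^ 2) ≤ l * (1 - l) / sin x ^ 2 := by
      rw [← neg_div]; gcongr
      rw [hA]; exact neg_abs_le _
    nlinarith
  have keyF : ∀ x ∈ Set.Icc t (π / 2), n ^ 2 / 2 * pU l p x ^ 2 ≤ pF l n p x ∧ pU1 l p x ^ 2 ≤ pF l n p x := by
    intro x hx
    have := keyphi x hx
    unfold pF
    constructor
    · have := mul_le_mul_of_nonneg_right this (sq_nonneg (pU l p x))
      nlinarith [sq_nonneg (pU1 l p x)]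
    · have : 0 ≤ pPhi l n x * pU l p x ^ 2 := mul_nonneg (by nlinarith [sq_nonneg n]) (sq_nonneg _)
      linarith
  have htm : t ∈ Set.Icc t (π / 2) := ⟨le_rfl, h1⟩
  have hpm : π / 2 ∈ Set.Icc t (π / 2) := ⟨h1, le_rfl⟩
  have hF0 : ∀ x ∈ Set.Icc t (π / 2), 0 ≤ pF l n p x := fun x hx => (sq_nonneg _).trans (keyF x hx).2
  have hg := gron (F := pF l n p) (F' := fun x => -(2 * (l * (1 - l)) * cos x / sin x ^ 3) * pU l p x ^ 2)
    (E := fun x => -(2 * A / n ^ 2) * ((sin x) ^ 2)⁻¹) (E' := fun x => 4 * A * cos x / (n ^ 2 * sin x ^ 3)) h1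
    (fun x hx => pF_deriv hp (key x hx).1)
    (fun x hx => by
      have hh := (key x hx).1
      have := (((Real.hasDerivAt_sin x).pow 2).inv (by simpa using hh.ne')).const_mul (-(2 * A / n ^ 2))
      refine this.congr_deriv ?_
      simp; field_simp; ring)
    (fun x hx => by
      obtain ⟨a1, a2, a3⟩ := key x hx
      have b1 := (keyF x hx).1
      rw [abs_mul, abs_neg, abs_div, abs_mul, abs_mul, ← hA, abs_of_nonneg a3, abs_of_pos (pow_pos a1 3),
        abs_of_nonneg (sq_nonneg (pU l p x)), abs_of_pos (by norm_num : (0:ℝ) < 2)]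
      have e : 4 * A * cos x / (n ^ 2 * sin x ^ 3) * pF l n p x =
        (2 * A * cos x / sin x ^ 3) * (2 / n ^ 2 * pF l n p x) := by field_simp; ring
      rw [e]
      have : 0 ≤ 2 * A * cos x / sin x ^ 3 := by positivity
      apply mul_le_mul_of_nonneg_left _ this
      rw [div_mul_eq_mul_div, le_div_iff₀ (by positivity)]
      linarith)
  refine ⟨(keyF t htm).1, (keyF t htm).2, ?_, ?_⟩
  · have h := hg.1
    have f1 := hF0 _ htm
    have f2 := hF0 _ hpm
    have g1 : exp (-1) ≤ exp (-(2 * A / n ^ 2) * ((sin t) ^ 2)⁻¹) := by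
      apply exp_le_exp.2
      have := (key t htm).2.1
      have e : -(2 * A / n ^ 2) * ((sin t) ^ 2)⁻¹ = - ((A / sin t ^ 2) * (2 / n ^ 2)) := by
        field_simp
      rw [e]
      have : (A / sin t ^ 2) * (2 / n ^ 2) ≤ (n ^ 2 / 2) * (2 / n ^ 2) := by gcongr
      have e2 : (n ^ 2 / 2) * (2 / n ^ 2) = 1 := by field_simp
      linarith
    have g2 : exp (-(2 * A / n ^ 2) * ((sin (π / 2)) ^ 2)⁻¹) ≤ 1 := by
      rw [exp_le_one_iff]
      have : 0 ≤ (2 * A / n ^ 2) * ((sin (π / 2)) ^ 2)⁻¹ := by positivity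
      linarith
    have h2 : pF l n p t * exp (-1) ≤ pF l n p (π / 2) := by
      calc _ ≤ pF l n p t * exp (-(2 * A / n ^ 2) * ((sin t) ^ 2)⁻¹) := by gcongr
        _ ≤ _ := h
        _ ≤ pF l n p (π / 2) * 1 := by gcongr
        _ = _ := mul_one _
    calc pF l n p t = exp 1 * (pF l n p t * exp (-1)) := by
          rw [mul_left_comm, ← exp_add]; simp
      _ ≤ _ := by gcongr
  · have h := hg.2
    have f1 := hF0 _ htm
    have f2 := hF0 _ hpm
    have g1 : exp (-(-(2 * A / n ^ 2) * ((sin t) ^ 2)⁻¹)) ≤ exp 1 := by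
      apply exp_le_exp.2
      have := (key t htm).2.1
      have e : -(-(2 * A / n ^ 2) * ((sin t) ^ 2)⁻¹) = ((A / sin t ^ 2) * (2 / n ^ 2)) := by
        field_simp
      rw [e]
      have : (A / sin t ^ 2) * (2 / n ^ 2) ≤ (n ^ 2 / 2) * (2 / n ^ 2) := by gcongr
      have e2 : (n ^ 2 / 2) * (2 / n ^ 2) = 1 := by field_simp
      linarith
    have g2 : 1 ≤ exp (-(-(2 * A / n ^ 2) * ((sin (π / 2)) ^ 2)⁻¹)) := by
      rw [one_le_exp_iff]
      have : 0 ≤ (2 * A / n ^ 2) * ((sin (π / 2)) ^ 2)⁻¹ := by positivity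
      linarith
    calc pF l n p (π / 2) = pF l n p (π / 2) * 1 := (mul_one _).symm
      _ ≤ _ := by gcongr
      _ ≤ _ := h
      _ ≤ pF l n p t * exp 1 := by gcongr
      _ = _ := mul_comm _ _

end

section

lemma pw_alg {l n w Y D k φ a : ℝ} (hn1 : 1 ≤ n) (hk : k ^ 2 ≤ 1) (hφ : φ ≤ a * n ^ 2) :
    (w * (-D + l * k * Y)) ^ 2 + φ * (w * Y) ^ 2 ≤
      2 * (D ^ 2 * w ^ 2) + (2 * l ^ 2 + a) * n ^ 2 * (Y ^ 2 * w ^ 2) := by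
  have h1 : k ^ 2 ≤ n ^ 2 := hk.trans (by nlinarith)
  have q1 : (l * k * Y) ^ 2 ≤ l ^ 2 * n ^ 2 * Y ^ 2 := by
    have e : (l * k * Y) ^ 2 = l ^ 2 * k ^ 2 * Y ^ 2 := by ring
    rw [e]; gcongr
  have b1 : (-D + l * k * Y) ^ 2 ≤ 2 * D ^ 2 + 2 * (l ^ 2 * n ^ 2 * Y ^ 2) := by
    have := sq_nonneg (D + l * k * Y)
    nlinarith
  have b2 : w ^ 2 * (-D + l * k * Y) ^ 2 ≤ w ^ 2 * (2 * D ^ 2 + 2 * (l ^ 2 * n ^ 2 * Y ^ 2)) := by gcongr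
  have b3 : φ * (w * Y) ^ 2 ≤ (a * n ^ 2) * (w * Y) ^ 2 := by gcongr
  calc _ = w ^ 2 * (-D + l * k * Y) ^ 2 + φ * (w * Y) ^ 2 := by ring
    _ ≤ w ^ 2 * (2 * D ^ 2 + 2 * (l ^ 2 * n ^ 2 * Y ^ 2)) + (a * n ^ 2) * (w * Y) ^ 2 := add_le_add b2 b3
    _ = _ := by ring

lemma pwA {l : ℝ} (hl : 0 < l) {κ : ℝ} (hκ : 0 < κ) : ∃ C c : ℝ, 0 < C ∧ 1 ≤ c ∧ ∀ (n : ℝ) (p : Polynomial ℝ),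
    2 * c ≤ n → PODE l n p →
    (∫ t in (0:ℝ)..π, p.eval (cos t) ^ 2 * (sin t) ^ (2 * l)) ≤ κ →
    (∫ t in (0:ℝ)..π, (sin t * p.derivative.eval (cos t)) ^ 2 * (sin t) ^ (2 * l)) ≤ n * (n + 2 * l) * κ →
    ∀ t, 0 < t → t ≤ π / 2 → c / n ≤ sin t → pU l p t ^ 2 ≤ C ∧ pU1 l p t ^ 2 ≤ C * n ^ 2 := by
  set A := |l * (1 - l)| with hA
  have hA0 : 0 ≤ A := hA ▸ abs_nonneg _
  set c := 1 + 2 * A with hc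
  set C1 := 2 * l ^ 2 + (1 + l) ^ 2 + 2 * A with hC1
  set C2 := (2 * (1 + 2 * l) + C1) * κ with hC2
  have hC1p : 0 < C1 := by positivity
  have hC2p : 0 < C2 := by positivity
  refine ⟨2 * (exp 1 * (exp 1 * 4 / π * C2)), c, by positivity, by linarith, ?_⟩
  intro n p hn hp hi1 hi2 t h0 h1 hs
  have hn1 : 1 ≤ n := by linarith
  have hn0 : 0 < n := by linarith
  have hend : pF l n p (π / 2) ≤ exp 1 * 4 / π * C2 * n ^ 2 := by
    set R : ℝ → ℝ := fun t => 2 * ((sin t * p.derivative.eval (cos t)) ^ 2 * (sin t) ^ (2 * l)) +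
      C1 * n ^ 2 * (p.eval (cos t) ^ 2 * (sin t) ^ (2 * l)) with hR
    have c1 : Continuous (fun t => (sin t * p.derivative.eval (cos t)) ^ 2 * (sin t) ^ (2 * l)) :=
      ((continuous_sin.mul (cont_eval_cos _)).pow 2).mul (cont_sin_rpow (by positivity))
    have c2 : Continuous (fun t => p.eval (cos t) ^ 2 * (sin t) ^ (2 * l)) :=
      ((cont_eval_cos _).pow 2).mul (cont_sin_rpow (by positivity))
    have cR : Continuous R := (c1.const_mul 2).add (c2.const_mul _)
    have hRi : ∫ t in (0:ℝ)..π, R t ≤ C2 * n ^ 2 := by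
      rw [hR, intervalIntegral.integral_add ((c1.const_mul 2).intervalIntegrable _ _)
        ((c2.const_mul _).intervalIntegrable _ _), intervalIntegral.integral_const_mul,
        intervalIntegral.integral_const_mul]
      have e1 : n * (n + 2 * l) * κ ≤ (1 + 2 * l) * n ^ 2 * κ := by
        apply mul_le_mul_of_nonneg_right _ hκ.le
        nlinarith [mul_nonneg (mul_nonneg hl.le hn0.le) (sub_nonneg.2 hn1)]
      have e2 : C1 * n ^ 2 * ∫ t in (0:ℝ)..π, p.eval (cos t) ^ 2 * (sin t) ^ (2 * l) ≤ C1 * n ^ 2 * κ := by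
        gcongr
      rw [hC2]; linarith
    have hR0 : ∀ t ∈ Set.Icc 0 π, 0 ≤ R t := by
      intro t ht
      have : 0 ≤ sin t := sin_nonneg_of_mem_Icc ht
      rw [hR]; positivity
    have hlow : ∀ t ∈ Set.Icc (π / 4) (π / 2), exp (-1) * pF l n p (π / 2) ≤ R t := by
      intro t ht
      have hst : 1 / 2 ≤ sin t := by
        have a1 : sin (π / 4) ≤ sin t := sin_le_sin_of_le_of_le_pi_div_two (by linarith [pi_pos]) ht.2 ht.1
        rw [sin_pi_div_four] at a1
        have : (1:ℝ) ≤ √2 := by rw [Real.one_le_sqrt]; norm_num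
        linarith
      have hst2 : 1 / 2 ≤ sin t ^ 2 := by
        have a1 : sin (π / 4) ≤ sin t := sin_le_sin_of_le_of_le_pi_div_two (by linarith [pi_pos]) ht.2 ht.1
        rw [sin_pi_div_four] at a1
        have : (√2 / 2) ^ 2 ≤ sin t ^ 2 := by gcongr
        rw [div_pow, Real.sq_sqrt (by norm_num)] at this
        linarith
      have hs0 : 0 < sin t := by linarith
      have hF := (pwF hA hc hn0 hl hp (t := t) (by linarith [pi_pos, ht.1]) ht.2 (by
        apply le_trans _ hst
        rw [div_le_iff₀ hn0]; linarith)).2.2.2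
      have hF' : exp (-1) * pF l n p (π / 2) ≤ pF l n p t := by
        calc exp (-1) * pF l n p (π / 2) ≤ exp (-1) * (exp 1 * pF l n p t) := by gcongr
          _ = _ := by rw [← mul_assoc, ← exp_add]; simp
      refine hF'.trans ?_
      have es : (sin t) ^ (2 * l) = ((sin t) ^ l) ^ 2 := by
        rw [mul_comm, rpow_mul hs0.le]; norm_num
      rw [hR]
      simp only [pF, pU1, pU, pPhi, es]
      have ecot : (cos t / sin t) ^ 2 ≤ 1 := by
        rw [div_pow, div_le_one (by positivity)]
        have := sin_sq_add_cos_sq t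
        linarith
      have ephi : (n + l) ^ 2 + l * (1 - l) / sin t ^ 2 ≤ ((1 + l) ^ 2 + 2 * A) * n ^ 2 := by
        have a1 : l * (1 - l) / sin t ^ 2 ≤ 2 * A := by
          rw [div_le_iff₀ (by positivity)]
          have := le_abs_self (l * (1 - l))
          rw [← hA] at this
          nlinarith
        have a2 : n + l ≤ (1 + l) * n := by nlinarith
        have a3 : (n + l) ^ 2 ≤ ((1 + l) * n) ^ 2 := by gcongr
        have a4 : 2 * A ≤ 2 * A * n ^ 2 := by nlinarith [mul_nonneg hA0 (by nlinarith : 0 ≤ n ^ 2 - 1)]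
        linarith
      refine (pw_alg hn1 ecot ephi).trans (le_of_eq ?_)
      rw [hC1]; ring
    have hint : (π / 2 - π / 4) * (exp (-1) * pF l n p (π / 2)) ≤ C2 * n ^ 2 := by
      calc (π / 2 - π / 4) * (exp (-1) * pF l n p (π / 2))
          = ∫ t in (π / 4)..(π / 2), exp (-1) * pF l n p (π / 2) := by rw [intervalIntegral.integral_const, smul_eq_mul]
        _ ≤ ∫ t in (π / 4)..(π / 2), R t :=
            intervalIntegral.integral_mono_on (by linarith [pi_pos]) (by simp) (cR.intervalIntegrable _ _) hlow
        _ ≤ ∫ t in (0:ℝ)..π, R t := by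
            apply intervalIntegral.integral_mono_interval (by linarith [pi_pos]) (by linarith [pi_pos]) (by linarith [pi_pos]) _ (cR.intervalIntegrable _ _)
            filter_upwards [ae_restrict_mem measurableSet_Ioc] with x hx
            exact hR0 x ⟨hx.1.le, hx.2⟩
        _ ≤ _ := hRi
    have e : pF l n p (π / 2) = exp 1 * 4 / π * ((π / 2 - π / 4) * (exp (-1) * pF l n p (π / 2))) := by
      rw [exp_neg]; field_simp; ring
    rw [e, mul_assoc (exp 1 * 4 / π)]
    gcongr
  obtain ⟨f1, f2, f3, f4⟩ := pwF hA hc hn0 hl hp h0 h1 hs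
  have f5 : pF l n p t ≤ exp 1 * (exp 1 * 4 / π * C2) * n ^ 2 := by
    calc _ ≤ _ := f3
      _ ≤ exp 1 * (exp 1 * 4 / π * C2 * n ^ 2) := by gcongr
      _ = _ := by ring
  constructor
  · have : n ^ 2 / 2 * pU l p t ^ 2 ≤ n ^ 2 / 2 * (2 * (exp 1 * (exp 1 * 4 / π * C2))) := by linarith
    exact le_of_mul_le_mul_left this (by positivity)
  · have : 0 ≤ exp 1 * (exp 1 * 4 / π * C2) * n ^ 2 := by positivity
    linarith

end

section

lemma pwIn {l n t1 : ℝ} {p : Polynomial ℝ} (hl : 0 < l) (hn : 0 < n) (hp : PODE l n p) (ht1 : 0 < t1)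
    (h1 : t1 ≤ π / 2) (h2 : n * (n + 2 * l) * t1 ^ 2 ≤ 1 / 2) :
    ∀ t ∈ Set.Icc 0 t1, |p.eval (cos t)| ≤ 2 * |p.eval (cos t1)| := by
  obtain ⟨x, hx, hxm⟩ := isCompact_Icc.exists_isMaxOn (Set.nonempty_Icc.2 ht1.le)
    (continuous_abs.comp (cont_eval_cos p)).continuousOn
  set M := |p.eval (cos x)| with hM
  have hMt : ∀ t ∈ Set.Icc 0 t1, |p.eval (cos t)| ≤ M := fun t ht => hxm ht
  have hM0 : 0 ≤ M := abs_nonneg _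
  set ν := n * (n + 2 * l) with hν
  have hν0 : 0 < ν := by positivity
  have hW : ∀ t, 0 < sin t → HasDerivAt (fun t => (sin t) ^ (2 * l + 1) * p.derivative.eval (cos t))
      (ν * (sin t) ^ (2 * l) * p.eval (cos t)) t := by
    intro t ht
    have := (hasDeriv_sin_rpow (a := 2 * l + 1) (by linarith) t).mul (hasDeriv_eval_cos p.derivative t)
    refine this.congr_deriv ?_
    have e := hp (cos t)
    have e3 : 1 - cos t ^ 2 = sin t ^ 2 := by rw [← sin_sq_add_cos_sq t]; ring
    rw [e3] at e
    have e1 : sin t ^ (2 * l + 1 - 1) = sin t ^ (2 * l) := by ring_nf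
    have e2 : sin t ^ (2 * l + 1) = sin t ^ (2 * l) * sin t := by rw [rpow_add ht, rpow_one]
    rw [e1, e2]
    linear_combination (-(sin t ^ (2 * l))) * e
  have hB : ∀ t, 0 < sin t → HasDerivAt (fun t => ν * M * (t * (sin t) ^ (2 * l)))
      (ν * M * (1 * (sin t) ^ (2 * l) + t * (2 * l * ((sin t) ^ (2 * l) / sin t) * cos t))) t := by
    intro t ht
    exact (((hasDerivAt_id t).mul (hasDeriv_sin_rpow' (2 * l) ht)).const_mul (ν * M))
  have hsin : ∀ t ∈ Set.Ioc 0 t1, 0 < sin t := fun t ht =>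
    sin_pos_of_pos_of_lt_pi ht.1 (by linarith [ht.2, pi_pos])
  have hcos : ∀ t ∈ Set.Ioc 0 t1, 0 ≤ cos t := fun t ht =>
    cos_nonneg_of_neg_pi_div_two_le_of_le (by linarith [ht.1, pi_pos]) (by linarith [ht.2])
  have cW : Continuous (fun t => (sin t) ^ (2 * l + 1) * p.derivative.eval (cos t)) :=
    (cont_sin_rpow (by linarith)).mul (cont_eval_cos _)
  have cB : Continuous (fun t => ν * M * (t * (sin t) ^ (2 * l))) :=
    continuous_const.mul (continuous_id.mul (cont_sin_rpow (by linarith)))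
  have hder : ∀ t ∈ Set.Ioc 0 t1, |ν * (sin t) ^ (2 * l) * p.eval (cos t)| ≤
      ν * M * (1 * (sin t) ^ (2 * l) + t * (2 * l * ((sin t) ^ (2 * l) / sin t) * cos t)) := by
    intro t ht
    have hs := hsin t ht
    have hc := hcos t ht
    have h3 := hMt t ⟨ht.1.le, ht.2⟩
    have ht0 := ht.1
    rw [abs_mul, abs_of_pos (by positivity : 0 < ν * (sin t) ^ (2 * l))]
    have a1 : ν * (sin t) ^ (2 * l) * |p.eval (cos t)| ≤ ν * (sin t) ^ (2 * l) * M := by gcongr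
    have a2 : 0 ≤ ν * M * (t * (2 * l * ((sin t) ^ (2 * l) / sin t) * cos t)) := by positivity
    linarith
  have hWB : ∀ t ∈ Set.Icc 0 t1, |(sin t) ^ (2 * l + 1) * p.derivative.eval (cos t)| ≤ ν * M * (t * (sin t) ^ (2 * l)) := by
    intro t ht
    have z : (0:ℝ) ∈ Set.Icc 0 t1 := ⟨le_rfl, ht1.le⟩
    have sub : ∀ y ∈ interior (Set.Icc 0 t1), y ∈ Set.Ioc 0 t1 := by
      intro y hy; rw [interior_Icc] at hy; exact ⟨hy.1, hy.2.le⟩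
    have m1 : MonotoneOn (fun t => ν * M * (t * (sin t) ^ (2 * l)) - (sin t) ^ (2 * l + 1) * p.derivative.eval (cos t)) (Set.Icc 0 t1) := by
      apply monotoneOn_of_hasDerivWithinAt_nonneg (convex_Icc _ _) (cB.sub cW).continuousOn
        (fun y hy => ((hB y (hsin y (sub y hy))).sub (hW y (hsin y (sub y hy)))).hasDerivWithinAt)
      intro y hy
      linarith [(abs_le.1 (hder y (sub y hy))).2]
    have m2 : MonotoneOn (fun t => ν * M * (t * (sin t) ^ (2 * l)) + (sin t) ^ (2 * l + 1) * p.derivative.eval (cos t)) (Set.Icc 0 t1) := by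
      apply monotoneOn_of_hasDerivWithinAt_nonneg (convex_Icc _ _) (cB.add cW).continuousOn
        (fun y hy => ((hB y (hsin y (sub y hy))).add (hW y (hsin y (sub y hy)))).hasDerivWithinAt)
      intro y hy
      linarith [(abs_le.1 (hder y (sub y hy))).1]
    have q1 := m1 z ht ht.1
    have q2 := m2 z ht ht.1
    simp only [sin_zero, zero_rpow (by positivity : 2 * l + 1 ≠ 0), zero_mul, mul_zero, sub_zero, add_zero] at q1 q2
    rw [abs_le]; constructor <;> linarith
  have hY' : ∀ t ∈ Set.Icc 0 t1, ‖-(sin t * p.derivative.eval (cos t))‖ ≤ ν * M * t1 := by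
    intro t ht
    rcases ht.1.eq_or_lt with h | h
    · subst h; simp; positivity
    have hs := hsin t ⟨h, ht.2⟩
    have h4 := hWB t ht
    rw [rpow_add hs, rpow_one, mul_assoc, abs_mul, abs_of_pos (by positivity : 0 < (sin t) ^ (2 * l))] at h4
    rw [norm_neg, Real.norm_eq_abs]
    have h5 : (sin t) ^ (2 * l) * |sin t * p.derivative.eval (cos t)| ≤ (sin t) ^ (2 * l) * (ν * M * t) := by linarith
    have h6 := le_of_mul_le_mul_left h5 (by positivity)
    refine h6.trans ?_
    have := ht.2
    gcongr
  have hmv := (convex_Icc (0:ℝ) t1).norm_image_sub_le_of_norm_hasDerivWithin_le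
    (fun t _ => (hasDeriv_eval_cos p t).hasDerivWithinAt) hY' (⟨ht1.le, le_rfl⟩ : t1 ∈ Set.Icc 0 t1) hx
  rw [Real.norm_eq_abs, Real.norm_eq_abs] at hmv
  have hxt : |x - t1| ≤ t1 := by rw [abs_le]; constructor <;> linarith [hx.1, hx.2]
  have h7 : ν * M * t1 * |x - t1| ≤ ν * M * t1 * t1 := by gcongr
  have h8 : ν * M * t1 * t1 ≤ M / 2 := by nlinarith
  have h9 := abs_sub_abs_le_abs_sub (p.eval (cos x)) (p.eval (cos t1))
  intro t ht
  have := hMt t ht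
  linarith

lemma pwG {l n t t0 : ℝ} {p : Polynomial ℝ} (hl : 0 < l) (hn : 0 < n) (hp : PODE l n p) (ht : 0 < t)
    (htt : t ≤ t0) (h0 : t0 ≤ π / 2) :
    ((sin t * p.derivative.eval (cos t)) ^ 2 + n * (n + 2 * l) * p.eval (cos t) ^ 2) * (sin t) ^ (4 * l) ≤
    ((sin t0 * p.derivative.eval (cos t0)) ^ 2 + n * (n + 2 * l) * p.eval (cos t0) ^ 2) * (sin t0) ^ (4 * l) := by
  have hs : ∀ x ∈ Set.Icc t t0, 0 < sin x := fun x hx =>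
    sin_pos_of_pos_of_lt_pi (by linarith [hx.1]) (by linarith [hx.2, pi_pos])
  have hc : ∀ x ∈ Set.Icc t t0, 0 ≤ cos x := fun x hx =>
    cos_nonneg_of_neg_pi_div_two_le_of_le (by linarith [hx.1]) (by linarith [hx.2])
  have := (gron (F := fun t => (sin t * p.derivative.eval (cos t)) ^ 2 + n * (n + 2 * l) * p.eval (cos t) ^ 2)
    (F' := fun t => - (4 * l * (cos t / sin t) * (sin t * p.derivative.eval (cos t)) ^ 2))
    (E := fun t => Real.log (sin t) * (4 * l)) (E' := fun t => cos t / sin t * (4 * l)) htt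
    (fun x hx => by
      have h3 := hs x hx
      have := (((Real.hasDerivAt_sin x).mul (hasDeriv_eval_cos p.derivative x)).pow 2).add
        (((hasDeriv_eval_cos p x).pow 2).const_mul (n * (n + 2 * l)))
      refine this.congr_deriv ?_
      have e := hp (cos x)
      have e3 : 1 - cos x ^ 2 = sin x ^ 2 := by rw [← sin_sq_add_cos_sq x]; ring
      rw [e3] at e
      simp only [Pi.mul_apply]
      field_simp
      push_cast
      linear_combination (-2 * sin x * p.derivative.eval (cos x)) * e)
    (fun x hx => ((Real.hasDerivAt_sin x).log (hs x hx).ne').mul_const _)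
    (fun x hx => by
      have h3 := hs x hx
      have h4 := hc x hx
      rw [abs_neg, abs_of_nonneg (by positivity)]
      have : 0 ≤ cos x / sin x * (4 * l) * (n * (n + 2 * l) * p.eval (cos x) ^ 2) := by positivity
      linarith)).1
  rw [rpow_def_of_pos (hs t ⟨le_rfl, htt⟩), rpow_def_of_pos (hs t0 ⟨htt, le_rfl⟩)]
  exact this

end

section

set_option maxHeartbeats 1000000 in
lemma pwB {l : ℝ} (hl : 0 < l) {κ : ℝ} (hκ : 0 < κ) : ∃ C c : ℝ, 0 < C ∧ 1 ≤ c ∧ ∀ (n : ℝ) (p : Polynomial ℝ),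
    2 * c ≤ n → PODE l n p →
    (∫ t in (0:ℝ)..π, p.eval (cos t) ^ 2 * (sin t) ^ (2 * l)) ≤ κ →
    (∫ t in (0:ℝ)..π, (sin t * p.derivative.eval (cos t)) ^ 2 * (sin t) ^ (2 * l)) ≤ n * (n + 2 * l) * κ →
    ∀ t, 0 ≤ t → t ≤ π / 2 → p.eval (cos t) ^ 2 * (sin t + 1 / n) ^ (2 * l) ≤ C := by
  obtain ⟨C, c, hC, hc, hA⟩ := pwA hl hκ
  set c1 := 1 / (2 * (1 + 2 * l)) with hc1
  have hc1p : 0 < c1 := by positivity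
  have hc1h : c1 ≤ 1 / 2 := by rw [hc1, div_le_div_iff₀ (by positivity) (by norm_num)]; linarith
  set C3 := (3 + 2 * l + 2 * l ^ 2) * C with hC3
  have hC3p : 0 < C3 := by positivity
  set Q := (c * π / (2 * c1)) ^ (4 * l) with hQ
  have hQp : 0 < Q := by positivity
  set K := 4 * (Q * C3) with hK
  have hKp : 0 < K := by positivity
  refine ⟨2 ^ (2 * l) * C + 2 ^ (2 * l) * K, c, by positivity, hc, ?_⟩
  intro n p hn hp hi1 hi2 t ht ht2
  have hn0 : 0 < n := by linarith
  have hB := hA n p hn hp hi1 hi2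
  have two : (0:ℝ) < 2 ^ (2 * l) := by positivity
  have sqU : ∀ x, 0 < sin x → pU l p x ^ 2 = sin x ^ (2 * l) * p.eval (cos x) ^ 2 := by
    intro x hx
    unfold pU
    rw [mul_pow, ← rpow_natCast, ← rpow_mul hx.le]; norm_num; left; ring_nf
  by_cases hst : c / n ≤ sin t
  · have hst0 : 0 < sin t := lt_of_lt_of_le (by positivity) hst
    have ht0 : 0 < t := by
      rcases ht.eq_or_lt with h | h
      · subst h; simp at hst0
      · exact h
    have h1 := (hB t ht0 ht2 hst).1
    rw [sqU t hst0] at h1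
    have h2 : 1 / n ≤ c / n := by gcongr
    have h3 : (sin t + 1 / n) ^ (2 * l) ≤ (2 * sin t) ^ (2 * l) := by
      gcongr; linarith
    rw [mul_rpow (by norm_num) hst0.le] at h3
    calc _ ≤ p.eval (cos t) ^ 2 * (2 ^ (2 * l) * sin t ^ (2 * l)) := by gcongr
      _ = 2 ^ (2 * l) * (sin t ^ (2 * l) * p.eval (cos t) ^ 2) := by ring
      _ ≤ 2 ^ (2 * l) * C := by gcongr
      _ ≤ _ := by linarith [mul_pos two hKp]
  · push Not at hst
    set s0 := c / n with hs0
    have hs0p : 0 < s0 := by positivity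
    have hs01 : s0 ≤ 1 / 2 := by rw [hs0, div_le_div_iff₀ hn0 (by norm_num)]; linarith
    set t0 := arcsin s0 with ht0
    have hsin0 : sin t0 = s0 := sin_arcsin (by linarith) (by linarith)
    have ht0p : 0 < t0 := arcsin_pos.2 hs0p
    have ht0h : t0 ≤ π / 2 := arcsin_le_pi_div_two _
    obtain ⟨b1, b2⟩ := hB t0 ht0p ht0h hsin0.ge
    rw [sqU t0 (by rw [hsin0]; exact hs0p), hsin0] at b1
    have hG0 : ((sin t0 * p.derivative.eval (cos t0)) ^ 2 + n * (n + 2 * l) * p.eval (cos t0) ^ 2) * s0 ^ (2 * l) ≤ C3 * n ^ 2 := by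
      set Y := p.eval (cos t0)
      set D := p.derivative.eval (cos t0)
      set w := s0 ^ l with hw
      have hww : s0 ^ (2 * l) = w ^ 2 := by rw [hw, ← rpow_natCast, ← rpow_mul hs0p.le]; norm_num; ring_nf
      rw [hww] at b1 ⊢
      have b2' : (w * (-(s0 * D) + l * (cos t0 / s0) * Y)) ^ 2 ≤ C * n ^ 2 := by
        have := b2; unfold pU1 at this; rw [hsin0] at this; exact this
      rw [hsin0]
      have k1 : (w * (s0 * D)) ^ 2 ≤ 2 * (w * (-(s0 * D) + l * (cos t0 / s0) * Y)) ^ 2 + 2 * (l * (cos t0 / s0) * (w * Y)) ^ 2 := by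
        have kk : ∀ u v : ℝ, u ^ 2 ≤ 2 * (-u + v) ^ 2 + 2 * v ^ 2 := by
          intro u v; nlinarith [sq_nonneg (-u + 2 * v)]
        have := kk (w * (s0 * D)) (l * (cos t0 / s0) * (w * Y))
        convert this using 3; ring
      have k2 : (l * (cos t0 / s0) * (w * Y)) ^ 2 ≤ l ^ 2 * n ^ 2 * C := by
        have : (l * (cos t0 / s0) * (w * Y)) ^ 2 = l ^ 2 * (cos t0 / s0) ^ 2 * (w ^ 2 * Y ^ 2) := by ring
        rw [this]
        have h5 : (cos t0 / s0) ^ 2 ≤ n ^ 2 := by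
          rw [div_pow, div_le_iff₀ (by positivity)]
          have : n * s0 = c := by rw [hs0]; field_simp
          have : n ^ 2 * s0 ^ 2 = c ^ 2 := by rw [← this]; ring
          rw [this]; exact (cos_sq_le_one t0).trans (one_le_pow₀ hc)
        gcongr
      have k3 : n * (n + 2 * l) ≤ (1 + 2 * l) * n ^ 2 := by
        have : 1 ≤ n := by linarith
        linarith [mul_le_mul_of_nonneg_left this (mul_pos hl hn0).le]
      have k4 : n * (n + 2 * l) * (w ^ 2 * Y ^ 2) ≤ (1 + 2 * l) * n ^ 2 * C := by gcongr
      rw [hC3]; linarith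
    have hmid : ∀ x, c1 / n ≤ x → x ≤ t0 → p.eval (cos x) ^ 2 * s0 ^ (2 * l) ≤ Q * C3 := by
      intro x hx1 hx2
      have hxp : 0 < x := lt_of_lt_of_le (by positivity) hx1
      have hg := pwG hl hn0 hp hxp hx2 ht0h
      rw [hsin0] at hg hG0
      have hsx : 0 < sin x := sin_pos_of_pos_of_lt_pi hxp (by linarith [pi_pos])
      have hsx2 : 2 / π * x ≤ sin x := mul_le_sin hxp.le (by linarith)
      have hr : s0 / sin x ≤ c * π / (2 * c1) := by
        rw [div_le_div_iff₀ hsx (by positivity)]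
        have : 2 / π * (c1 / n) ≤ sin x := le_trans (by gcongr) hsx2
        calc s0 * (2 * c1) = c * π * (2 / π * (c1 / n)) := by rw [hs0]; field_simp
          _ ≤ _ := by gcongr
      have hr2 : s0 ^ (4 * l) ≤ Q * sin x ^ (4 * l) := by
        have := rpow_le_rpow (by positivity) hr (by positivity : 0 ≤ 4 * l)
        rw [div_rpow hs0p.le hsx.le, div_le_iff₀ (by positivity)] at this
        exact this
      set G0 := ((s0 * p.derivative.eval (cos t0)) ^ 2 + n * (n + 2 * l) * p.eval (cos t0) ^ 2)
      have hG00 : 0 ≤ G0 := by positivity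
      have q1 : n * (n + 2 * l) * p.eval (cos x) ^ 2 * sin x ^ (4 * l) ≤ G0 * Q * sin x ^ (4 * l) := by
        calc _ ≤ ((sin x * p.derivative.eval (cos x)) ^ 2 + n * (n + 2 * l) * p.eval (cos x) ^ 2) * sin x ^ (4 * l) := by
              gcongr; linarith [sq_nonneg (sin x * p.derivative.eval (cos x))]
          _ ≤ _ := hg
          _ ≤ G0 * (Q * sin x ^ (4 * l)) := by gcongr
          _ = _ := by ring
      have q2 := le_of_mul_le_mul_right q1 (by positivity)
      have q3 : n ^ 2 * (p.eval (cos x) ^ 2 * s0 ^ (2 * l)) ≤ n ^ 2 * (Q * C3) := by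
        calc n ^ 2 * (p.eval (cos x) ^ 2 * s0 ^ (2 * l)) ≤ (n * (n + 2 * l)) * (p.eval (cos x) ^ 2 * s0 ^ (2 * l)) := by
              gcongr; linarith [mul_pos hn0 hl]
          _ = (n * (n + 2 * l) * p.eval (cos x) ^ 2) * s0 ^ (2 * l) := by ring
          _ ≤ (G0 * Q) * s0 ^ (2 * l) := by gcongr
          _ = Q * (G0 * s0 ^ (2 * l)) := by ring
          _ ≤ Q * (C3 * n ^ 2) := by gcongr
          _ = _ := by ring
      exact le_of_mul_le_mul_left q3 (by positivity)
    have htt0 : t ≤ t0 := by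
      by_contra h
      push Not at h
      have := sin_le_sin_of_le_of_le_pi_div_two (by linarith [pi_pos]) ht2 h.le
      linarith
    have ht1t0 : c1 / n ≤ t0 := by
      have : sin t0 ≤ t0 := sin_le ht0p.le
      have : c1 / n ≤ c / n := by gcongr; linarith
      linarith
    have hfin : p.eval (cos t) ^ 2 * s0 ^ (2 * l) ≤ K := by
      by_cases h : c1 / n ≤ t
      · have := hmid t h htt0
        have : 0 < Q * C3 := by positivity
        linarith
      · push Not at h
        have h3 := pwIn (t1 := c1 / n) hl hn0 hp (by positivity) (by linarith) (by
          have : n * (n + 2 * l) * (c1 / n) ^ 2 = (n + 2 * l) / n * c1 ^ 2 := by field_simp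
          rw [this]
          have : (n + 2 * l) / n ≤ 1 + 2 * l := by rw [div_le_iff₀ hn0]; linarith [mul_le_mul_of_nonneg_left (by linarith : 1 ≤ n) hl.le]
          calc _ ≤ (1 + 2 * l) * c1 ^ 2 := by gcongr
            _ = c1 / 2 := by rw [hc1]; field_simp
            _ ≤ _ := by linarith) t ⟨ht, h.le⟩
        have h4 := hmid (c1 / n) le_rfl ht1t0
        have h5 : p.eval (cos t) ^ 2 ≤ 4 * p.eval (cos (c1 / n)) ^ 2 := by
          rw [← sq_abs (p.eval (cos t)), ← sq_abs (p.eval (cos (c1 / n)))]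
          have := pow_le_pow_left₀ (abs_nonneg _) h3 2
          rw [mul_pow] at this; linarith
        calc _ ≤ 4 * p.eval (cos (c1 / n)) ^ 2 * s0 ^ (2 * l) := by gcongr
          _ ≤ _ := by rw [hK]; linarith
    have hsn : 0 ≤ sin t := sin_nonneg_of_nonneg_of_le_pi ht (by linarith [pi_pos])
    have h2 : 1 / n ≤ c / n := by gcongr
    have h3 : (sin t + 1 / n) ^ (2 * l) ≤ (2 * s0) ^ (2 * l) := by
      gcongr; linarith
    rw [mul_rpow (by norm_num) hs0p.le] at h3
    calc _ ≤ p.eval (cos t) ^ 2 * (2 ^ (2 * l) * s0 ^ (2 * l)) := by gcongr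
      _ = 2 ^ (2 * l) * (p.eval (cos t) ^ 2 * s0 ^ (2 * l)) := by ring
      _ ≤ 2 ^ (2 * l) * K := by gcongr
      _ ≤ _ := by linarith [mul_pos two hC]

lemma PODE_refl {l n : ℝ} {p : Polynomial ℝ} (hp : PODE l n p) : PODE l n (p.comp (-Polynomial.X)) := by
  intro x
  have := hp (-x)
  simp [Polynomial.derivative_comp] at this ⊢
  linarith

lemma int_refl (f : ℝ → ℝ) : ∫ t in (0:ℝ)..π, f (π - t) = ∫ t in (0:ℝ)..π, f t := by
  simp

lemma GSys.pw {l κ : ℝ} {L : ℕ → Polynomial ℝ} (S : GSys l κ L) : ∃ C : ℝ, 0 < C ∧ ∀ n : ℕ, ∀ t ∈ Set.Icc 0 π,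
    |(L n).eval (cos t)| * (sin t + 1 / (n + 1)) ^ l ≤ C := by
  obtain ⟨C, c, hC, hc, hB⟩ := pwB S.hl S.hκ
  have big : ∀ n : ℕ, 2 * c ≤ n → ∀ t ∈ Set.Icc 0 π, (L n).eval (cos t) ^ 2 * (sin t + 1 / n) ^ (2 * l) ≤ C := by
    intro n hn t ht
    have hk : (∫ t in (0:ℝ)..π, (L n).eval (cos t) ^ 2 * (sin t) ^ (2 * l)) = κ := by
      have := S.orth n n
      rw [if_pos rfl, gip] at this
      rw [← this]; congr 1; funext x; ring
    have he := S.energy n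
    rcases le_total t (π / 2) with h | h
    · exact hB n (L n) hn (S.ode n) hk.le he.le t ht.1 h
    · have := hB n ((L n).comp (-Polynomial.X)) hn (PODE_refl (S.ode n)) (by
        refine le_of_eq ?_
        rw [← hk, ← int_refl]; congr 1; funext x; simp) (by
        refine le_of_eq ?_
        rw [← he, ← int_refl]; congr 1; funext x; simp [Polynomial.derivative_comp]) (π - t) (by linarith [ht.2])
          (by linarith [ht.2])
      simpa using this
  obtain ⟨M, hM⟩ := exists_nat_ge (2 * c)
  have small : ∀ n : ℕ, ∃ K : ℝ, ∀ t ∈ Set.Icc 0 π, |(L n).eval (cos t)| * (sin t + 1 / (n + 1)) ^ l ≤ K := by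
    intro n
    have hc : Continuous fun t => |(L n).eval (cos t)| * (sin t + 1 / (n + 1)) ^ l :=
      (continuous_abs.comp (cont_eval_cos _)).mul ((continuous_sin.add continuous_const).rpow_const
        (fun _ => Or.inr S.hl.le))
    obtain ⟨K, hK⟩ := (isCompact_Icc.image hc).bddAbove (α := ℝ) (s := _ '' Set.Icc 0 π)
    exact ⟨K, fun t ht => hK ⟨t, ht, rfl⟩⟩
  choose K hK using small
  refine ⟨√C + ∑ k ∈ Finset.range M, |K k|, by positivity, ?_⟩
  intro n t ht
  have hs : 0 ≤ sin t := sin_nonneg_of_nonneg_of_le_pi ht.1 ht.2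
  by_cases h : n < M
  · calc _ ≤ K n := hK n t ht
      _ ≤ |K n| := le_abs_self _
      _ ≤ ∑ k ∈ Finset.range M, |K k| := Finset.single_le_sum (f := fun k => |K k|) (fun _ _ => abs_nonneg _) (Finset.mem_range.2 h)
      _ ≤ _ := by linarith [sqrt_nonneg C]
  · push Not at h
    have hn : 2 * c ≤ n := hM.trans (by exact_mod_cast h)
    have hn0 : (0:ℝ) < n := by linarith
    have h1 := big n hn t ht
    have h2 : |(L n).eval (cos t)| * (sin t + 1 / (n + 1)) ^ l ≤ √C := by
      apply le_sqrt_of_sq_le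
      refine le_trans ?_ h1
      rw [mul_pow, sq_abs]
      have e : (sin t + 1 / n) ^ (2 * l) = ((sin t + 1 / n) ^ l) ^ 2 := by
        rw [← rpow_natCast, ← rpow_mul (by positivity)]; norm_num; ring_nf
      rw [e]
      have : 1 / ((n:ℝ) + 1) ≤ 1 / n := by gcongr; linarith
      have hl := S.hl
      gcongr
    have : 0 ≤ ∑ k ∈ Finset.range M, |K k| := Finset.sum_nonneg fun _ _ => abs_nonneg _
    linarith

end

section

lemma geomC_bound (N : ℕ) (u : ℝ) (hu : |u| ≤ π) :
    ‖∑ i ∈ Finset.range N, (Complex.exp (Complex.I * u)) ^ i‖ ≤ N ∧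
    ‖∑ i ∈ Finset.range N, (Complex.exp (Complex.I * u)) ^ i‖ * |u| ≤ π := by
  have h1 : ‖Complex.exp (Complex.I * u)‖ = 1 := by rw [mul_comm]; exact Complex.norm_exp_ofReal_mul_I u
  constructor
  · refine (norm_sum_le _ _).trans ?_
    simp [h1]
  · have h := congrArg norm (mul_geom_sum (Complex.exp (Complex.I * u)) N)
    rw [norm_mul, Complex.norm_exp_I_mul_ofReal_sub_one] at h
    have h2 : ‖Complex.exp (Complex.I * u) ^ N - 1‖ ≤ 2 := by
      refine (norm_sub_le _ _).trans ?_
      simp [h1]; norm_num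
    have h3 := mul_abs_le_abs_sin (x := u / 2) (by rw [abs_div, abs_two]; linarith)
    rw [← h, norm_mul, Real.norm_eq_abs, Real.norm_eq_abs, abs_two] at h2
    rw [abs_div, abs_two] at h3
    set G := ‖∑ i ∈ Finset.range N, (Complex.exp (Complex.I * u)) ^ i‖
    have hG : 0 ≤ G := norm_nonneg _
    have h4 : 2 * (2 / π * (|u| / 2)) * G ≤ 2 := le_trans (by gcongr) h2
    have e : 2 * (2 / π * (|u| / 2)) * G = 2 * (G * |u|) / π := by field_simp
    rw [e, div_le_iff₀ pi_pos] at h4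
    linarith

open Polynomial in
lemma plateau (G : ℝ[X]) (hG : G.eval 1 = 1) (d M k : ℕ) (hd : G.natDegree ≤ d) (hk : d ≤ k) (hM : k < M) :
    ((∑ i ∈ Finset.range M, (X:ℝ[X]) ^ i) * G).coeff k = 1 := by
  rw [mul_comm, coeff_mul, Finset.Nat.sum_antidiagonal_eq_sum_range_succ_mk]
  have h2 := eval_eq_sum_range' (lt_of_le_of_lt (hd.trans hk) (Nat.lt_succ_self k)) (1:ℝ)
  rw [← hG, h2]
  apply Finset.sum_congr rfl
  intro i hi
  have : (∑ i ∈ Finset.range M, (X:ℝ[X]) ^ i).coeff (k - i) = 1 := by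
    rw [finsetSum_coeff]
    simp [coeff_X_pow]
    omega
  rw [this]; simp

set_option maxHeartbeats 400000 in
open Polynomial in
lemma kern (l : ℝ) : ∃ C : ℝ, 0 < C ∧ ∃ D : ℕ, 1 ≤ D ∧ ∀ N : ℕ, 1 ≤ N → ∃ (K a : ℕ) (R : ℕ → ℝ),
    a = D * N ∧ K = 2 * a + 1 ∧ N ≤ a ∧ (∀ k, a ≤ k + N → k ≤ a + N → R k = 1) ∧
    ∀ u : ℝ, |u| ≤ π → |∑ k ∈ Finset.range K, R k * cos (((k:ℝ) - a) * u)| * (1 + N * |u|) ^ (2 * l) ≤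
      C * (N * (1 + (N * u) ^ 2)⁻¹) := by
  obtain ⟨p, hp⟩ := exists_nat_ge (2 * l + 2)
  refine ⟨(p + 3) * (1 + π) ^ p, by positivity, p + 1, by omega, ?_⟩
  intro N hN
  have hN0 : (0:ℝ) < N := by exact_mod_cast hN
  set F : ℕ → ℝ[X] := fun M => ∑ i ∈ Finset.range M, (X:ℝ[X]) ^ i with hF
  have hFd : ∀ M, 1 ≤ M → (F M).natDegree ≤ M - 1 := by
    intro M hM
    apply natDegree_sum_le_of_forall_le
    intro i hi
    rw [natDegree_X_pow]
    have := Finset.mem_range.1 hi; omega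
  set G : ℝ[X] := (C (1 / (N:ℝ)) * F N) ^ p with hG
  have hGd : G.natDegree ≤ p * (N - 1) := by
    refine natDegree_pow_le.trans ?_
    gcongr
    exact (natDegree_C_mul_le _ _).trans (hFd N hN)
  have hG1 : G.eval 1 = 1 := by
    rw [hG, hF]; simp [eval_finsetSum]
    rw [inv_mul_cancel₀ hN0.ne']; simp
  set M := (p + 2) * N + 1 with hM
  set Q : ℝ[X] := F M * G with hQ
  have hQd : Q.natDegree < 2 * ((p + 1) * N) + 1 := by
    refine lt_of_le_of_lt natDegree_mul_le ?_
    have h1 := hFd M (by omega)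
    have h2 : p * (N - 1) ≤ p * N := by gcongr; omega
    have : (p + 2) * N + p * N = 2 * ((p + 1) * N) := by ring
    omega
  refine ⟨2 * ((p + 1) * N) + 1, (p + 1) * N, Q.coeff, rfl, rfl, by nlinarith, ?_, ?_⟩
  · intro k h1 h2
    apply plateau G hG1 (p * (N - 1)) M k hGd
    · have : p * (N - 1) ≤ p * N := by gcongr; omega
      have : (p + 1) * N = p * N + N := by ring
      omega
    · have : (p + 2) * N = (p + 1) * N + N := by ring
      omega
  · intro u hu
    set z := Complex.exp (Complex.I * u) with hz
    have hz1 : ‖z‖ = 1 := by rw [hz, mul_comm]; exact Complex.norm_exp_ofReal_mul_I u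
    set a := (p + 1) * N with ha
    have e1 : ∑ k ∈ Finset.range (2 * a + 1), Q.coeff k * cos (((k:ℝ) - a) * u) =
        (Complex.exp (-(Complex.I * (a * u))) * (Q.map (algebraMap ℝ ℂ)).eval z).re := by
      rw [eval_eq_sum_range' (lt_of_le_of_lt natDegree_map_le hQd), Finset.mul_sum, Complex.re_sum]
      apply Finset.sum_congr rfl
      intro k _
      rw [coeff_map, hz, ← Complex.exp_nat_mul, mul_left_comm, ← Complex.exp_add]
      have : -(Complex.I * (a * u)) + k * (Complex.I * u) = (((((k:ℝ) - a) * u : ℝ)) : ℂ) * Complex.I := by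
        push_cast; ring
      rw [this]
      simp only [Complex.coe_algebraMap, Complex.re_ofReal_mul, Complex.exp_ofReal_mul_I_re]
    have e2 : (Q.map (algebraMap ℝ ℂ)).eval z = (∑ i ∈ Finset.range M, z ^ i) * ((1 / N : ℂ) * ∑ i ∈ Finset.range N, z ^ i) ^ p := by
      rw [hQ, hG, hF]
      simp [Polynomial.eval_finsetSum, Polynomial.map_sum, Polynomial.eval_mul]
    have e3 : |∑ k ∈ Finset.range (2 * a + 1), Q.coeff k * cos (((k:ℝ) - a) * u)| ≤
        ‖∑ i ∈ Finset.range M, z ^ i‖ * (‖∑ i ∈ Finset.range N, z ^ i‖ / N) ^ p := by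
      rw [e1]
      refine (Complex.abs_re_le_norm _).trans ?_
      have : ‖Complex.exp (-(Complex.I * (a * u)))‖ = 1 := by
        have := Complex.norm_exp_ofReal_mul_I (-(a * u))
        rw [← this]; congr 2; push_cast; ring
      rw [norm_mul, this, one_mul, e2, norm_mul, norm_pow, norm_mul]
      simp [div_eq_inv_mul]
    obtain ⟨f1, f2⟩ := geomC_bound N u hu
    obtain ⟨g1, -⟩ := geomC_bound M u hu
    rw [← hz] at f1 f2 g1
    set A := ‖∑ i ∈ Finset.range N, z ^ i‖
    have hA : 0 ≤ A := norm_nonneg _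
    have y0 : 0 ≤ N * |u| := by positivity
    have k1 : A / N * (1 + N * |u|) ≤ 1 + π := by
      rw [div_mul_eq_mul_div, div_le_iff₀ hN0]
      nlinarith
    have k2 : (A / N) ^ p * (1 + N * |u|) ^ p ≤ (1 + π) ^ p := by
      rw [← mul_pow]; gcongr
    have k3 : (1 + N * |u|) ^ (2 * l) * (1 + (N * u) ^ 2) ≤ (1 + N * |u|) ^ p := by
      calc (1 + N * |u|) ^ (2 * l) * (1 + (N * u) ^ 2) ≤ (1 + N * |u|) ^ (2 * l) * (1 + N * |u|) ^ (2:ℝ) := by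
            gcongr
            rw [rpow_two, mul_pow, ← sq_abs u]; nlinarith
        _ = (1 + N * |u|) ^ (2 * l + 2) := by rw [← rpow_add (by positivity)]
        _ ≤ (1 + N * |u|) ^ (p:ℝ) := rpow_le_rpow_of_exponent_le (by linarith) hp
        _ = _ := rpow_natCast _ _
    have hM' : (M:ℝ) ≤ (p + 3) * N := by
      have : (1:ℝ) ≤ N := by exact_mod_cast hN
      rw [hM]; push_cast; nlinarith
    rw [← div_eq_mul_inv, mul_div_assoc', le_div_iff₀ (by positivity)]
    calc _ ≤ (M * (A / N) ^ p) * (1 + N * |u|) ^ (2 * l) * (1 + (N * u) ^ 2) := by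
            gcongr
            exact e3.trans (by gcongr)
      _ = M * ((A / N) ^ p * ((1 + N * |u|) ^ (2 * l) * (1 + (N * u) ^ 2))) := by ring
      _ ≤ M * ((A / N) ^ p * (1 + N * |u|) ^ p) := by gcongr
      _ ≤ ((p + 3) * N) * (1 + π) ^ p := by gcongr
      _ = _ := by ring

end

section

def vker (K a : ℕ) (R : ℕ → ℝ) (u : ℝ) : ℝ := ∑ k ∈ Finset.range K, R k * cos (((k:ℝ) - a) * u)

def vop (K a : ℕ) (R : ℕ → ℝ) (h : ℝ → ℝ) : Polynomial ℝ :=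
  ∑ k ∈ Finset.range K, Polynomial.C (R k * ((1 / (2 * π)) * ∫ u in (-π)..π, h u * cos (((k:ℝ) - a) * u))) *
    Polynomial.Chebyshev.T ℝ ((k:ℤ) - a)

lemma cont_vker (K a : ℕ) (R : ℕ → ℝ) : Continuous (vker K a R) := by unfold vker; fun_prop

lemma vop_add (K a : ℕ) (R : ℕ → ℝ) {h h' : ℝ → ℝ} (c : Continuous h) (c' : Continuous h') :
    vop K a R (fun u => h u + h' u) = vop K a R h + vop K a R h' := by
  unfold vop
  rw [← Finset.sum_add_distrib]
  apply Finset.sum_congr rfl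
  intro k _
  rw [← add_mul, ← Polynomial.C_add, ← mul_add, ← mul_add, ← intervalIntegral.integral_add]
  · simp_rw [add_mul]
  · exact Continuous.intervalIntegrable (by fun_prop) _ _
  · exact Continuous.intervalIntegrable (by fun_prop) _ _

lemma vop_smul (K a : ℕ) (R : ℕ → ℝ) (b : ℝ) (h : ℝ → ℝ)  :
    vop K a R (fun u => b * h u) = Polynomial.C b * vop K a R h := by
  unfold vop
  rw [Finset.mul_sum]
  apply Finset.sum_congr rfl
  intro k _
  rw [← mul_assoc (Polynomial.C b), ← Polynomial.C_mul]
  simp_rw [mul_assoc b]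
  rw [intervalIntegral.integral_const_mul]
  congr 2; ring

lemma vop_zero (K a : ℕ) (R : ℕ → ℝ) : vop K a R (fun _ => 0) = 0 := by
  unfold vop; simp

lemma vop_deg (a : ℕ) (R : ℕ → ℝ) (h : ℝ → ℝ) : (vop (2 * a + 1) a R h).natDegree ≤ a := by
  apply Polynomial.natDegree_sum_le_of_forall_le
  intro k hk
  refine (Polynomial.natDegree_C_mul_le _ _).trans ?_
  rw [Polynomial.Chebyshev.natDegree_T]
  have := Finset.mem_range.1 hk
  omega

lemma int_odd_zero (f : ℝ → ℝ) (hf : ∀ x, f (-x) = - f x) : ∫ u in (-π)..π, f u = 0 := by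
  have := intervalIntegral.integral_comp_neg (a := -π) (b := π) f
  simp_rw [hf] at this
  rw [intervalIntegral.integral_neg, neg_neg] at this
  linarith

lemma vop_eval (K a : ℕ) (R : ℕ → ℝ) {h : ℝ → ℝ} (c : Continuous h) (he : ∀ x, h (-x) = h x) (t : ℝ) :
    (vop K a R h).eval (cos t) = (1 / (2 * π)) * ∫ u in (-π)..π, h u * vker K a R (t - u) := by
  unfold vop vker
  rw [Polynomial.eval_finsetSum]
  simp_rw [Finset.mul_sum]
  rw [intervalIntegral.integral_finsetSum (fun k _ => Continuous.intervalIntegrable (by fun_prop) _ _), Finset.mul_sum]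
  apply Finset.sum_congr rfl
  intro k _
  rw [Polynomial.eval_mul, Polynomial.eval_C, Polynomial.Chebyshev.T_real_cos]
  have e : ∀ u, h u * (R k * cos (((k:ℝ) - a) * (t - u))) =
      (R k * cos (((k:ℝ) - a) * t)) * (h u * cos (((k:ℝ) - a) * u)) +
      (R k * sin (((k:ℝ) - a) * t)) * (h u * sin (((k:ℝ) - a) * u)) := by
    intro u; rw [mul_sub, cos_sub]; ring
  simp_rw [e]
  rw [intervalIntegral.integral_add (Continuous.intervalIntegrable (by fun_prop) _ _)
    (Continuous.intervalIntegrable (by fun_prop) _ _), intervalIntegral.integral_const_mul,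
    intervalIntegral.integral_const_mul, int_odd_zero (fun u => h u * sin (((k:ℝ) - a) * u))]
  · push_cast; ring
  · intro x; rw [he, mul_neg, sin_neg]; ring

lemma vker_periodic (K a : ℕ) (R : ℕ → ℝ) : Function.Periodic (vker K a R) (2 * π) := by
  intro u
  unfold vker
  apply Finset.sum_congr rfl
  intro k _
  have := Real.cos_add_int_mul_two_pi (((k:ℝ) - a) * u) ((k:ℤ) - a)
  rw [← this]; push_cast; ring_nf

lemma int_shift {f : ℝ → ℝ} (hf : Function.Periodic f (2 * π)) (t : ℝ) :
    ∫ u in (-π)..π, f (u + t) = ∫ u in (-π)..π, f u := by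
  rw [intervalIntegral.integral_comp_add_right]
  have := hf.intervalIntegral_add_eq (-π + t) (-π)
  ring_nf at this ⊢
  exact this

lemma vop_conv (K a : ℕ) (R : ℕ → ℝ) {h : ℝ → ℝ} (c : Continuous h) (he : ∀ x, h (-x) = h x)
    (hp : Function.Periodic h (2 * π)) (t : ℝ) :
    (vop K a R h).eval (cos t) = (1 / (2 * π)) * ∫ u in (-π)..π, h (t - u) * vker K a R u := by
  rw [vop_eval K a R c he]
  congr 1
  have e : ∫ u in (-π)..π, h (t - u) * vker K a R u = ∫ u in (-π)..π, h (t + u) * vker K a R (-u) := by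
    rw [← neg_neg π, ← intervalIntegral.integral_comp_neg (fun u => h (t - u) * vker K a R u)]
    simp
  rw [e, ← int_shift (f := fun u => h u * vker K a R (t - u)) ?_ t]
  · congr 1; funext u; ring_nf
  · intro u
    simp only
    rw [hp u, ← (vker_periodic K a R) (t - (u + 2 * π))]; ring_nf

lemma int_cos_int (m : ℤ) : ∫ u in (-π)..π, cos (m * u) = if m = 0 then 2 * π else 0 := by
  split_ifs with h
  · subst h; simp; ring
  · have : (m:ℝ) ≠ 0 := by exact_mod_cast h
    rw [intervalIntegral.integral_comp_mul_left (fun x => cos x) this, integral_cos]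
    simp

lemma vop_T (a N : ℕ) (R : ℕ → ℝ) (hN : N ≤ a) (hR : ∀ k, a ≤ k + N → k ≤ a + N → R k = 1)
    (j : ℕ) (hj : j ≤ N) :
    vop (2 * a + 1) a R (fun t => (Polynomial.Chebyshev.T ℝ (j:ℤ)).eval (cos t)) = Polynomial.Chebyshev.T ℝ (j:ℤ) := by
  unfold vop
  have hc : ∀ k : ℕ, (1 / (2 * π)) * ∫ u in (-π)..π, (Polynomial.Chebyshev.T ℝ (j:ℤ)).eval (cos u) * cos (((k:ℝ) - a) * u)
      = (if k = a + j then 1 / 2 else 0) + (if k = a - j then 1 / 2 else 0) := by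
    intro k
    have e : ∀ u, (Polynomial.Chebyshev.T ℝ (j:ℤ)).eval (cos u) * cos (((k:ℝ) - a) * u) =
      1 / 2 * cos (((k:ℤ) - (a + j : ℤ) : ℤ) * u) + 1 / 2 * cos (((k:ℤ) - (a:ℤ) + j : ℤ) * u) := by
      intro u
      rw [Polynomial.Chebyshev.T_real_cos]
      have h1 : (((k:ℤ) - (a + j : ℤ) : ℤ) : ℝ) * u = ((k:ℝ) - a) * u - j * u := by push_cast; ring
      have h2 : (((k:ℤ) - (a:ℤ) + j : ℤ) : ℝ) * u = ((k:ℝ) - a) * u + j * u := by push_cast; ring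
      rw [h1, h2, cos_sub, cos_add]; push_cast; ring
    simp_rw [e]
    rw [intervalIntegral.integral_add (Continuous.intervalIntegrable (by fun_prop) _ _)
      (Continuous.intervalIntegrable (by fun_prop) _ _), intervalIntegral.integral_const_mul,
      intervalIntegral.integral_const_mul, int_cos_int, int_cos_int]
    have a1 : ((k:ℤ) - (a + j : ℤ) = 0) ↔ k = a + j := by omega
    have a2 : ((k:ℤ) - (a:ℤ) + j = 0) ↔ k = a - j := by omega
    simp_rw [a1, a2]
    have := pi_pos
    rw [mul_add]
    congr 1 <;> split_ifs <;> field_simp <;> simp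
  simp_rw [hc, mul_add, Polynomial.C_add, add_mul, Finset.sum_add_distrib]
  rw [Finset.sum_eq_single_of_mem (a + j) (Finset.mem_range.2 (by omega)),
    Finset.sum_eq_single_of_mem (a - j) (Finset.mem_range.2 (by omega))]
  · rw [if_pos rfl, if_pos rfl, hR _ (by omega) (by omega), hR _ (by omega) (by omega)]
    have e1 : (((a + j : ℕ) : ℤ) - a) = j := by push_cast; ring
    have e2 : (((a - j : ℕ) : ℤ) - a) = -(j:ℤ) := by omega
    rw [e1, e2, Polynomial.Chebyshev.T_neg, ← add_mul, ← Polynomial.C_add]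
    norm_num
  · intro b _ hb; rw [if_neg hb]; simp
  · intro b _ hb; rw [if_neg hb]; simp

lemma vop_sum (K a : ℕ) (R : ℕ → ℝ) {ι : Type*} (s : Finset ι) (h : ι → ℝ → ℝ) (hc : ∀ i, Continuous (h i)) :
    vop K a R (fun u => ∑ i ∈ s, h i u) = ∑ i ∈ s, vop K a R (h i) := by
  classical
  induction s using Finset.induction_on with
  | empty => simpa using vop_zero K a R
  | insert i s hi ih =>
    simp_rw [Finset.sum_insert hi]
    rw [vop_add K a R (hc i) (continuous_finsetSum _ (fun i _ => hc i)), ih]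

lemma vop_repro (a N : ℕ) (R : ℕ → ℝ) (hN : N ≤ a) (hR : ∀ k, a ≤ k + N → k ≤ a + N → R k = 1)
    (e : Polynomial ℝ) (he : e.natDegree ≤ N) :
    vop (2 * a + 1) a R (fun t => e.eval (cos t)) = e := by
  obtain ⟨b, hb⟩ := seq_span (fun j : ℕ => Polynomial.Chebyshev.T ℝ (j:ℤ)) (fun n => by
    rw [Polynomial.Chebyshev.natDegree_T]; simp) (fun n h => by
    have := Polynomial.Chebyshev.T_eval_one (R := ℝ) (n:ℤ)
    rw [h] at this; simp at this) (N + 1) e (lt_of_le_of_lt Polynomial.degree_le_natDegree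
      (by exact_mod_cast Nat.lt_succ_of_le he))
  have : (fun t => e.eval (cos t)) = fun t => ∑ k ∈ Finset.range (N + 1), b k * (Polynomial.Chebyshev.T ℝ (k:ℤ)).eval (cos t) := by
    funext t
    conv_lhs => rw [hb]
    rw [Polynomial.eval_finsetSum]; simp
  rw [this, vop_sum _ _ _ _ (fun k t => b k * (Polynomial.Chebyshev.T ℝ (k:ℤ)).eval (cos t)) (fun i => continuous_const.mul (cont_eval_cos _))]
  conv_rhs => rw [hb]
  apply Finset.sum_congr rfl
  intro k hk
  rw [vop_smul, vop_T a N R hN hR k (by have := Finset.mem_range.1 hk; omega)]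

end

section

lemma csw {a b : ℝ} (hab : a ≤ b) {f w : ℝ → ℝ} (hf : Continuous f) (hw : Continuous w) (h0 : ∀ x, 0 ≤ w x) :
    (∫ x in a..b, f x * w x) ^ 2 ≤ (∫ x in a..b, w x) * ∫ x in a..b, f x ^ 2 * w x := by
  have h : ∀ y : ℝ, 0 ≤ (∫ x in a..b, w x) * (y * y) + (-2 * ∫ x in a..b, f x * w x) * y + ∫ x in a..b, f x ^ 2 * w x := by
    intro y
    have h1 : 0 ≤ ∫ x in a..b, (f x - y) ^ 2 * w x :=
      intervalIntegral.integral_nonneg hab (fun x _ => mul_nonneg (sq_nonneg _) (h0 x))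
    have e : ∀ x, (f x - y) ^ 2 * w x = w x * (y * y) + (-2 * (f x * w x)) * y + f x ^ 2 * w x := by intro x; ring
    simp_rw [e] at h1
    rw [intervalIntegral.integral_add, intervalIntegral.integral_add, intervalIntegral.integral_mul_const,
      intervalIntegral.integral_mul_const, intervalIntegral.integral_const_mul] at h1
    · exact h1
    all_goals exact Continuous.intervalIntegrable (by fun_prop) _ _
  have := discrim_le_zero h
  rw [discrim] at this
  nlinarith

lemma int_g (N : ℕ) (hN : 1 ≤ N) : ∫ u in (-π)..π, (N:ℝ) * (1 + (N * u) ^ 2)⁻¹ ≤ π := by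
  have hN0 : (0:ℝ) < N := by exact_mod_cast hN
  rw [intervalIntegral.integral_const_mul, intervalIntegral.integral_comp_mul_left (fun x => (1 + x ^ 2)⁻¹) hN0.ne',
    integral_inv_one_add_sq, smul_eq_mul, ← mul_assoc, mul_inv_cancel₀ hN0.ne', one_mul]
  linarith [arctan_lt_pi_div_two (N * π), neg_pi_div_two_lt_arctan (N * -π)]

lemma cont_g (N : ℕ) : Continuous (fun u : ℝ => (N:ℝ) * (1 + (N * u) ^ 2)⁻¹) := by
  refine continuous_const.mul (Continuous.inv₀ (by fun_prop) ?_)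
  intro x; positivity

set_option maxHeartbeats 1000000 in
lemma Vbounds {l : ℝ} (hl : 0 < l) : ∃ C : ℝ, 0 < C ∧ ∃ D : ℕ, 1 ≤ D ∧ ∀ N : ℕ, 1 ≤ N →
    ∃ V : (ℝ → ℝ) → Polynomial ℝ,
    (∀ h h', Continuous h → Continuous h' → V (fun u => h u + h' u) = V h + V h') ∧
    (∀ h, (V h).natDegree ≤ D * N) ∧
    (∀ e : Polynomial ℝ, e.natDegree ≤ N → V (fun t => e.eval (cos t)) = e) ∧
    (∀ h, Continuous h → (∀ x, h (-x) = h x) → Function.Periodic h (2 * π) →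
      (∀ H, (∀ t, |h t| ≤ H) → ∀ t, |(V h).eval (cos t)| ≤ C * H) ∧
      (∫ t in (0:ℝ)..π, (V h).eval (cos t) ^ 2 * (sin t) ^ (2 * l)) ≤
        C * ∫ t in (-π)..π, h t ^ 2 * (|sin t| + 1 / N) ^ (2 * l)) := by
  obtain ⟨C, hC, D, hD, hk⟩ := kern l
  refine ⟨C + 4 * C ^ 2, by positivity, D, hD, ?_⟩
  intro N hN
  obtain ⟨K, a, R, ha, hK, hNa, hR, hb⟩ := hk N hN
  have hN0 : (0:ℝ) < N := by exact_mod_cast hN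
  subst hK
  refine ⟨vop (2 * a + 1) a R, fun h h' c c' => vop_add _ _ _ c c', fun h => ha ▸ vop_deg a R h,
    fun e he => vop_repro a N R hNa hR e he, ?_⟩
  intro h hc he hp
  set v := vker (2 * a + 1) a R with hv
  have cv : Continuous v := cont_vker _ _ _
  have cg := cont_g N
  have hpi := pi_pos
  have hvb : ∀ u ∈ Set.Icc (-π) π, |v u| * (1 + N * |u|) ^ (2 * l) ≤ C * (N * (1 + (N * u) ^ 2)⁻¹) :=
    fun u hu => hb u (abs_le.2 hu)
  have hvb' : ∀ u ∈ Set.Icc (-π) π, |v u| ≤ C * (N * (1 + (N * u) ^ 2)⁻¹) := by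
    intro u hu
    refine le_trans ?_ (hvb u hu)
    have : 1 ≤ (1 + N * |u|) ^ (2 * l) := one_le_rpow (by have : 0 ≤ N * |u| := by positivity
                                                          linarith) (by linarith)
    nlinarith [abs_nonneg (v u)]
  have cw : Continuous fun u : ℝ => (1 + N * |u|) ^ (2 * l) :=
    Continuous.rpow_const (by fun_prop) (fun _ => Or.inr (by linarith))
  have iv2 : ∫ u in (-π)..π, |v u| * (1 + N * |u|) ^ (2 * l) ≤ C * π := by
    calc _ ≤ ∫ u in (-π)..π, C * (N * (1 + (N * u) ^ 2)⁻¹) :=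
          intervalIntegral.integral_mono_on (by linarith) ((cv.abs.mul cw).intervalIntegrable _ _)
            ((continuous_const.mul cg).intervalIntegrable _ _) hvb
      _ ≤ _ := by rw [intervalIntegral.integral_const_mul]; gcongr; exact int_g N hN
  have iv : ∫ u in (-π)..π, |v u| ≤ C * π := by
    calc _ ≤ ∫ u in (-π)..π, C * (N * (1 + (N * u) ^ 2)⁻¹) :=
          intervalIntegral.integral_mono_on (by linarith) (cv.abs.intervalIntegrable _ _)
            ((continuous_const.mul cg).intervalIntegrable _ _) hvb'
      _ ≤ _ := by rw [intervalIntegral.integral_const_mul]; gcongr; exact int_g N hN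
  have iv0 : 0 ≤ ∫ u in (-π)..π, |v u| := intervalIntegral.integral_nonneg (by linarith) (fun _ _ => abs_nonneg _)
  have hconv := vop_conv (2 * a + 1) a R hc he hp
  have habs : ∀ t, |(vop (2 * a + 1) a R h).eval (cos t)| ≤ 1 / (2 * π) * ∫ u in (-π)..π, |h (t - u)| * |v u| := by
    intro t
    rw [hconv t, abs_mul, abs_of_pos (by positivity)]
    gcongr
    refine (intervalIntegral.abs_integral_le_integral_abs (by linarith)).trans (le_of_eq ?_)
    simp_rw [abs_mul]; rfl
  have h2pi : (1:ℝ) / (2 * π) * π = 1 / 2 := by field_simp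
  refine ⟨?_, ?_⟩
  · intro H hH t
    have hH0 : 0 ≤ H := (abs_nonneg _).trans (hH 0)
    calc _ ≤ 1 / (2 * π) * ∫ u in (-π)..π, |h (t - u)| * |v u| := habs t
      _ ≤ 1 / (2 * π) * ∫ u in (-π)..π, H * |v u| := by
          gcongr
          apply intervalIntegral.integral_mono_on (by linarith) (Continuous.intervalIntegrable (by fun_prop) _ _)
            (Continuous.intervalIntegrable (by fun_prop) _ _)
          intro u _
          gcongr; exact hH _
      _ ≤ 1 / (2 * π) * (H * (C * π)) := by rw [intervalIntegral.integral_const_mul]; gcongr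
      _ = (1 / (2 * π) * π) * (C * H) := by ring
      _ = 1 / 2 * (C * H) := by rw [h2pi]
      _ ≤ _ := by
        have : 0 ≤ C * H := by positivity
        have : 0 ≤ C ^ 2 * H := by positivity
        linarith
  · set W := ∫ t in (-π)..π, h t ^ 2 * (|sin t| + 1 / N) ^ (2 * l) with hW
    have cs2 : Continuous fun t : ℝ => |sin t| ^ (2 * l) :=
      Continuous.rpow_const (by fun_prop) (fun _ => Or.inr (by linarith))
    have csN : Continuous fun t : ℝ => (|sin t| + 1 / N) ^ (2 * l) :=
      Continuous.rpow_const (by fun_prop) (fun _ => Or.inr (by linarith))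
    have hW0 : 0 ≤ W := intervalIntegral.integral_nonneg (by linarith) (fun _ _ => by positivity)
    have hsq : ∀ t, (vop (2 * a + 1) a R h).eval (cos t) ^ 2 ≤ C * ∫ u in (-π)..π, h (t - u) ^ 2 * |v u| := by
      intro t
      have i0 : 0 ≤ ∫ u in (-π)..π, h (t - u) ^ 2 * |v u| :=
        intervalIntegral.integral_nonneg (by linarith) (fun _ _ => by positivity)
      have c1 := csw (a := -π) (b := π) (by linarith) (f := fun u => |h (t - u)|) (w := fun u => |v u|) (by fun_prop) (by fun_prop)
        (fun _ => abs_nonneg _)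
      simp only [sq_abs] at c1
      calc _ = |(vop (2 * a + 1) a R h).eval (cos t)| ^ 2 := (sq_abs _).symm
        _ ≤ (1 / (2 * π) * ∫ u in (-π)..π, |h (t - u)| * |v u|) ^ 2 := by gcongr; exact habs t
        _ = (1 / (2 * π)) ^ 2 * (∫ u in (-π)..π, |h (t - u)| * |v u|) ^ 2 := by ring
        _ ≤ (1 / (2 * π)) ^ 2 * ((C * π) * ∫ u in (-π)..π, h (t - u) ^ 2 * |v u|) := by
            gcongr; exact c1.trans (by gcongr)
        _ = (1 / (2 * π) * π) * (1 / (2 * π)) * (C * ∫ u in (-π)..π, h (t - u) ^ 2 * |v u|) := by ring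
        _ ≤ 1 * (C * ∫ u in (-π)..π, h (t - u) ^ 2 * |v u|) := by
            rw [h2pi]
            gcongr
            rw [div_mul_div_comm, div_le_one (by positivity)]
            nlinarith [pi_gt_three]
        _ = _ := one_mul _
    have cJ : Continuous (Function.uncurry fun t u : ℝ => |sin t| ^ (2 * l) * (h (t - u) ^ 2 * |v u|)) := by
      have : Continuous fun z : ℝ × ℝ => |sin z.1| ^ (2 * l) := cs2.comp continuous_fst
      exact this.mul (by fun_prop)
    have cI : Continuous fun t => ∫ u in (-π)..π, |sin t| ^ (2 * l) * (h (t - u) ^ 2 * |v u|) :=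
      intervalIntegral.continuous_parametric_intervalIntegral_of_continuous' cJ _ _
    have cJ' : Continuous (Function.uncurry fun u t : ℝ => |sin t| ^ (2 * l) * (h (t - u) ^ 2 * |v u|)) := by
      have : Continuous fun z : ℝ × ℝ => |sin z.2| ^ (2 * l) := cs2.comp continuous_snd
      exact this.mul (by fun_prop)
    have cI2 : Continuous fun u => ∫ t in (-π)..π, |sin t| ^ (2 * l) * (h (t - u) ^ 2 * |v u|) :=
      intervalIntegral.continuous_parametric_intervalIntegral_of_continuous'
        (f := fun u t : ℝ => |sin t| ^ (2 * l) * (h (t - u) ^ 2 * |v u|)) cJ' _ _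
    have s1 : (∫ t in (0:ℝ)..π, (vop (2 * a + 1) a R h).eval (cos t) ^ 2 * (sin t) ^ (2 * l)) ≤
        ∫ t in (0:ℝ)..π, C * ∫ u in (-π)..π, |sin t| ^ (2 * l) * (h (t - u) ^ 2 * |v u|) := by
      have cP : Continuous fun t => (vop (2 * a + 1) a R h).eval (cos t) ^ 2 * (sin t) ^ (2 * l) :=
        ((cont_eval_cos (vop (2 * a + 1) a R h)).pow 2).mul (cont_sin_rpow (by linarith))
      apply intervalIntegral.integral_mono_on hpi.le (cP.intervalIntegrable _ _)
        ((continuous_const.mul cI).intervalIntegrable _ _)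
      intro t ht
      have hs : 0 ≤ sin t := sin_nonneg_of_nonneg_of_le_pi ht.1 ht.2
      simp only [Pi.mul_apply]
      rw [abs_of_nonneg hs, intervalIntegral.integral_const_mul]
      calc _ ≤ (C * ∫ u in (-π)..π, h (t - u) ^ 2 * |v u|) * (sin t) ^ (2 * l) := by gcongr; exact hsq t
        _ = _ := by ring
    have s2 : (∫ t in (0:ℝ)..π, C * ∫ u in (-π)..π, |sin t| ^ (2 * l) * (h (t - u) ^ 2 * |v u|)) ≤
        C * ∫ t in (-π)..π, ∫ u in (-π)..π, |sin t| ^ (2 * l) * (h (t - u) ^ 2 * |v u|) := by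
      rw [intervalIntegral.integral_const_mul]
      gcongr
      apply intervalIntegral.integral_mono_interval (by linarith) hpi.le le_rfl _ (cI.intervalIntegrable _ _)
      refine Filter.Eventually.of_forall fun t => ?_
      exact intervalIntegral.integral_nonneg (by linarith) (fun _ _ => by positivity)
    have s3 : (∫ t in (-π)..π, ∫ u in (-π)..π, |sin t| ^ (2 * l) * (h (t - u) ^ 2 * |v u|)) =
        ∫ u in (-π)..π, ∫ t in (-π)..π, |sin t| ^ (2 * l) * (h (t - u) ^ 2 * |v u|) := by
      apply MeasureTheory.intervalIntegral_intervalIntegral_swap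
      have : IntegrableOn (Function.uncurry fun t u : ℝ => |sin t| ^ (2 * l) * (h (t - u) ^ 2 * |v u|))
          (Set.uIcc (-π) π ×ˢ Set.uIcc (-π) π) := cJ.continuousOn.integrableOn_compact (isCompact_uIcc.prod isCompact_uIcc)
      exact this.mono_set (Set.prod_mono Set.uIoc_subset_uIcc Set.uIoc_subset_uIcc)
    have s4 : (∫ u in (-π)..π, ∫ t in (-π)..π, |sin t| ^ (2 * l) * (h (t - u) ^ 2 * |v u|)) ≤
        ∫ u in (-π)..π, (|v u| * (1 + N * |u|) ^ (2 * l)) * W := by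
      apply intervalIntegral.integral_mono_on (by linarith) (cI2.intervalIntegrable _ _)
        (((cv.abs.mul cw).mul continuous_const).intervalIntegrable _ _)
      intro u _
      have e : ∫ t in (-π)..π, |sin t| ^ (2 * l) * (h (t - u) ^ 2 * |v u|) =
          ∫ t in (-π)..π, |sin (t + u)| ^ (2 * l) * (h t ^ 2 * |v u|) := by
        rw [← int_shift (f := fun t => |sin t| ^ (2 * l) * (h (t - u) ^ 2 * |v u|)) _ u]
        · simp
        · intro t
          simp only
          rw [sin_add_two_pi, ← hp (t - u)]; ring_nf
      simp only [Pi.mul_apply]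
      rw [e, ← intervalIntegral.integral_const_mul]
      have cc : Continuous fun t => |sin (t + u)| ^ (2 * l) := cs2.comp (continuous_id.add continuous_const)
      apply intervalIntegral.integral_mono_on (by linarith)
      · exact Continuous.intervalIntegrable (cc.mul (by fun_prop)) _ _
      · exact (continuous_const.mul ((hc.pow 2).mul csN)).intervalIntegrable _ _
      intro t _
      have h1 : |sin (t + u)| ≤ |sin t| + |u| := by
        rw [sin_add]
        calc |sin t * cos u + cos t * sin u| ≤ |sin t * cos u| + |cos t * sin u| := abs_add_le _ _
          _ = |sin t| * |cos u| + |cos t| * |sin u| := by rw [abs_mul, abs_mul]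
          _ ≤ |sin t| * 1 + 1 * |u| := by
              exact add_le_add (mul_le_mul_of_nonneg_left (abs_cos_le_one u) (abs_nonneg _))
                (mul_le_mul (abs_cos_le_one t) abs_sin_le_abs (abs_nonneg _) zero_le_one)
          _ = _ := by ring
      have h2 : |sin t| + |u| ≤ (1 + N * |u|) * (|sin t| + 1 / N) := by
        have : (1 + N * |u|) * (|sin t| + 1 / N) = |sin t| + |u| + N * |u| * |sin t| + 1 / N := by field_simp; ring
        rw [this]
        have : 0 ≤ N * |u| * |sin t| + 1 / N := by positivity
        linarith
      have h3 : |sin (t + u)| ^ (2 * l) ≤ (1 + N * |u|) ^ (2 * l) * (|sin t| + 1 / N) ^ (2 * l) := by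
        rw [← mul_rpow (by positivity) (by positivity)]
        exact rpow_le_rpow (abs_nonneg _) (h1.trans h2) (by linarith)
      calc _ ≤ (1 + N * |u|) ^ (2 * l) * (|sin t| + 1 / N) ^ (2 * l) * (h t ^ 2 * |v u|) := by gcongr
        _ = _ := by ring
    rw [intervalIntegral.integral_mul_const] at s4
    have s5 : (∫ u in (-π)..π, |v u| * (1 + N * |u|) ^ (2 * l)) * W ≤ C * π * W := by gcongr
    calc _ ≤ C * (C * π * W) := by
            refine s1.trans (s2.trans ?_)
            rw [s3]; gcongr; exact s4.trans s5
      _ = C ^ 2 * π * W := by ring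
      _ ≤ C ^ 2 * 4 * W := by gcongr; exact pi_le_four
      _ ≤ _ := by
        have : 0 ≤ C * W := by positivity
        linarith

end

section

lemma exp_avg {ι : Type*} (S : Finset ι) (w x : ι → ℝ) (hw : ∀ i ∈ S, 0 ≤ w i) (h1 : ∑ i ∈ S, w i = 1)
    (h0 : ∑ i ∈ S, w i * x i = 0) (s : ℝ) (hs0 : 0 ≤ s) (hs1 : s ≤ 1) (hx : ∀ i ∈ S, |x i| ≤ s) :
    ∑ i ∈ S, w i * exp (x i) ≤ exp (s ^ 2) := by
  have h2 : ∀ i ∈ S, w i * exp (x i) ≤ w i * (1 + s ^ 2) + w i * x i := by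
    intro i hi
    have a1 := (abs_le.1 (Real.abs_exp_sub_one_sub_id_le ((hx i hi).trans hs1))).2
    have a2 : x i ^ 2 ≤ s ^ 2 := by rw [← sq_abs (x i)]; gcongr; exact hx i hi
    rw [← mul_add]
    exact mul_le_mul_of_nonneg_left (by linarith) (hw i hi)
  calc _ ≤ ∑ i ∈ S, (w i * (1 + s ^ 2) + w i * x i) := Finset.sum_le_sum h2
    _ = 1 + s ^ 2 := by rw [Finset.sum_add_distrib, ← Finset.sum_mul, h1, h0]; ring
    _ ≤ _ := by linarith [add_one_le_exp (s ^ 2)]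

lemma cosh_avg {ι : Type*} (S : Finset ι) (w x : ι → ℝ) (hw : ∀ i ∈ S, 0 ≤ w i) (h1 : ∑ i ∈ S, w i = 1)
    (h0 : ∑ i ∈ S, w i * x i = 0) (s : ℝ) (hs0 : 0 ≤ s) (hs1 : s ≤ 1) (hx : ∀ i ∈ S, |x i| ≤ s) (X : ℝ) :
    ∑ i ∈ S, w i * cosh (X + x i) ≤ exp (s ^ 2) * cosh X := by
  have a1 := exp_avg S w x hw h1 h0 s hs0 hs1 hx
  have a2 := exp_avg S w (fun i => - x i) hw h1 (by simp [h0]) s hs0 hs1 (fun i hi => by rw [abs_neg]; exact hx i hi)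
  have e : ∑ i ∈ S, w i * cosh (X + x i) =
      (exp X * ∑ i ∈ S, w i * exp (x i) + exp (-X) * ∑ i ∈ S, w i * exp (- x i)) / 2 := by
    rw [Finset.mul_sum, Finset.mul_sum, ← Finset.sum_add_distrib, Finset.sum_div]
    apply Finset.sum_congr rfl
    intro i _
    rw [cosh_eq, neg_add, exp_add, exp_add]; ring
  rw [e, cosh_eq]
  have b1 := mul_le_mul_of_nonneg_left a1 (exp_pos X).le
  have b2 := mul_le_mul_of_nonneg_left a2 (exp_pos (-X)).le
  linarith

lemma maurey_step {ι : Type*} (S : Finset ι) (w : ι → ℝ) (ξ : ι → ℝ → ℝ) (hw : ∀ i ∈ S, 0 ≤ w i) (h1 : ∑ i ∈ S, w i = 1)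
    (h0 : ∀ t, ∑ i ∈ S, w i * ξ i t = 0) (s : ℝ) (hs0 : 0 ≤ s) (hs1 : s ≤ 1) (hx : ∀ i ∈ S, ∀ t, |ξ i t| ≤ 1)
    (hc : ∀ i, Continuous (ξ i)) (ρ X : ℝ → ℝ) (cρ : Continuous ρ) (hρ : ∀ t, 0 ≤ ρ t) (cX : Continuous X) :
    ∃ i ∈ S, ∫ t in (-π)..π, ρ t * cosh (X t + s * ξ i t) ≤ exp (s ^ 2) * ∫ t in (-π)..π, ρ t * cosh (X t) := by
  by_contra hcon
  push Not at hcon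
  set A := exp (s ^ 2) * ∫ t in (-π)..π, ρ t * cosh (X t)
  have hpi := pi_pos
  have cc : ∀ i, Continuous fun t => ρ t * cosh (X t + s * ξ i t) := fun i =>
    cρ.mul (continuous_cosh.comp (cX.add (continuous_const.mul (hc i))))
  have cc2 : ∀ i, Continuous fun t => w i * (ρ t * cosh (X t + s * ξ i t)) := fun i => continuous_const.mul (cc i)
  have h2 : ∑ i ∈ S, w i * ∫ t in (-π)..π, ρ t * cosh (X t + s * ξ i t) ≤ A := by
    simp_rw [← intervalIntegral.integral_const_mul]
    rw [← intervalIntegral.integral_finsetSum (f := fun i t => w i * (ρ t * cosh (X t + s * ξ i t)))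
      (fun i _ => (cc2 i).intervalIntegrable _ _)]
    simp only [A]
    rw [← intervalIntegral.integral_const_mul]
    apply intervalIntegral.integral_mono_on (by linarith)
    · exact (continuous_finsetSum _ fun i _ => cc2 i).intervalIntegrable _ _
    · exact (continuous_const.mul (cρ.mul (continuous_cosh.comp cX))).intervalIntegrable _ _
    intro t _
    have := cosh_avg S w (fun i => s * ξ i t) hw h1 (by
      have : ∀ i, w i * (s * ξ i t) = s * (w i * ξ i t) := fun i => by ring
      simp_rw [this, ← Finset.mul_sum, h0]; simp) s hs0 hs1 (fun i hi => by
        rw [abs_mul, abs_of_nonneg hs0]; nlinarith [hx i hi t]) (X t)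
    calc _ = ρ t * ∑ i ∈ S, w i * cosh (X t + s * ξ i t) := by
            rw [Finset.mul_sum]; apply Finset.sum_congr rfl; intro i _; ring
      _ ≤ ρ t * (exp (s ^ 2) * cosh (X t)) := mul_le_mul_of_nonneg_left this (hρ t)
      _ = _ := by ring
  have h3 : A < ∑ i ∈ S, w i * ∫ t in (-π)..π, ρ t * cosh (X t + s * ξ i t) := by
    have e : A = ∑ i ∈ S, w i * A := by rw [← Finset.sum_mul, h1, one_mul]
    conv_lhs => rw [e]
    have : ∃ i ∈ S, 0 < w i := by
      by_contra h
      push Not at h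
      have : ∑ i ∈ S, w i ≤ 0 := Finset.sum_nonpos h
      linarith
    obtain ⟨i, hi, hi0⟩ := this
    apply Finset.sum_lt_sum
    · intro j hj; exact mul_le_mul_of_nonneg_left (hcon j hj).le (hw j hj)
    · exact ⟨i, hi, mul_lt_mul_of_pos_left (hcon i hi) hi0⟩
  linarith

lemma maurey (N : ℕ) (b : ℕ → ℝ) (hb : ∑ k ∈ Finset.range N, |b k| ≤ 1) (φ : ℕ → ℝ → ℝ) (hc : ∀ k, Continuous (φ k))
    (hφ : ∀ k < N, ∀ t, |φ k t| ≤ 1 / 2) (s : ℝ) (hs0 : 0 ≤ s) (hs1 : s ≤ 1)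
    (ρ : ℝ → ℝ) (cρ : Continuous ρ) (hρ : ∀ t, 0 ≤ ρ t) (j : ℕ) :
    ∃ (c : ℕ → ℝ) (J : Finset ℕ), J ⊆ Finset.range N ∧ J.card ≤ j ∧ (∀ k, k ∉ J → c k = 0) ∧
      ∫ t in (-π)..π, ρ t * cosh (s * ∑ k ∈ Finset.range N, (c k - j * b k) * φ k t) ≤
        exp (s ^ 2 * j) * ∫ t in (-π)..π, ρ t := by
  induction j with
  | zero => exact ⟨0, ∅, by simp, by simp, by simp, by simp⟩
  | succ j ih =>
    obtain ⟨c, J, hJ, hJc, hc0, hint⟩ := ih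
    set w : ℕ → ℝ := fun k => if k < N then |b k| else 1 - ∑ k ∈ Finset.range N, |b k| with hw
    set m : ℝ → ℝ := fun t => ∑ k ∈ Finset.range N, b k * φ k t with hm
    set ξ : ℕ → ℝ → ℝ := fun k t => (if k < N then (SignType.sign (b k) : ℝ) else 0) * φ k t - m t with hξ
    have cm : Continuous m := continuous_finsetSum _ fun k _ => continuous_const.mul (hc k)
    have hsum : ∀ f : ℕ → ℝ, ∑ k ∈ Finset.range (N + 1), w k * f k =
        ∑ k ∈ Finset.range N, |b k| * f k + (1 - ∑ k ∈ Finset.range N, |b k|) * f N := by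
      intro f
      rw [Finset.sum_range_succ]
      congr 1
      · apply Finset.sum_congr rfl
        intro k hk
        simp only [hw, if_pos (Finset.mem_range.1 hk)]
      · simp [hw]
    have w1 : ∑ k ∈ Finset.range (N + 1), w k = 1 := by
      have := hsum (fun _ => 1)
      simpa using this
    have hm1 : ∀ t, |m t| ≤ 1 / 2 := by
      intro t
      refine (Finset.abs_sum_le_sum_abs _ _).trans ?_
      calc _ ≤ ∑ k ∈ Finset.range N, |b k| * (1 / 2) := by
            apply Finset.sum_le_sum
            intro k hk
            rw [abs_mul]
            exact mul_le_mul_of_nonneg_left (hφ k (Finset.mem_range.1 hk) t) (abs_nonneg _)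
        _ ≤ _ := by rw [← Finset.sum_mul]; linarith
    obtain ⟨i, hi, hstep⟩ := maurey_step (Finset.range (N + 1)) w ξ
      (fun k _ => by
        simp only [hw]; split_ifs
        · exact abs_nonneg _
        · linarith) w1
      (fun t => by
        rw [hsum]
        simp only [hξ, lt_irrefl, if_false]
        have : ∀ k ∈ Finset.range N, |b k| * ((if k < N then (SignType.sign (b k) : ℝ) else 0) * φ k t - m t) =
            b k * φ k t - |b k| * m t := by
          intro k hk
          rw [if_pos (Finset.mem_range.1 hk)]
          have := abs_mul_sign (b k)
          linear_combination (φ k t) * this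
        rw [Finset.sum_congr rfl this, Finset.sum_sub_distrib, ← Finset.sum_mul]
        simp only [hm]; ring) s hs0 hs1
      (fun k _ t => by
        simp only [hξ]
        refine (abs_sub _ _).trans ?_
        have := hm1 t
        split_ifs with h
        · have h2 := hφ k h t
          have h3 : |(SignType.sign (b k) : ℝ)| ≤ 1 := by
            rcases lt_trichotomy (b k) 0 with h | h | h <;> simp [h]
          rw [abs_mul]
          nlinarith [abs_nonneg (φ k t), abs_nonneg (SignType.sign (b k) : ℝ)]
        · simp; linarith)
      (fun k => (continuous_const.mul (hc k)).sub cm) ρ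
      (fun t => s * ∑ k ∈ Finset.range N, (c k - j * b k) * φ k t) cρ hρ
      (continuous_const.mul (continuous_finsetSum _ fun k _ => continuous_const.mul (hc k)))
    set c' : ℕ → ℝ := fun k => c k + (if k = i ∧ i < N then (SignType.sign (b i) : ℝ) else 0) with hc'
    refine ⟨c', if i < N then insert i J else J, ?_, ?_, ?_, ?_⟩
    · split_ifs with h
      · exact Finset.insert_subset (Finset.mem_range.2 h) hJ
      · exact hJ
    · split_ifs with h
      · exact (Finset.card_insert_le _ _).trans (by omega)
      · omega
    · intro k hk
      simp only [hc']
      split_ifs at hk with h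
      · rw [Finset.mem_insert, not_or] at hk
        rw [hc0 k hk.2, if_neg (fun h => hk.1 h.1)]; simp
      · rw [hc0 k hk, if_neg (fun h' => h h'.2)]; simp
    · have e : ∀ t, s * ∑ k ∈ Finset.range N, (c' k - ((j + 1 : ℕ) : ℝ) * b k) * φ k t =
          s * ∑ k ∈ Finset.range N, (c k - j * b k) * φ k t + s * ξ i t := by
        intro t
        rw [← mul_add]
        congr 1
        have : ∀ k ∈ Finset.range N, (c' k - ((j + 1 : ℕ) : ℝ) * b k) * φ k t =
            (c k - j * b k) * φ k t - b k * φ k t + (if k = i then (if i < N then (SignType.sign (b i) : ℝ) else 0) * φ i t else 0) := by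
          intro k hk
          simp only [hc']
          by_cases h1 : k = i
          · subst h1; simp [Finset.mem_range.1 hk]; ring
          · simp [h1]; ring
        rw [Finset.sum_congr rfl this, Finset.sum_add_distrib, Finset.sum_sub_distrib, Finset.sum_ite_eq']
        simp only [hξ, hm, Finset.mem_range]
        by_cases h : i < N <;> simp [h] <;> ring
      simp_rw [e]
      refine hstep.trans ?_
      calc _ ≤ exp (s ^ 2) * (exp (s ^ 2 * j) * ∫ t in (-π)..π, ρ t) := by gcongr
        _ = _ := by rw [← mul_assoc, ← exp_add]; push_cast; ring_nf

end

section

lemma GSys.pwAll {l κ : ℝ} {L : ℕ → Polynomial ℝ} (S : GSys l κ L) : ∃ C : ℝ, 0 < C ∧ ∀ k N : ℕ, k < N → ∀ t : ℝ,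
    |(L k).eval (cos t)| * (|sin t| + 1 / N) ^ l ≤ C := by
  obtain ⟨C, hC, h⟩ := S.pw
  refine ⟨C, hC, ?_⟩
  intro k N hk t
  have := h k (arccos (cos t)) ⟨arccos_nonneg _, arccos_le_pi _⟩
  rw [cos_arccos (neg_one_le_cos t) (cos_le_one t), sin_arccos, ← abs_sin_eq_sqrt_one_sub_cos_sq] at this
  refine le_trans ?_ this
  have hk' : (k:ℝ) + 1 ≤ N := by exact_mod_cast hk
  have hl := S.hl
  gcongr

lemma rho_int {p : ℝ} (hp0 : 0 < p) (hp : p < 1) : ∃ C : ℝ, 0 < C ∧ ∀ N : ℕ, 1 ≤ N →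
    ∫ t in (-π)..π, (|sin t| + 1 / N) ^ (-p) ≤ C := by
  have hpi := pi_pos
  refine ⟨4 * |∫ t in (0:ℝ)..(π / 2), (2 / π) ^ (-p) * t ^ (-p)| + 1, by positivity, ?_⟩
  intro N hN
  have hN0 : (0:ℝ) < 1 / N := by have : (0:ℝ) < N := by exact_mod_cast hN
                                 positivity
  set g : ℝ → ℝ := fun t => (|sin t| + 1 / N) ^ (-p) with hg
  have cg : Continuous g := by
    apply Continuous.rpow_const (by fun_prop)
    intro t; left; positivity
  have ii : ∀ a b, IntervalIntegrable g volume a b := fun a b => cg.intervalIntegrable _ _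
  have e1 : ∫ t in (-π)..0, g t = ∫ t in (0:ℝ)..π, g t := by
    have := intervalIntegral.integral_comp_neg (a := 0) (b := π) g
    rw [neg_zero] at this
    rw [← this]
    simp only [hg, sin_neg, abs_neg]
  have e2 : ∫ t in (π / 2)..π, g t = ∫ t in (0:ℝ)..(π / 2), g t := by
    have := intervalIntegral.integral_comp_sub_left (a := 0) (b := π / 2) g π
    rw [sub_zero, show π - π / 2 = π / 2 by ring] at this
    rw [← this]
    simp only [hg, sin_pi_sub]
  have e3 : ∫ t in (-π)..π, g t = 4 * ∫ t in (0:ℝ)..(π / 2), g t := by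
    rw [← intervalIntegral.integral_add_adjacent_intervals (ii (-π) 0) (ii 0 π), e1,
      ← intervalIntegral.integral_add_adjacent_intervals (ii 0 (π / 2)) (ii (π / 2) π), e2]
    ring
  rw [e3]
  have h4 : ∫ t in (0:ℝ)..(π / 2), g t ≤ ∫ t in (0:ℝ)..(π / 2), (2 / π) ^ (-p) * t ^ (-p) := by
    apply intervalIntegral.integral_mono_on_of_le_Ioo (by positivity) (ii _ _)
    · exact (intervalIntegral.intervalIntegrable_rpow' (by linarith)).const_mul _
    intro t ht
    have h1 := mul_le_sin ht.1.le ht.2.le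
    have h0 : 0 < 2 / π * t := mul_pos (by positivity) ht.1
    rw [← mul_rpow (by positivity) ht.1.le]
    apply rpow_le_rpow_of_nonpos h0 _ (by linarith)
    exact h1.trans ((le_abs_self _).trans (by linarith))
  linarith [le_abs_self (∫ t in (0:ℝ)..(π / 2), (2 / π) ^ (-p) * t ^ (-p))]

lemma rpow_cosh {p y : ℝ} (hp : 0 < p) (hy : 0 ≤ y) : y ^ p ≤ 2 * p ^ p * cosh y := by
  have h1 : y / p ≤ exp (y / p) := by linarith [add_one_le_exp (y / p)]
  have h2 : (y / p) ^ p ≤ exp y := by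
    calc _ ≤ (exp (y / p)) ^ p := rpow_le_rpow (by positivity) h1 hp.le
      _ = _ := by rw [← exp_mul]; congr 1; field_simp
  have h3 : exp y ≤ 2 * cosh y := by rw [cosh_eq]; linarith [exp_pos (-y)]
  rw [div_rpow hy hp.le, div_le_iff₀ (rpow_pos_of_pos hp _)] at h2
  have := mul_le_mul_of_nonneg_right h3 (rpow_pos_of_pos hp p).le
  linarith

lemma clip_props {x H a : ℝ} (hH : 0 < H) (ha : 0 < a) : |max (-H) (min H x)| ≤ H ∧
    (x - max (-H) (min H x)) ^ 2 ≤ |x| ^ (2 + a) * H ^ (-a) := by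
  have h1 : |max (-H) (min H x)| ≤ H := abs_le.2 ⟨le_max_left _ _, max_le (by linarith) (min_le_left _ _)⟩
  refine ⟨h1, ?_⟩
  by_cases hx : |x| ≤ H
  · have := abs_le.1 hx
    rw [min_eq_right this.2, max_eq_right this.1]
    simp only [sub_self, ne_eq, OfNat.ofNat_ne_zero, not_false_eq_true, zero_pow]
    positivity
  · push Not at hx
    have h2 : (x - max (-H) (min H x)) ^ 2 ≤ |x| ^ 2 := by
      rw [← sq_abs (x - _)]
      apply pow_le_pow_left₀ (abs_nonneg _)
      rcases abs_cases x with ⟨e, h⟩ | ⟨e, h⟩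
      · rw [e] at hx ⊢
        rw [min_eq_left hx.le, max_eq_right (by linarith), abs_le]; constructor <;> linarith
      · rw [e] at hx ⊢
        rw [min_eq_right (by linarith), max_eq_left (by linarith), abs_le]; constructor <;> linarith
    have hx0 : 0 < |x| := hH.trans hx
    refine h2.trans ?_
    rw [rpow_add hx0, rpow_two, rpow_neg hH.le, mul_assoc]
    have : 1 ≤ |x| ^ a * (H ^ a)⁻¹ := by
      rw [← div_eq_mul_inv, one_le_div (rpow_pos_of_pos hH _)]
      exact rpow_le_rpow hH.le hx.le ha.le
    exact le_mul_of_one_le_right (by positivity) this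

end

section

set_option maxHeartbeats 1000000 in
lemma GSys.core {l κ : ℝ} {L : ℕ → Polynomial ℝ} (S : GSys l κ L) {q : ℝ} (hq : l < q) :
    ∃ C : ℝ, 0 < C ∧ ∃ D : ℕ, 1 ≤ D ∧ ∀ N m : ℕ, 1 ≤ N → 1 ≤ m → ∀ b : ℕ → ℝ, ∑ k ∈ Finset.range N, |b k| ≤ 1 →
    ∀ δ : ℝ, 0 < δ → ∃ (c : ℕ → ℝ) (J : Finset ℕ) (P : Polynomial ℝ) (b' : ℕ → ℝ), J.card ≤ m ∧
      J ⊆ Finset.range N ∧ (∀ k, k ∉ J → c k = 0) ∧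
      ∑ k ∈ Finset.range N, Polynomial.C (b k - c k) * L k =
        P + ∑ k ∈ Finset.range (D * N), Polynomial.C (b' k) * L k ∧
      (∀ t, |P.eval (cos t)| ≤ C * ((√m)⁻¹ * (N / (m * δ ^ 2)) ^ q)) ∧
      ∑ k ∈ Finset.range (D * N), |b' k| ≤ δ := by
  have hl := S.hl
  have hκ := S.hκ
  have hq0 : 0 < q := hl.trans hq
  obtain ⟨C0, hC0, hpw⟩ := S.pwAll
  obtain ⟨Cv, hCv, D, hD, hV⟩ := Vbounds hl
  set a := 1 / q with ha
  have ha0 : 0 < a := by positivity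
  obtain ⟨C1, hC1, hρ⟩ := rho_int (p := l * a) (by positivity) (by rw [ha, mul_one_div, div_lt_one hq0]; exact hq)
  set C2 := 2 * (2 + a) ^ (2 + a) * (exp 1 * C1) with hC2
  have hC2p : 0 < C2 := by positivity
  set C3 := (D + 1) * Cv * C2 * (4 * C0 ^ 2) / κ with hC3
  have hC3p : 0 < C3 := by positivity
  refine ⟨Cv * (2 * C0) * C3 ^ q, by positivity, D + 1, by omega, ?_⟩
  intro N m hN hm b hb δ hδ
  have hN0 : (0:ℝ) < N := by exact_mod_cast hN
  have hm0 : (0:ℝ) < m := by exact_mod_cast hm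
  have hm1 : (1:ℝ) ≤ m := by exact_mod_cast hm
  have hsm : 0 < √(m:ℝ) := sqrt_pos.2 hm0
  have hsm2 : √(m:ℝ) * √m = m := mul_self_sqrt hm0.le
  set U : ℝ → ℝ := fun t => |sin t| + 1 / N with hU
  have hU0 : ∀ t, 0 < U t := fun t => by simp only [hU]; positivity
  have cU : Continuous U := by simp only [hU]; fun_prop
  set W : ℝ → ℝ := fun t => U t ^ l with hW
  have cW : Continuous W := cU.rpow_const (fun t => Or.inl (hU0 t).ne')
  have hW0 : ∀ t, 0 < W t := fun t => rpow_pos_of_pos (hU0 t) _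
  set ρ : ℝ → ℝ := fun t => U t ^ (-(l * a)) with hρd
  have cρ : Continuous ρ := cU.rpow_const (fun t => Or.inl (hU0 t).ne')
  have hρ0 : ∀ t, 0 < ρ t := fun t => rpow_pos_of_pos (hU0 t) _
  set φ : ℕ → ℝ → ℝ := fun k t => (L k).eval (cos t) * W t / (2 * C0) with hφ
  have cφ : ∀ k, Continuous (φ k) := fun k => ((cont_eval_cos (L k)).mul cW).div_const _
  obtain ⟨c, J, hJ, hJc, hc0, hint⟩ := maurey N b hb φ cφ (by
    intro k hk t
    simp only [hφ, abs_div, abs_mul, abs_of_pos (hW0 t)]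
    rw [abs_of_pos hC0, abs_two, div_le_iff₀ (by positivity)]
    have := hpw k N hk t
    simp only [hW, hU]; linarith) (√m)⁻¹ (by positivity) (by
      rw [inv_le_one₀ hsm]; exact one_le_sqrt.2 hm1) ρ cρ (fun t => (hρ0 t).le) m
  have es : (√(m:ℝ))⁻¹ ^ 2 * m = 1 := by
    rw [inv_pow, sq_sqrt hm0.le]; field_simp
  rw [es] at hint
  set e : Polynomial ℝ := ∑ k ∈ Finset.range N, Polynomial.C (b k - c k / m) * L k with he
  set h : ℝ → ℝ := fun t => e.eval (cos t) with hh
  have ch : Continuous h := cont_eval_cos e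
  set A := √(m:ℝ) / (2 * C0) with hA
  have hA0 : 0 < A := by positivity
  have hY : ∀ t, |(√(m:ℝ))⁻¹ * ∑ k ∈ Finset.range N, (c k - m * b k) * φ k t| = A * (W t * |h t|) := by
    intro t
    have : (√(m:ℝ))⁻¹ * ∑ k ∈ Finset.range N, (c k - m * b k) * φ k t = -(A * (W t * h t)) := by
      simp only [hh, he, Polynomial.eval_finsetSum, Polynomial.eval_mul, Polynomial.eval_C, Finset.mul_sum]
      rw [← Finset.sum_neg_distrib]
      apply Finset.sum_congr rfl
      intro k _
      simp only [hφ, hA]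
      field_simp
      rw [sq, hsm2]
      ring
    rw [this, abs_neg, abs_mul, abs_mul, abs_of_pos hA0, abs_of_pos (hW0 t)]
  have cY : Continuous fun t => ρ t * cosh ((√(m:ℝ))⁻¹ * ∑ k ∈ Finset.range N, (c k - m * b k) * φ k t) :=
    cρ.mul (continuous_cosh.comp (continuous_const.mul
      (continuous_finsetSum _ fun k _ => continuous_const.mul (cφ k))))
  have hpi := pi_pos
  set K := (C3 * (N / (m * δ ^ 2))) ^ q with hK
  have hK0 : 0 < K := by positivity
  have hKa : K ^ a = C3 * (N / (m * δ ^ 2)) := by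
    rw [hK, ← rpow_mul (by positivity), ha, mul_one_div_cancel hq0.ne', rpow_one]
  set H := K / A with hH
  have hH0 : 0 < H := by positivity
  set h1 : ℝ → ℝ := fun t => max (-H) (min H (h t)) with hh1
  set h2 : ℝ → ℝ := fun t => h t - h1 t with hh2
  have ch1 : Continuous h1 := continuous_const.max (continuous_const.min ch)
  have ch2 : Continuous h2 := ch.sub ch1
  have even : ∀ t, h (-t) = h t := fun t => by simp only [hh, cos_neg]
  have even1 : ∀ t, h1 (-t) = h1 t := fun t => by simp only [hh1, even]
  have even2 : ∀ t, h2 (-t) = h2 t := fun t => by simp only [hh2, even, even1]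
  have per : Function.Periodic h (2 * π) := fun t => by simp only [hh, cos_add_two_pi]
  have per1 : Function.Periodic h1 (2 * π) := fun t => by simp only [hh1, per t]
  have per2 : Function.Periodic h2 (2 * π) := fun t => by simp only [hh2, per t, per1 t]
  have cp : Continuous fun t => h2 t ^ 2 * U t ^ (2 * l) :=
    (ch2.pow 2).mul (cU.rpow_const (fun t => Or.inl (hU0 t).ne'))
  have main : ∫ t in (-π)..π, h2 t ^ 2 * U t ^ (2 * l) ≤ C2 * (A ^ (-(2 + a)) * H ^ (-a)) := by
    have step : ∀ t, h2 t ^ 2 * U t ^ (2 * l) ≤ (2 * (2 + a) ^ (2 + a) * (A ^ (-(2 + a)) * H ^ (-a))) *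
        (ρ t * cosh ((√(m:ℝ))⁻¹ * ∑ k ∈ Finset.range N, (c k - m * b k) * φ k t)) := by
      intro t
      have s1 := (clip_props (x := h t) hH0 ha0).2
      have s2 := rpow_cosh (p := 2 + a) (by positivity) (abs_nonneg ((√(m:ℝ))⁻¹ * ∑ k ∈ Finset.range N, (c k - m * b k) * φ k t))
      rw [cosh_abs, hY t, mul_rpow hA0.le (mul_nonneg (hW0 t).le (abs_nonneg _)), mul_rpow (hW0 t).le (abs_nonneg _)] at s2
      have eW : W t ^ (2 + a) * ρ t = U t ^ (2 * l) := by
        simp only [hW, hρd]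
        rw [← rpow_mul (hU0 t).le, ← rpow_add (hU0 t)]
        congr 1; ring
      have eA : A ^ (-(2 + a)) * A ^ (2 + a) = 1 := by
        rw [← rpow_add hA0]; simp
      calc h2 t ^ 2 * U t ^ (2 * l) ≤ (|h t| ^ (2 + a) * H ^ (-a)) * U t ^ (2 * l) := by
            exact mul_le_mul_of_nonneg_right s1 (rpow_pos_of_pos (hU0 t) _).le
        _ = (A ^ (-(2 + a)) * H ^ (-a)) * ρ t * (A ^ (2 + a) * (W t ^ (2 + a) * |h t| ^ (2 + a))) := by
            rw [← eW]
            linear_combination (-(|h t| ^ (2 + a) * H ^ (-a) * (W t ^ (2 + a) * ρ t))) * eA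
        _ ≤ (A ^ (-(2 + a)) * H ^ (-a)) * ρ t * (2 * (2 + a) ^ (2 + a) *
            cosh ((√(m:ℝ))⁻¹ * ∑ k ∈ Finset.range N, (c k - m * b k) * φ k t)) := by
            apply mul_le_mul_of_nonneg_left s2
            have := hρ0 t
            positivity
        _ = _ := by ring
    calc _ ≤ ∫ t in (-π)..π, (2 * (2 + a) ^ (2 + a) * (A ^ (-(2 + a)) * H ^ (-a))) *
        (ρ t * cosh ((√(m:ℝ))⁻¹ * ∑ k ∈ Finset.range N, (c k - m * b k) * φ k t)) := by
          apply intervalIntegral.integral_mono_on (by linarith) (cp.intervalIntegrable _ _)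
          · exact (continuous_const.mul cY).intervalIntegrable _ _
          · intro t _; exact step t
      _ ≤ (2 * (2 + a) ^ (2 + a) * (A ^ (-(2 + a)) * H ^ (-a))) * (exp 1 * C1) := by
          rw [intervalIntegral.integral_const_mul]
          apply mul_le_mul_of_nonneg_left _ (by positivity)
          refine hint.trans ?_
          exact mul_le_mul_of_nonneg_left (hρ N hN) (exp_pos _).le
      _ = _ := by rw [hC2]; ring
  obtain ⟨V, Vadd, Vdeg, Vrep, Vb⟩ := hV N hN
  have hdeg : e.natDegree ≤ N := by
    apply Polynomial.natDegree_sum_le_of_forall_le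
    intro k hk
    refine (Polynomial.natDegree_C_mul_le _ _).trans ?_
    rw [S.hd]; exact (Finset.mem_range.1 hk).le
  have eV : e = V h1 + V h2 := by
    rw [← Vadd h1 h2 ch1 ch2, ← Vrep e hdeg]
    congr 1
    ext t
    simp only [hh2, hh]
    ring
  obtain ⟨b', hb'⟩ := seq_span L S.hd S.h0 ((D + 1) * N) (V h2) (by
    refine lt_of_le_of_lt Polynomial.degree_le_natDegree ?_
    have := Vdeg h2
    exact_mod_cast (by nlinarith : (V h2).natDegree < (D + 1) * N))
  refine ⟨fun k => c k / m, J, V h1, b', hJc, hJ, fun k hk => by simp [hc0 k hk], ?_, ?_, ?_⟩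
  · rw [← hb', ← eV]
  · intro t
    have := (Vb h1 ch1 even1 per1).1 H (fun t => (clip_props hH0 ha0).1) t
    refine this.trans (le_of_eq ?_)
    rw [hH, hK, hA, mul_rpow hC3p.le (by positivity)]
    field_simp
  · have p1 := (Vb h2 ch2 even2 per2).2
    have p2 := S.parseval ((D + 1) * N) b'
    rw [← hb'] at p2
    have p3 : gip l (V h2) (V h2) ≤ Cv * (C2 * (A ^ (-(2 + a)) * H ^ (-a))) := by
      refine le_trans (le_of_eq ?_) (p1.trans (mul_le_mul_of_nonneg_left main hCv.le))
      unfold gip; congr 1; ext t; ring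
    have p4 : A ^ (-(2 + a)) * H ^ (-a) = (A ^ 2)⁻¹ * (K ^ a)⁻¹ := by
      rw [hH, div_rpow hK0.le hA0.le, rpow_neg hK0.le, rpow_neg hA0.le, rpow_neg hA0.le, rpow_add hA0, rpow_two]
      have := rpow_pos_of_pos hA0 a
      field_simp
    rw [p4, hKa, p2] at p3
    have p5 : (∑ k ∈ Finset.range ((D + 1) * N), |b' k|) ^ 2 ≤ ((D + 1) * N) * ∑ k ∈ Finset.range ((D + 1) * N), b' k ^ 2 := by
      have := sq_sum_le_card_mul_sum_sq (s := Finset.range ((D + 1) * N)) (f := fun k => |b' k|)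
      simpa using this
    apply (pow_le_pow_iff_left₀ (Finset.sum_nonneg fun k _ => abs_nonneg _) hδ.le two_ne_zero).1
    refine p5.trans ?_
    have p6 : ∑ k ∈ Finset.range ((D + 1) * N), b' k ^ 2 ≤ (Cv * (C2 * ((A ^ 2)⁻¹ * (C3 * (N / (m * δ ^ 2)))⁻¹))) / κ := by
      rw [le_div_iff₀ hκ]; linarith
    calc _ ≤ ((D + 1) * N) * ((Cv * (C2 * ((A ^ 2)⁻¹ * (C3 * (N / (m * δ ^ 2)))⁻¹))) / κ) := by gcongr
      _ = δ ^ 2 := by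
        rw [hA, hC3, div_pow, sq_sqrt hm0.le]
        field_simp
        norm_num

end

section

def Sp (L : ℕ → Polynomial ℝ) (m : ℕ) (G : Polynomial ℝ) : Prop :=
  ∃ J : Finset ℕ, J.card ≤ m ∧ G ∈ Submodule.span ℝ (L '' (J : Set ℕ))

lemma Sp.zero (L : ℕ → Polynomial ℝ) (m : ℕ) : Sp L m 0 := ⟨∅, by simp, Submodule.zero_mem _⟩

lemma Sp.add {L : ℕ → Polynomial ℝ} {m m' : ℕ} {G G' : Polynomial ℝ} (h : Sp L m G) (h' : Sp L m' G') :
    Sp L (m + m') (G + G') := by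
  classical
  obtain ⟨J, hJ, hG⟩ := h
  obtain ⟨J', hJ', hG'⟩ := h'
  refine ⟨J ∪ J', (Finset.card_union_le _ _).trans (by omega), Submodule.add_mem _ ?_ ?_⟩
  · exact Submodule.span_mono (Set.image_mono (by simp)) hG
  · exact Submodule.span_mono (Set.image_mono (by simp)) hG'

lemma Sp.smul {L : ℕ → Polynomial ℝ} {m : ℕ} {G : Polynomial ℝ} (h : Sp L m G) (a : ℝ) : Sp L m (Polynomial.C a * G) := by
  obtain ⟨J, hJ, hG⟩ := h
  refine ⟨J, hJ, ?_⟩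
  rw [← Polynomial.smul_eq_C_mul]
  exact Submodule.smul_mem _ _ hG

lemma Sp.mono {L : ℕ → Polynomial ℝ} {m m' : ℕ} {G : Polynomial ℝ} (h : Sp L m G) (hm : m ≤ m') : Sp L m' G := by
  obtain ⟨J, hJ, hG⟩ := h
  exact ⟨J, hJ.trans hm, hG⟩

lemma Sp.sum (L : ℕ → Polynomial ℝ) (c : ℕ → ℝ) (J : Finset ℕ) :
    Sp L J.card (∑ k ∈ J, Polynomial.C (c k) * L k) := by
  refine ⟨J, le_rfl, Submodule.sum_mem _ fun k hk => ?_⟩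
  rw [← Polynomial.smul_eq_C_mul]
  exact Submodule.smul_mem _ _ (Submodule.subset_span ⟨k, hk, rfl⟩)

lemma GSys.supb {l κ : ℝ} {L : ℕ → Polynomial ℝ} (S : GSys l κ L) : ∃ C : ℝ, 0 < C ∧ ∀ (k : ℕ) (t : ℝ),
    |(L k).eval (cos t)| ≤ C * (1 + (k:ℝ)) ^ l := by
  obtain ⟨C, hC, h⟩ := S.pwAll
  refine ⟨C, hC, fun k t => ?_⟩
  have h1 := h k (k + 1) (by omega) t
  have hl := S.hl
  have h2 : |(L k).eval (cos t)| * (1 / ((k + 1 : ℕ) : ℝ)) ^ l ≤ C := by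
    refine le_trans ?_ h1
    gcongr
    linarith [abs_nonneg (sin t)]
  rw [one_div, inv_rpow (by positivity), ← div_eq_mul_inv, div_le_iff₀ (by positivity)] at h2
  push_cast at h2
  rwa [add_comm (1:ℝ)]

set_option maxHeartbeats 1000000 in
lemma GSys.sparse {l κ : ℝ} {L : ℕ → Polynomial ℝ} (S : GSys l κ L) {q : ℝ} (hq : l < q) :
    ∃ C : ℝ, 0 < C ∧ ∀ m : ℕ, 1 ≤ m → ∀ N : ℕ, 1 ≤ N → ∀ b : ℕ → ℝ, ∑ k ∈ Finset.range N, |b k| ≤ 1 →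
    ∃ G, Sp L m G ∧ ∀ t, |((∑ k ∈ Finset.range N, Polynomial.C (b k) * L k) - G).eval (cos t)| ≤
      C * ((√m)⁻¹ * (N / m) ^ q) := by
  have hl := S.hl
  have hq0 : 0 < q := hl.trans hq
  obtain ⟨C0, hC0, hsup⟩ := S.supb
  obtain ⟨Cs, hCs, D, hD, hcore⟩ := S.core hq
  have hD0 : (0:ℝ) < D := by exact_mod_cast hD
  set δ := (2 * (√2 * (2 * D) ^ q))⁻¹ with hδ
  have hδ0 : 0 < δ := by positivity
  set B := Cs * (√3 * (3 / δ ^ 2) ^ q) with hB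
  have hB0 : 0 < B := by positivity
  set C := 2 * B + C0 with hC
  have hCp : 0 < C := by positivity
  refine ⟨C, hCp, ?_⟩
  intro m
  induction m using Nat.strong_induction_on with
  | _ m ih =>
  intro hm N hN b hb
  have hN0 : (0:ℝ) < N := by exact_mod_cast hN
  have hN1 : (1:ℝ) ≤ N := by exact_mod_cast hN
  rcases Nat.lt_or_ge m 2 with h2 | h2
  · have : m = 1 := by omega
    subst this
    refine ⟨0, Sp.zero _ _, fun t => ?_⟩
    rw [sub_zero, Polynomial.eval_finsetSum]
    refine (Finset.abs_sum_le_sum_abs _ _).trans ?_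
    calc _ ≤ ∑ k ∈ Finset.range N, |b k| * (C0 * (N:ℝ) ^ q) := by
          apply Finset.sum_le_sum
          intro k hk
          rw [Polynomial.eval_mul, Polynomial.eval_C, abs_mul]
          apply mul_le_mul_of_nonneg_left _ (abs_nonneg _)
          refine (hsup k t).trans (mul_le_mul_of_nonneg_left ?_ hC0.le)
          have : 1 + (k:ℝ) ≤ N := by
            have := Finset.mem_range.1 hk
            rw [add_comm]; exact_mod_cast this
          calc _ ≤ (N:ℝ) ^ l := rpow_le_rpow (by positivity) this hl.le
            _ ≤ _ := rpow_le_rpow_of_exponent_le hN1 hq.le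
      _ ≤ 1 * (C0 * (N:ℝ) ^ q) := by
          rw [← Finset.sum_mul]
          exact mul_le_mul_of_nonneg_right hb (by positivity)
      _ ≤ _ := by
          simp only [Nat.cast_one, sqrt_one, inv_one, div_one, one_mul]
          exact mul_le_mul_of_nonneg_right (by rw [hC]; linarith) (by positivity)
  · set m1 := m / 2 with hm1
    have hm1a : 1 ≤ m1 := by omega
    have hm1b : m ≤ 3 * m1 := by omega
    have hm2b : m ≤ 2 * (m - m1) := by omega
    obtain ⟨c, J, P, b', hJc, hJ, hc0, hdec, hP, hb'⟩ := hcore N m1 hN hm1a b hb δ hδ0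
    obtain ⟨G, hG, hGb⟩ := ih (m - m1) (by omega) (by omega) (D * N) (Nat.mul_pos hD hN) (fun k => b' k / δ) (by
      simp only [abs_div, abs_of_pos hδ0]
      rw [← Finset.sum_div, div_le_one hδ0]; exact hb')
    have hm0 : (0:ℝ) < m := by exact_mod_cast hm
    have hm10 : (0:ℝ) < m1 := by exact_mod_cast hm1a
    have hm20 : (0:ℝ) < ((m - m1 : ℕ) : ℝ) := by exact_mod_cast (by omega : 0 < m - m1)
    have hm1r : (m:ℝ) ≤ 3 * m1 := by exact_mod_cast hm1b
    have hm2r : (m:ℝ) ≤ 2 * ((m - m1 : ℕ) : ℝ) := by exact_mod_cast hm2b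
    set m2 : ℝ := ((m - m1 : ℕ) : ℝ) with hm2
    have inv : ∀ a x : ℝ, 0 < a → 0 < x → (m:ℝ) ≤ a * x → (√x)⁻¹ ≤ √a * (√m)⁻¹ := by
      intro a x ha hx h
      rw [← div_eq_mul_inv, le_div_iff₀ (sqrt_pos.2 hm0), inv_mul_le_iff₀ (sqrt_pos.2 hx), mul_comm, ← sqrt_mul ha.le]
      exact sqrt_le_sqrt h
    have eG : (∑ k ∈ Finset.range (D * N), Polynomial.C (b' k) * L k) =
        Polynomial.C δ * ∑ k ∈ Finset.range (D * N), Polynomial.C (b' k / δ) * L k := by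
      rw [Finset.mul_sum]
      apply Finset.sum_congr rfl
      intro k _
      rw [← mul_assoc, ← Polynomial.C_mul]
      congr 2; field_simp
    have eJ : ∑ k ∈ Finset.range N, Polynomial.C (c k) * L k = ∑ k ∈ J, Polynomial.C (c k) * L k := by
      symm
      apply Finset.sum_subset hJ
      intro k _ hk
      rw [hc0 k hk]; simp
    refine ⟨(∑ k ∈ J, Polynomial.C (c k) * L k) + Polynomial.C δ * G,
      (((Sp.sum L c J).mono hJc).add (hG.smul δ)).mono (by omega), fun t => ?_⟩
    have e1 : (∑ k ∈ Finset.range N, Polynomial.C (b k) * L k) - ((∑ k ∈ J, Polynomial.C (c k) * L k) + Polynomial.C δ * G)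
        = P + Polynomial.C δ * ((∑ k ∈ Finset.range (D * N), Polynomial.C (b' k / δ) * L k) - G) := by
      rw [mul_sub, ← eG, ← eJ, ← add_sub_assoc, ← hdec, sub_add_eq_sub_sub, ← Finset.sum_sub_distrib]
      congr 1
      apply Finset.sum_congr rfl
      intro k _
      rw [Polynomial.C_sub, sub_mul]
    rw [e1, Polynomial.eval_add, Polynomial.eval_mul, Polynomial.eval_C]
    refine (abs_add_le _ _).trans ?_
    rw [abs_mul, abs_of_pos hδ0]
    have b1 : |P.eval (cos t)| ≤ B * ((√m)⁻¹ * (N / m) ^ q) := by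
      refine (hP t).trans ?_
      have i1 := inv 3 m1 (by norm_num) hm10 hm1r
      have i2 : ((N:ℝ) / (m1 * δ ^ 2)) ^ q ≤ (3 / δ ^ 2) ^ q * (N / m) ^ q := by
        rw [← mul_rpow (by positivity) (by positivity)]
        apply rpow_le_rpow (by positivity) _ hq0.le
        rw [div_mul_div_comm, div_le_div_iff₀ (by positivity) (by positivity)]
        have := mul_le_mul_of_nonneg_left hm1r (by positivity : 0 ≤ (N:ℝ) * δ ^ 2)
        linarith
      calc _ ≤ Cs * ((√3 * (√m)⁻¹) * ((3 / δ ^ 2) ^ q * (N / m) ^ q)) := by gcongr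
        _ = _ := by rw [hB]; ring
    have b2 : δ * |((∑ k ∈ Finset.range (D * N), Polynomial.C (b' k / δ) * L k) - G).eval (cos t)| ≤
        C / 2 * ((√m)⁻¹ * (N / m) ^ q) := by
      have i1 := inv 2 m2 (by norm_num) hm20 hm2r
      have i2 : (((D * N : ℕ):ℝ) / m2) ^ q ≤ (2 * D) ^ q * (N / m) ^ q := by
        rw [← mul_rpow (by positivity) (by positivity)]
        apply rpow_le_rpow (by positivity) _ hq0.le
        rw [mul_div_assoc', div_le_div_iff₀ (by positivity) (by positivity)]
        push_cast
        have := mul_le_mul_of_nonneg_left hm2r (by positivity : 0 ≤ (D:ℝ) * N)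
        linarith
      calc _ ≤ δ * (C * ((√m2)⁻¹ * (((D * N : ℕ):ℝ) / m2) ^ q)) := mul_le_mul_of_nonneg_left (hGb t) hδ0.le
        _ ≤ δ * (C * ((√2 * (√m)⁻¹) * ((2 * D) ^ q * (N / m) ^ q))) := by gcongr
        _ = (δ * (√2 * (2 * D) ^ q)) * (C * ((√m)⁻¹ * (N / m) ^ q)) := by ring
        _ = _ := by
          have : δ * (√2 * (2 * D) ^ q) = 1 / 2 := by
            have : 0 < √2 * (2 * (D:ℝ)) ^ q := by positivity
            rw [hδ]; field_simp
          rw [this]; ring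
    have : B ≤ C / 2 := by rw [hC]; linarith
    have := mul_le_mul_of_nonneg_right this (by positivity : 0 ≤ (√(m:ℝ))⁻¹ * (N / m) ^ q)
    linarith

lemma GSys.sparseB {l κ : ℝ} {L : ℕ → Polynomial ℝ} (S : GSys l κ L) {q : ℝ} (hq : l < q) :
    ∃ C : ℝ, 0 < C ∧ ∀ m : ℕ, 1 ≤ m → ∀ N : ℕ, 1 ≤ N → ∀ (b : ℕ → ℝ) (B : ℝ), ∑ k ∈ Finset.range N, |b k| ≤ B →
    ∃ G, Sp L m G ∧ ∀ t, |((∑ k ∈ Finset.range N, Polynomial.C (b k) * L k) - G).eval (cos t)| ≤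
      C * B * ((√m)⁻¹ * (N / m) ^ q) := by
  obtain ⟨C, hC, h⟩ := S.sparse hq
  refine ⟨C, hC, ?_⟩
  intro m hm N hN b B hb
  have hB0 : 0 ≤ B := le_trans (Finset.sum_nonneg fun k _ => abs_nonneg _) hb
  rcases hB0.eq_or_lt with h0 | h0
  · refine ⟨0, Sp.zero _ _, fun t => ?_⟩
    have hz : ∀ k ∈ Finset.range N, b k = 0 := by
      intro k hk
      have := Finset.single_le_sum (f := fun k => |b k|) (fun k _ => abs_nonneg _) hk
      exact abs_eq_zero.1 (le_antisymm (by linarith) (abs_nonneg _))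
    rw [Finset.sum_eq_zero (fun k hk => by rw [hz k hk]; simp), ← h0]
    simp
  · obtain ⟨G, hG, hb2⟩ := h m hm N hN (fun k => b k / B) (by
      simp only [abs_div, abs_of_pos h0]
      rw [← Finset.sum_div, div_le_one h0]; exact hb)
    refine ⟨Polynomial.C B * G, hG.smul B, fun t => ?_⟩
    have e : (∑ k ∈ Finset.range N, Polynomial.C (b k) * L k) =
        Polynomial.C B * ∑ k ∈ Finset.range N, Polynomial.C (b k / B) * L k := by
      rw [Finset.mul_sum]
      apply Finset.sum_congr rfl
      intro k _
      rw [← mul_assoc, ← Polynomial.C_mul]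
      congr 2; field_simp
    rw [e, ← mul_sub, Polynomial.eval_mul, Polynomial.eval_C, abs_mul, abs_of_pos h0]
    have := mul_le_mul_of_nonneg_left (hb2 t) h0.le
    linarith

end

section

lemma GSys.block {l κ : ℝ} {L : ℕ → Polynomial ℝ} (S : GSys l κ L) {q : ℝ} (hq : l < q) {r θ : ℝ} (hr : 0 < r)
    (hθ : 0 < θ) (hθ1 : θ ≤ 1) :
    ∃ C : ℝ, 0 < C ∧ ∀ m : ℕ, 1 ≤ m → ∀ M : ℕ, 1 ≤ M → ∀ a : ℕ → ℝ,
    (∀ s : Finset ℕ, ∑ k ∈ s, ((1 + (k:ℝ)) ^ r * |a k|) ^ θ ≤ 1) →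
    ∃ G, Sp L (2 * m) G ∧ ∀ t, |((∑ k ∈ Finset.Ico M (2 * M), Polynomial.C (a k) * L k) - G).eval (cos t)| ≤
      C * ((M:ℝ) ^ (-r) * (m:ℝ) ^ (1 - 1 / θ)) * ((√m)⁻¹ * (((2 * M : ℕ):ℝ) / m) ^ q) := by
  obtain ⟨C, hC, h⟩ := S.sparseB hq
  refine ⟨C, hC, ?_⟩
  intro m hm M hM a ha
  classical
  have hm0 : (0:ℝ) < m := by exact_mod_cast hm
  have hM0 : (0:ℝ) < M := by exact_mod_cast hM
  set A : ℕ → ℝ := fun k => (1 + (k:ℝ)) ^ r * |a k| with hA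
  have hA0 : ∀ k, 0 ≤ A k := fun k => by simp only [hA]; positivity
  set I := Finset.Ico M (2 * M) with hI
  set T := I.filter (fun k => (m:ℝ)⁻¹ < A k ^ θ) with hT
  set R := I.filter (fun k => ¬ (m:ℝ)⁻¹ < A k ^ θ) with hR
  have hTc : T.card ≤ m := by
    have h1 : ∑ k ∈ T, (m:ℝ)⁻¹ ≤ ∑ k ∈ T, A k ^ θ := Finset.sum_le_sum fun k hk => (Finset.mem_filter.1 hk).2.le
    have h2 := h1.trans (ha T)
    rw [Finset.sum_const, nsmul_eq_mul, ← div_eq_mul_inv, div_le_one hm0] at h2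
    exact_mod_cast h2
  have key : ∀ k ∈ R, |a k| ≤ ((M:ℝ) ^ (-r) * (m:ℝ) ^ (1 - 1 / θ)) * A k ^ θ := by
    intro k hk
    obtain ⟨hkI, hk2⟩ := Finset.mem_filter.1 hk
    push Not at hk2
    have hkM : (M:ℝ) ≤ 1 + k := by
      have := (Finset.mem_Ico.1 hkI).1
      have : (M:ℝ) ≤ k := by exact_mod_cast this
      linarith
    have e1 : |a k| = (1 + (k:ℝ)) ^ (-r) * A k := by
      simp only [hA]
      rw [← mul_assoc, ← rpow_add (by positivity)]; simp
    have e2 : A k ≤ (m:ℝ) ^ (1 - 1 / θ) * A k ^ θ := by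
      rcases (hA0 k).eq_or_lt with h0 | h0
      · rw [← h0]; positivity
      have h3 : A k = (A k ^ θ) ^ (1 / θ - 1) * A k ^ θ := by
        rw [← rpow_mul h0.le, ← rpow_add h0]
        have : θ * (1 / θ - 1) + θ = 1 := by field_simp; ring
        rw [this, rpow_one]
      have h4 : (A k ^ θ) ^ (1 / θ - 1) ≤ (m:ℝ) ^ (1 - 1 / θ) := by
        calc _ ≤ ((m:ℝ)⁻¹) ^ (1 / θ - 1) := by
              apply rpow_le_rpow (by positivity) hk2
              rw [sub_nonneg, one_le_div hθ]; exact hθ1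
          _ = _ := by rw [inv_rpow hm0.le, ← rpow_neg hm0.le, neg_sub]
      calc A k = _ := h3
        _ ≤ _ := mul_le_mul_of_nonneg_right h4 (by positivity)
    rw [e1, mul_assoc]
    have : (1 + (k:ℝ)) ^ (-r) ≤ (M:ℝ) ^ (-r) := rpow_le_rpow_of_nonpos hM0 hkM (by linarith)
    exact mul_le_mul this e2 (hA0 k) (by positivity)
  have hsub : R ⊆ Finset.range (2 * M) := by
    intro k hk
    exact Finset.mem_range.2 (Finset.mem_Ico.1 (Finset.mem_filter.1 hk).1).2
  obtain ⟨G, hG, hGb⟩ := h m hm (2 * M) (by omega) (fun k => if k ∈ R then a k else 0)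
    ((M:ℝ) ^ (-r) * (m:ℝ) ^ (1 - 1 / θ)) (by
      have e : ∀ k, |(if k ∈ R then a k else 0)| = if k ∈ R then |a k| else 0 := by
        intro k; split_ifs <;> simp
      simp only [e]
      rw [Finset.sum_ite_mem, Finset.inter_eq_right.2 hsub]
      refine (Finset.sum_le_sum key).trans ?_
      rw [← Finset.mul_sum]
      exact mul_le_of_le_one_right (by positivity) (ha R))
  refine ⟨(∑ k ∈ T, Polynomial.C (a k) * L k) + G, (((Sp.sum L a T).mono hTc).add hG).mono (by omega), fun t => ?_⟩
  refine le_trans (le_of_eq ?_) (hGb t)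
  congr 2
  have e : ∀ k, Polynomial.C (if k ∈ R then a k else 0) * L k = if k ∈ R then Polynomial.C (a k) * L k else 0 := by
    intro k; split_ifs <;> simp
  simp only [e]
  rw [Finset.sum_ite_mem, Finset.inter_eq_right.2 hsub, ← Finset.sum_filter_add_sum_filter_not I (fun k => (m:ℝ)⁻¹ < A k ^ θ)]
  simp only [← hT, ← hR]
  ring

lemma tail_bd {l : ℝ} {L : ℕ → Polynomial ℝ} {C0 : ℝ} (hC0 : 0 < C0)
    (hsup : ∀ (k : ℕ) (t : ℝ), |(L k).eval (cos t)| ≤ C0 * (1 + (k:ℝ)) ^ l)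
    {r θ : ℝ} (hr : l < r) (hθ : 0 < θ) (hθ1 : θ ≤ 1) (a : ℕ → ℝ)
    (ha : ∀ s : Finset ℕ, ∑ k ∈ s, ((1 + (k:ℝ)) ^ r * |a k|) ^ θ ≤ 1) (M : ℝ) (hM : 0 < M) (s : Finset ℕ)
    (hs : ∀ k ∈ s, M ≤ 1 + (k:ℝ)) (t : ℝ) :
    ∑ k ∈ s, |a k| * |(L k).eval (cos t)| ≤ C0 * M ^ (l - r) := by
  calc _ ≤ ∑ k ∈ s, C0 * M ^ (l - r) * ((1 + (k:ℝ)) ^ r * |a k|) ^ θ := by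
        apply Finset.sum_le_sum
        intro k hk
        have hk0 : (0:ℝ) < 1 + k := by positivity
        set A := (1 + (k:ℝ)) ^ r * |a k| with hA
        have hA0 : 0 ≤ A := by positivity
        have h1 : A ^ θ ≤ 1 := by simpa using ha {k}
        have h2 : A ≤ 1 := by
          by_contra h
          push Not at h
          linarith [one_lt_rpow h hθ]
        have h3 : A ≤ A ^ θ := by
          rcases hA0.eq_or_lt with h0 | h0
          · rw [← h0]; positivity
          · conv_lhs => rw [← rpow_one A]
            exact rpow_le_rpow_of_exponent_ge h0 h2 hθ1
        calc |a k| * |(L k).eval (cos t)| ≤ |a k| * (C0 * (1 + (k:ℝ)) ^ l) :=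
              mul_le_mul_of_nonneg_left (hsup k t) (abs_nonneg _)
          _ = C0 * (1 + (k:ℝ)) ^ (l - r) * A := by
              rw [hA, rpow_sub hk0]
              have := rpow_pos_of_pos hk0 r
              field_simp
          _ ≤ C0 * M ^ (l - r) * A ^ θ := by
              apply mul_le_mul _ h3 hA0 (by positivity)
              exact mul_le_mul_of_nonneg_left (rpow_le_rpow_of_nonpos hM (hs k hk) (by linarith)) hC0.le
    _ ≤ _ := by
        rw [← Finset.mul_sum]
        exact mul_le_of_le_one_right (by positivity) (ha s)

end

section

lemma GSys.blocks {l κ : ℝ} {L : ℕ → Polynomial ℝ} (S : GSys l κ L) {r θ : ℝ} (hr : l < r)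
    (hθ : 0 < θ) (hθ1 : θ ≤ 1) :
    ∃ C ρ : ℝ, 0 < C ∧ 0 < ρ ∧ ρ < 1 ∧ ∀ n : ℕ, 1 ≤ n → ∀ a : ℕ → ℝ,
    (∀ s : Finset ℕ, ∑ k ∈ s, ((1 + (k:ℝ)) ^ r * |a k|) ^ θ ≤ 1) → ∀ J : ℕ,
    ∃ (G : Polynomial ℝ) (p : ℕ), (p:ℝ) ≤ n + 2 * (n * ∑ j ∈ Finset.range J, ρ ^ j + J) ∧ Sp L p G ∧
      ∀ t, |((∑ k ∈ Finset.range (2 ^ J * n), Polynomial.C (a k) * L k) - G).eval (cos t)| ≤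
        C * (n:ℝ) ^ (-(r + 1 / θ - 1 / 2)) := by
  have hl := S.hl
  have hinv : 1 ≤ 1 / θ := by rw [one_le_div hθ]; exact hθ1
  set q := (l + r) / 2 with hqd
  have hq : l < q := by linarith
  have hqr : q < r := by linarith
  obtain ⟨C, hC, hblock⟩ := S.block hq (hl.trans hr) hθ hθ1
  set Y := q + 1 / θ - 1 / 2 with hY
  have hY0 : 0 < Y := by linarith
  set κ' := (r - q) / (2 * Y) with hκ'
  have hκ0 : 0 < κ' := div_pos (by linarith) (by linarith)
  have hκY : κ' * Y = (r - q) / 2 := by rw [hκ']; field_simp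
  set ρ : ℝ := 2 ^ (-κ') with hρ
  have hρ0 : 0 < ρ := by positivity
  have hρ1 : ρ < 1 := rpow_lt_one_of_one_lt_of_neg (by norm_num) (by linarith)
  set τ : ℝ := 2 ^ (-((r - q) / 2)) with hτ
  have hτ0 : 0 < τ := by positivity
  have hτ1 : τ < 1 := rpow_lt_one_of_one_lt_of_neg (by norm_num) (by linarith)
  refine ⟨C * 2 ^ q * (1 - τ)⁻¹, ρ, by have : 0 < 1 - τ := by linarith
                                       positivity, hρ0, hρ1, ?_⟩
  intro n hn a ha J
  have hn0 : (0:ℝ) < n := by exact_mod_cast hn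
  set X := r + 1 / θ - 1 / 2 with hX
  suffices H : ∃ (G : Polynomial ℝ) (p : ℕ), (p:ℝ) ≤ n + 2 * (n * ∑ j ∈ Finset.range J, ρ ^ j + J) ∧ Sp L p G ∧
      ∀ t, |((∑ k ∈ Finset.range (2 ^ J * n), Polynomial.C (a k) * L k) - G).eval (cos t)| ≤
        C * 2 ^ q * (n:ℝ) ^ (-X) * ∑ j ∈ Finset.range J, τ ^ j by
    obtain ⟨G, p, hp, hG, hb⟩ := H
    refine ⟨G, p, hp, hG, fun t => (hb t).trans ?_⟩
    have : ∑ j ∈ Finset.range J, τ ^ j ≤ (1 - τ)⁻¹ := by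
      rw [← tsum_geometric_of_lt_one hτ0.le hτ1]
      exact (summable_geometric_of_lt_one hτ0.le hτ1).sum_le_tsum _ (fun i _ => by positivity)
    calc _ ≤ C * 2 ^ q * (n:ℝ) ^ (-X) * (1 - τ)⁻¹ := by gcongr
      _ = _ := by ring
  induction J with
  | zero =>
    refine ⟨∑ k ∈ Finset.range n, Polynomial.C (a k) * L k, n, by simp, ?_, fun t => by simp⟩
    have := Sp.sum L a (Finset.range n)
    rwa [Finset.card_range] at this
  | succ J ih =>
    obtain ⟨G, p, hp, hG, hb⟩ := ih
    set x : ℝ := n * ρ ^ J with hx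
    have hx0 : 0 < x := by positivity
    set m := ⌈x⌉₊ with hm
    have hm1 : 1 ≤ m := Nat.one_le_ceil_iff.2 hx0
    have hmx : x ≤ m := Nat.le_ceil x
    have hmx2 : (m:ℝ) < x + 1 := Nat.ceil_lt_add_one hx0.le
    have hm0 : (0:ℝ) < m := by exact_mod_cast hm1
    set M := 2 ^ J * n with hM
    have hM1 : 1 ≤ M := Nat.mul_pos (by positivity) hn
    obtain ⟨G', hG', hb'⟩ := hblock m hm1 M hM1 a ha
    refine ⟨G + G', p + 2 * m, ?_, hG.add hG', fun t => ?_⟩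
    · push_cast
      rw [Finset.sum_range_succ, mul_add]
      linarith
    · have e : (∑ k ∈ Finset.range (2 ^ (J + 1) * n), Polynomial.C (a k) * L k) - (G + G') =
          ((∑ k ∈ Finset.range M, Polynomial.C (a k) * L k) - G) +
          ((∑ k ∈ Finset.Ico M (2 * M), Polynomial.C (a k) * L k) - G') := by
        rw [show 2 ^ (J + 1) * n = 2 * M by rw [hM]; ring, ← Finset.sum_range_add_sum_Ico _ (show M ≤ 2 * M by omega)]
        ring
      rw [e, Polynomial.eval_add]
      refine (abs_add_le _ _).trans ?_
      rw [Finset.sum_range_succ, mul_add]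
      refine add_le_add (hb t) ((hb' t).trans ?_)
      have hMr : (M:ℝ) = 2 ^ (J:ℝ) * n := by rw [hM]; push_cast; rw [rpow_natCast]
      have h2J : (0:ℝ) < 2 ^ (J:ℝ) := by positivity
      have e1 : C * ((M:ℝ) ^ (-r) * (m:ℝ) ^ (1 - 1 / θ)) * ((√m)⁻¹ * (((2 * M : ℕ):ℝ) / m) ^ q) =
          C * 2 ^ q * ((M:ℝ) ^ (q - r) * (m:ℝ) ^ (-Y)) := by
        have hM0 : (0:ℝ) < M := by exact_mod_cast hM1
        rw [sqrt_eq_rpow, ← rpow_neg hm0.le]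
        push_cast
        rw [div_rpow (by positivity) hm0.le, mul_rpow (by norm_num) hM0.le, div_eq_mul_inv (_ * _) ((m:ℝ) ^ q), ← rpow_neg hm0.le,
          show q - r = -r + q by ring, rpow_add hM0, show -Y = (1 - 1 / θ) + (-(1 / 2)) + (-q) by rw [hY]; ring,
          rpow_add hm0, rpow_add hm0]
        ring
      have e2 : (m:ℝ) ^ (-Y) ≤ x ^ (-Y) := rpow_le_rpow_of_nonpos hx0 hmx (by linarith)
      have e3 : (M:ℝ) ^ (q - r) * x ^ (-Y) = (n:ℝ) ^ (-X) * τ ^ J := by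
        have ρJ : ρ ^ J = 2 ^ (-κ' * (J:ℝ)) := by rw [hρ, ← rpow_natCast, ← rpow_mul (by norm_num)]
        have τJ : τ ^ J = 2 ^ (-((r - q) / 2) * (J:ℝ)) := by rw [hτ, ← rpow_natCast, ← rpow_mul (by norm_num)]
        rw [hx, ρJ, τJ, hMr, mul_rpow h2J.le hn0.le, mul_rpow hn0.le (by positivity), ← rpow_mul (by norm_num),
          ← rpow_mul (by norm_num)]
        have c1 : (n:ℝ) ^ (-X) = (n:ℝ) ^ (q - r) * (n:ℝ) ^ (-Y) := by
          rw [← rpow_add hn0]; congr 1; rw [hX, hY]; ring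
        have c2 : (2:ℝ) ^ (-((r - q) / 2) * (J:ℝ)) = 2 ^ ((J:ℝ) * (q - r)) * 2 ^ (-κ' * (J:ℝ) * -Y) := by
          rw [← rpow_add (by norm_num)]; congr 1
          linear_combination (-(J:ℝ)) * hκY
        rw [c1, c2]; ring
      rw [e1]
      calc _ ≤ C * 2 ^ q * ((M:ℝ) ^ (q - r) * x ^ (-Y)) := by gcongr
        _ = _ := by rw [e3]; ring

lemma GSys.upper {l κ : ℝ} {L : ℕ → Polynomial ℝ} (S : GSys l κ L) {r θ : ℝ} (hr : l < r)
    (hθ : 0 < θ) (hθ1 : θ ≤ 1) :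
    ∃ C : ℝ, 0 < C ∧ ∀ n : ℕ, 1 ≤ n → ∀ a : ℕ → ℝ,
    (∀ s : Finset ℕ, ∑ k ∈ s, ((1 + (k:ℝ)) ^ r * |a k|) ^ θ ≤ 1) →
    ∃ (G : Polynomial ℝ) (M0 : ℕ), Sp L (n / 2) G ∧ ∀ M ≥ M0, ∀ t,
      |((∑ k ∈ Finset.range M, Polynomial.C (a k) * L k) - G).eval (cos t)| ≤
        C * (n:ℝ) ^ (-(r + 1 / θ - 1 / 2)) := by
  have hl := S.hl
  have hinv : 1 ≤ 1 / θ := by rw [one_le_div hθ]; exact hθ1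
  set X := r + 1 / θ - 1 / 2 with hX
  have hX0 : 0 < X := by linarith
  obtain ⟨C1, ρ, hC1, hρ0, hρ1, hbl⟩ := S.blocks hr hθ hθ1
  obtain ⟨C0, hC0, hsup⟩ := S.supb
  obtain ⟨p, hp⟩ := exists_nat_ge (X / (r - l))
  rw [div_le_iff₀ (by linarith)] at hp
  obtain ⟨Q, hQ⟩ := exists_nat_ge (2 * (1 + 2 * ((1 - ρ)⁻¹ + p)))
  have hρ2 : 0 < (1 - ρ)⁻¹ := inv_pos.2 (by linarith)
  have hQ1r : (1:ℝ) ≤ Q := by have : (0:ℝ) ≤ p := by positivity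
                              linarith
  have hQ1 : 1 ≤ Q := by exact_mod_cast hQ1r
  refine ⟨(C1 + C0) * (2 * Q) ^ X, by positivity, ?_⟩
  intro n0 hn0 a ha
  have hn0r : (0:ℝ) < n0 := by exact_mod_cast hn0
  have evb : ∀ (s : Finset ℕ) t, |(∑ k ∈ s, Polynomial.C (a k) * L k).eval (cos t)| ≤
      ∑ k ∈ s, |a k| * |(L k).eval (cos t)| := by
    intro s t
    rw [Polynomial.eval_finsetSum]
    refine (Finset.abs_sum_le_sum_abs _ _).trans (le_of_eq ?_)
    apply Finset.sum_congr rfl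
    intro k _
    rw [Polynomial.eval_mul, Polynomial.eval_C, abs_mul]
  have cmp : ∀ y : ℝ, 0 < y → (n0:ℝ) ≤ (2 * Q) * y → y ^ (-X) ≤ (2 * Q) ^ X * (n0:ℝ) ^ (-X) := by
    intro y hy h
    rw [rpow_neg hy.le, rpow_neg hn0r.le, ← div_eq_mul_inv, le_div_iff₀ (by positivity), inv_mul_le_iff₀ (by positivity),
      ← mul_rpow hy.le (by positivity)]
    exact rpow_le_rpow hn0r.le (by linarith) hX0.le
  rcases Nat.lt_or_ge n0 Q with h | h
  · refine ⟨0, 0, Sp.zero _ _, fun M _ t => ?_⟩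
    rw [sub_zero]
    refine (evb _ t).trans ((tail_bd hC0 hsup hr hθ hθ1 a ha 1 one_pos _ (fun k _ => by
      have : (0:ℝ) ≤ k := by positivity
      linarith) t).trans ?_)
    have hr' : (n0:ℝ) ≤ Q := by exact_mod_cast h.le
    have h1 := cmp 1 one_pos (by linarith)
    rw [one_rpow] at h1
    rw [one_rpow, mul_one, mul_assoc]
    have := mul_le_mul_of_nonneg_left h1 (by positivity : 0 ≤ C1 + C0)
    linarith
  · set n := n0 / Q with hn
    have hn1 : 1 ≤ n := Nat.div_pos h hQ1
    have hnQ : n * Q ≤ n0 := Nat.div_mul_le_self _ _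
    have hnQ2 : n0 ≤ 2 * Q * n := by
      have h1 : n0 < n * Q + Q := Nat.lt_div_mul_add hQ1
      have h2 : Q ≤ n * Q := Nat.le_mul_of_pos_left _ hn1
      calc n0 ≤ n * Q + n * Q := by omega
        _ = _ := by ring
    have hn1r : (0:ℝ) < n := by exact_mod_cast hn1
    obtain ⟨G, P, hP, hG, hb⟩ := hbl n hn1 a ha (p * n)
    refine ⟨G, 2 ^ (p * n) * n, hG.mono ?_, fun M hM t => ?_⟩
    · have h1 : ∑ j ∈ Finset.range (p * n), ρ ^ j ≤ (1 - ρ)⁻¹ := by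
        rw [← tsum_geometric_of_lt_one hρ0.le hρ1]
        exact (summable_geometric_of_lt_one hρ0.le hρ1).sum_le_tsum _ (fun i _ => by positivity)
      have h2 : (P:ℝ) * 2 ≤ n * Q := by
        have h3 := mul_le_mul_of_nonneg_left h1 hn1r.le
        have h4 := mul_le_mul_of_nonneg_left hQ hn1r.le
        push_cast at hP
        linarith
      have h3 : P * 2 ≤ n * Q := by exact_mod_cast h2
      rw [Nat.le_div_iff_mul_le two_pos]
      exact h3.trans hnQ
    · set M1 := 2 ^ (p * n) * n with hM1
      have hM10 : (0:ℝ) < M1 := by rw [hM1]; push_cast; positivity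
      have e : (∑ k ∈ Finset.range M, Polynomial.C (a k) * L k) - G =
          ((∑ k ∈ Finset.range M1, Polynomial.C (a k) * L k) - G) + ∑ k ∈ Finset.Ico M1 M, Polynomial.C (a k) * L k := by
        rw [← Finset.sum_range_add_sum_Ico _ hM]; ring
      rw [e, Polynomial.eval_add]
      refine (abs_add_le _ _).trans ?_
      have t1 := (evb (Finset.Ico M1 M) t).trans (tail_bd hC0 hsup hr hθ hθ1 a ha M1 hM10 _ (fun k hk => by
        have := (Finset.mem_Ico.1 hk).1
        have : (M1:ℝ) ≤ k := by exact_mod_cast this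
        linarith) t)
      have t2 : (M1:ℝ) ^ (l - r) ≤ (n:ℝ) ^ (-X) := by
        have hn11 : (1:ℝ) ≤ n := by exact_mod_cast hn1
        have h2n : (n:ℝ) ≤ 2 ^ n := by exact_mod_cast (Nat.lt_two_pow_self (n := n)).le
        rw [show l - r = -(r - l) by ring, rpow_neg hM10.le, rpow_neg hn1r.le]
        apply inv_anti₀ (by positivity)
        calc (n:ℝ) ^ X ≤ (n:ℝ) ^ (p * (r - l)) := rpow_le_rpow_of_exponent_le hn11 hp
          _ = ((n:ℝ) ^ p) ^ (r - l) := by rw [rpow_mul hn1r.le, rpow_natCast]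
          _ ≤ _ := by
            apply rpow_le_rpow (by positivity) _ (by linarith)
            calc (n:ℝ) ^ p ≤ (2 ^ n) ^ p := by gcongr
              _ = 2 ^ (p * n) * 1 := by rw [← pow_mul, mul_comm n p, mul_one]
              _ ≤ _ := by rw [hM1]; push_cast; gcongr
      have t3 := cmp n hn1r (by exact_mod_cast hnQ2)
      calc _ ≤ C1 * (n:ℝ) ^ (-X) + C0 * (n:ℝ) ^ (-X) := by
            refine add_le_add (hb t) (t1.trans ?_)
            exact mul_le_mul_of_nonneg_left t2 hC0.le
        _ = (C1 + C0) * (n:ℝ) ^ (-X) := by ring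
        _ ≤ (C1 + C0) * ((2 * Q) ^ X * (n0:ℝ) ^ (-X)) := by gcongr
        _ = _ := by ring

end

section

lemma cos_image : cos '' Set.Ioo 0 π = Set.Ioo (-1) 1 := by
  ext x
  constructor
  · rintro ⟨t, ht, rfl⟩
    have h1 := strictAntiOn_cos (⟨le_rfl, pi_pos.le⟩ : (0:ℝ) ∈ Set.Icc 0 π) ⟨ht.1.le, ht.2.le⟩ ht.1
    have h2 := strictAntiOn_cos (⟨ht.1.le, ht.2.le⟩ : t ∈ Set.Icc 0 π) ⟨pi_pos.le, le_rfl⟩ ht.2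
    rw [cos_zero] at h1; rw [cos_pi] at h2
    exact ⟨h2, h1⟩
  · intro hx
    refine ⟨arccos x, ⟨arccos_pos.2 hx.2, ?_⟩, cos_arccos hx.1.le hx.2.le⟩
    refine lt_of_le_of_ne (arccos_le_pi x) fun h => ?_
    rw [arccos_eq_pi] at h
    linarith [hx.1]

lemma cov {E : Type*} [NormedAddCommGroup E] [NormedSpace ℝ E] (α : ℝ) (g : ℝ → E) :
    ∫ x in Set.Ioo (-1:ℝ) 1, (1 - x ^ 2) ^ α • g x = ∫ t in (0:ℝ)..π, (sin t) ^ (2 * (α + 1 / 2)) • g (cos t) := by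
  rw [← cos_image, integral_image_eq_integral_abs_deriv_smul measurableSet_Ioo
    (fun t _ => (hasDerivAt_cos t).hasDerivWithinAt) (injOn_cos.mono Set.Ioo_subset_Icc_self),
    intervalIntegral.integral_of_le pi_pos.le, ← integral_Ioc_eq_integral_Ioo]
  rw [integral_Ioc_eq_integral_Ioo, integral_Ioc_eq_integral_Ioo]
  apply setIntegral_congr_fun measurableSet_Ioo
  intro t ht
  have hs := sin_pos_of_pos_of_lt_pi ht.1 ht.2
  simp only
  rw [smul_smul]
  congr 1
  rw [abs_neg, abs_of_pos hs, ← sin_sq, ← rpow_natCast, ← rpow_mul hs.le,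
    show 2 * (α + 1 / 2) = 1 + ((2:ℕ):ℝ) * α by push_cast; ring, rpow_add hs, rpow_one]

lemma kap_eq (α : ℝ) : ∫ t in Set.Ioo (-1 : ℝ) 1, (1 - t ^ 2) ^ α = ∫ t in (0:ℝ)..π, (sin t) ^ (2 * (α + 1 / 2)) := by
  have := cov α (fun _ => (1:ℝ))
  simpa using this

lemma kap_pos {l : ℝ} (hl : 0 < l) : 0 < ∫ t in (0:ℝ)..π, (sin t) ^ (2 * l) := by
  apply intervalIntegral.intervalIntegral_pos_of_pos_on
  · exact (cont_sin_rpow (by positivity)).intervalIntegrable _ _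
  · intro t ht
    have := sin_pos_of_pos_of_lt_pi ht.1 ht.2
    positivity
  · exact pi_pos

lemma mkGSys {α : ℝ} (hα : -(1 / 2 : ℝ) < α) (L : ℕ → Polynomial ℝ)
    (hdeg : ∀ n, (L n).natDegree = n)
    (hlead : ∀ n, 0 < (L n).leadingCoeff)
    (horth : ∀ i j, (∫ x in Set.Ioo (-1 : ℝ) 1,
        (L i).eval x * (L j).eval x * gegWeight α x) = if i = j then 1 else 0) :
    GSys (α + 1 / 2) (∫ t in (0:ℝ)..π, (sin t) ^ (2 * (α + 1 / 2))) L := by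
  have hl : 0 < α + 1 / 2 := by linarith
  have hκ := kap_pos hl
  refine ⟨hl, hκ, hdeg, fun n h => by have := hlead n; rw [h] at this; simp at this, fun i j => ?_⟩
  have h := horth i j
  unfold gegWeight at h
  rw [kap_eq] at h
  set κ := ∫ t in (0:ℝ)..π, (sin t) ^ (2 * (α + 1 / 2))
  have e : ∀ x : ℝ, (L i).eval x * (L j).eval x * (κ⁻¹ * (1 - x ^ 2) ^ α) =
      κ⁻¹ * ((1 - x ^ 2) ^ α • ((L i).eval x * (L j).eval x)) := fun x => by rw [smul_eq_mul]; ring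
  simp_rw [e] at h
  rw [integral_const_mul, cov, inv_mul_eq_iff_eq_mul₀ hκ.ne'] at h
  unfold gip
  have e2 : ∀ t : ℝ, sin t ^ (2 * (α + 1 / 2)) • ((L i).eval (cos t) * (L j).eval (cos t)) =
    (L i).eval (cos t) * (L j).eval (cos t) * sin t ^ (2 * (α + 1 / 2)) := fun t => by rw [smul_eq_mul]; ring
  simp_rw [e2] at h
  rw [h]; split_ifs <;> simp

/-- real Gegenbauer coefficient -/
def rc (l : ℝ) (L : ℕ → Polynomial ℝ) (u : ℝ → ℝ) (k : ℕ) : ℝ :=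
  (∫ t in (0:ℝ)..π, (sin t) ^ (2 * l))⁻¹ * ∫ t in (0:ℝ)..π, u (cos t) * (L k).eval (cos t) * (sin t) ^ (2 * l)

lemma cont_clampI : Continuous clampI := by
  unfold clampI
  fun_prop

lemma gegCoef_eq {α : ℝ} (hα : -(1 / 2 : ℝ) < α) (L : ℕ → Polynomial ℝ) (f : C(Set.Icc (-1 : ℝ) 1, ℂ)) (k : ℕ) :
    gegCoef α L f k = ((rc (α + 1 / 2) L (fun x => (f (clampI x)).re) k : ℝ) : ℂ) +
      ((rc (α + 1 / 2) L (fun x => (f (clampI x)).im) k : ℝ) : ℂ) * Complex.I := by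
  have hl : 0 < α + 1 / 2 := by linarith
  unfold gegCoef gegWeight rc
  rw [kap_eq]
  set κ := ∫ t in (0:ℝ)..π, (sin t) ^ (2 * (α + 1 / 2)) with hκ
  have e : ∀ x : ℝ, f (clampI x) * (((L k).eval x : ℝ) : ℂ) * ((κ⁻¹ * (1 - x ^ 2) ^ α : ℝ) : ℂ) =
      (κ⁻¹ : ℝ) * ((1 - x ^ 2) ^ α • (f (clampI x) * (((L k).eval x : ℝ) : ℂ))) := fun x => by
    rw [Complex.real_smul]; push_cast; ring
  simp_rw [e]
  rw [integral_const_mul, cov]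
  have cf : Continuous fun x => f (clampI x) := f.continuous.comp cont_clampI
  have cw : Continuous fun t : ℝ => (sin t) ^ (2 * (α + 1 / 2)) := cont_sin_rpow (by positivity)
  have c1 : Continuous fun t : ℝ => (f (clampI (cos t))).re * (L k).eval (cos t) * (sin t) ^ (2 * (α + 1 / 2)) :=
    ((Complex.continuous_re.comp (cf.comp continuous_cos)).mul (cont_eval_cos _)).mul cw
  have c2 : Continuous fun t : ℝ => (f (clampI (cos t))).im * (L k).eval (cos t) * (sin t) ^ (2 * (α + 1 / 2)) :=
    ((Complex.continuous_im.comp (cf.comp continuous_cos)).mul (cont_eval_cos _)).mul cw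
  have e2 : ∀ t : ℝ, sin t ^ (2 * (α + 1 / 2)) • (f (clampI (cos t)) * (((L k).eval (cos t) : ℝ) : ℂ)) =
      (((f (clampI (cos t))).re * (L k).eval (cos t) * (sin t) ^ (2 * (α + 1 / 2)) : ℝ) : ℂ) +
      (((f (clampI (cos t))).im * (L k).eval (cos t) * (sin t) ^ (2 * (α + 1 / 2)) : ℝ) : ℂ) * Complex.I := by
    intro t
    conv_lhs => rw [← Complex.re_add_im (f (clampI (cos t)))]
    rw [Complex.real_smul]; push_cast; ring
  simp_rw [e2]
  have d1 : Continuous fun t : ℝ => (((f (clampI (cos t))).re * (L k).eval (cos t) * (sin t) ^ (2 * (α + 1 / 2)) : ℝ) : ℂ) :=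
    Complex.continuous_ofReal.comp c1
  have d2 : Continuous fun t : ℝ =>
      (((f (clampI (cos t))).im * (L k).eval (cos t) * (sin t) ^ (2 * (α + 1 / 2)) : ℝ) : ℂ) * Complex.I :=
    (Complex.continuous_ofReal.comp c2).mul continuous_const
  rw [intervalIntegral.integral_add (d1.intervalIntegrable _ _) (d2.intervalIntegrable _ _),
    intervalIntegral.integral_mul_const, intervalIntegral.integral_ofReal, intervalIntegral.integral_ofReal]
  push_cast; ring

end

section

lemma GSys.complete {l κ : ℝ} {L : ℕ → Polynomial ℝ} (S : GSys l κ L) {u : ℝ → ℝ} (cu : Continuous u)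
    (h : ∀ n, ∫ t in (0:ℝ)..π, u (cos t) * (L n).eval (cos t) * (sin t) ^ (2 * l) = 0) (t : ℝ) : u (cos t) = 0 := by
  have hl := S.hl
  have hpi := pi_pos
  have cw : Continuous fun t : ℝ => (sin t) ^ (2 * l) := cont_sin_rpow (by positivity)
  have cuc : Continuous fun t : ℝ => u (cos t) := cu.comp continuous_cos
  have ci : ∀ p : Polynomial ℝ, Continuous fun t : ℝ => u (cos t) * p.eval (cos t) * (sin t) ^ (2 * l) := fun p =>
    (cuc.mul (cont_eval_cos p)).mul cw
  have hp : ∀ p : Polynomial ℝ, ∫ t in (0:ℝ)..π, u (cos t) * p.eval (cos t) * (sin t) ^ (2 * l) = 0 := by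
    intro p
    obtain ⟨b, hb⟩ := seq_span L S.hd S.h0 (p.natDegree + 1) p (by
      refine lt_of_le_of_lt Polynomial.degree_le_natDegree ?_
      exact_mod_cast Nat.lt_succ_self _)
    have e : ∀ t : ℝ, u (cos t) * p.eval (cos t) * (sin t) ^ (2 * l) =
        ∑ k ∈ Finset.range (p.natDegree + 1), b k * (u (cos t) * (L k).eval (cos t) * (sin t) ^ (2 * l)) := by
      intro t
      conv_lhs => rw [hb]
      simp only [Polynomial.eval_finsetSum, Polynomial.eval_mul, Polynomial.eval_C]
      rw [Finset.mul_sum, Finset.sum_mul]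
      apply Finset.sum_congr rfl
      intro k _; ring
    simp_rw [e]
    have c2 : ∀ k, Continuous fun t : ℝ => b k * (u (cos t) * (L k).eval (cos t) * (sin t) ^ (2 * l)) :=
      fun k => continuous_const.mul (ci (L k))
    rw [intervalIntegral.integral_finsetSum (f := fun k t => b k * (u (cos t) * (L k).eval (cos t) * (sin t) ^ (2 * l)))
      (fun k _ => (c2 k).intervalIntegrable _ _)]
    apply Finset.sum_eq_zero
    intro k _
    simp only [intervalIntegral.integral_const_mul, h k, mul_zero]
  have csq : Continuous fun t : ℝ => u (cos t) ^ 2 * (sin t) ^ (2 * l) := (cuc.pow 2).mul cw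
  have hw0 : ∀ t ∈ Set.Icc 0 π, 0 ≤ (sin t) ^ (2 * l) := fun t ht => rpow_nonneg (sin_nonneg_of_mem_Icc ht) _
  have hsq : ∫ t in (0:ℝ)..π, u (cos t) ^ 2 * (sin t) ^ (2 * l) ≤ 0 := by
    apply le_of_forall_pos_le_add
    intro η hη
    rw [zero_add]
    set Z := ∫ t in (0:ℝ)..π, |u (cos t)| * (sin t) ^ (2 * l) with hZ
    have hZ0 : 0 ≤ Z := intervalIntegral.integral_nonneg hpi.le fun t ht => mul_nonneg (abs_nonneg _) (hw0 t ht)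
    obtain ⟨p, hpn⟩ := exists_polynomial_near_of_continuousOn (-1) 1 u cu.continuousOn (η / (Z + 1)) (by positivity)
    have e : ∫ t in (0:ℝ)..π, u (cos t) ^ 2 * (sin t) ^ (2 * l) =
        ∫ t in (0:ℝ)..π, (u (cos t) ^ 2 * (sin t) ^ (2 * l) - u (cos t) * p.eval (cos t) * (sin t) ^ (2 * l)) := by
      rw [intervalIntegral.integral_sub (csq.intervalIntegrable _ _) ((ci p).intervalIntegrable _ _), hp p, sub_zero]
    have cab : Continuous fun t : ℝ => (η / (Z + 1)) * (|u (cos t)| * (sin t) ^ (2 * l)) :=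
      continuous_const.mul ((continuous_abs.comp cuc).mul cw)
    rw [e]
    calc _ ≤ ∫ t in (0:ℝ)..π, (η / (Z + 1)) * (|u (cos t)| * (sin t) ^ (2 * l)) := by
          apply intervalIntegral.integral_mono_on hpi.le ((csq.sub (ci p)).intervalIntegrable _ _)
            (cab.intervalIntegrable _ _)
          intro t ht
          have h1 := (hpn (cos t) ⟨neg_one_le_cos t, cos_le_one t⟩).le
          rw [abs_sub_comm] at h1
          simp only [Pi.sub_apply]
          calc _ = (u (cos t) * (u (cos t) - p.eval (cos t))) * (sin t) ^ (2 * l) := by ring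
            _ ≤ (|u (cos t)| * (η / (Z + 1))) * (sin t) ^ (2 * l) := by
              apply mul_le_mul_of_nonneg_right _ (hw0 t ht)
              refine (le_abs_self _).trans ?_
              rw [abs_mul]
              exact mul_le_mul_of_nonneg_left h1 (abs_nonneg _)
            _ = _ := by ring
      _ = η / (Z + 1) * Z := by rw [intervalIntegral.integral_const_mul]
      _ ≤ η := by
          rw [div_mul_eq_mul_div, div_le_iff₀ (by positivity)]
          linarith
  have hz : ∀ x ∈ Set.Ioo (-1:ℝ) 1, u x = 0 := by
    intro x hx
    by_contra hne
    have hs : 0 < sin (arccos x) := by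
      rw [sin_arccos]; apply sqrt_pos.2; nlinarith [hx.1, hx.2]
    have := intervalIntegral.integral_pos hpi csq.continuousOn
      (fun t ht => mul_nonneg (sq_nonneg _) (hw0 t (Set.Ioc_subset_Icc_self ht)))
      ⟨arccos x, ⟨arccos_nonneg _, arccos_le_pi _⟩, by
        rw [cos_arccos hx.1.le hx.2.le]
        have : 0 < u x ^ 2 := by positivity
        positivity⟩
    linarith
  have hcl : Set.EqOn u (fun _ => 0) (closure (Set.Ioo (-1:ℝ) 1)) :=
    Set.EqOn.closure hz cu continuous_const
  rw [closure_Ioo (by norm_num)] at hcl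
  exact hcl ⟨neg_one_le_cos t, cos_le_one t⟩

lemma GSys.repr {l κ : ℝ} {L : ℕ → Polynomial ℝ} (S : GSys l κ L) (hκ : κ = ∫ t in (0:ℝ)..π, (sin t) ^ (2 * l))
    {u : ℝ → ℝ} (cu : Continuous u)
    (hs : Summable fun k : ℕ => |rc l L u k| * (1 + (k:ℝ)) ^ l) (t : ℝ) :
    HasSum (fun k => rc l L u k * (L k).eval (cos t)) (u (cos t)) := by
  have hl := S.hl
  have hκ0 := S.hκ
  obtain ⟨C0, hC0, hsup⟩ := S.supb
  set a := rc l L u with ha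
  have hbd : ∀ k t, ‖a k * (L k).eval (cos t)‖ ≤ C0 * (|a k| * (1 + (k:ℝ)) ^ l) := by
    intro k t
    rw [norm_eq_abs, abs_mul]
    have := mul_le_mul_of_nonneg_left (hsup k t) (abs_nonneg (a k))
    linarith
  have hs2 : Summable fun k : ℕ => C0 * (|a k| * (1 + (k:ℝ)) ^ l) := hs.mul_left _
  have hsum : ∀ t, Summable fun k => a k * (L k).eval (cos t) := fun t =>
    Summable.of_norm_bounded hs2 (fun k => hbd k t)
  set s : ℝ → ℝ := fun x => ∑' k, a k * (L k).eval (cos (arccos x)) with hsd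
  have cs : Continuous s := continuous_tsum
    (fun k => continuous_const.mul ((cont_eval_cos (L k)).comp continuous_arccos)) hs2 (fun k x => hbd k _)
  have hst : ∀ t, HasSum (fun k => a k * (L k).eval (cos t)) (s (cos t)) := by
    intro t
    simp only [hsd, cos_arccos (neg_one_le_cos t) (cos_le_one t)]
    exact (hsum t).hasSum
  have cw : Continuous fun t : ℝ => (sin t) ^ (2 * l) := cont_sin_rpow (by positivity)
  have cf : ∀ n (v : ℝ → ℝ), Continuous v → Continuous fun t : ℝ => v (cos t) * (L n).eval (cos t) * (sin t) ^ (2 * l) := fun n v cv =>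
    ((cv.comp continuous_cos).mul (cont_eval_cos (L n))).mul cw
  have key : ∀ n, ∫ t in (0:ℝ)..π, s (cos t) * (L n).eval (cos t) * (sin t) ^ (2 * l) = κ * a n := by
    intro n
    set B := C0 * (1 + (n:ℝ)) ^ l with hB
    have hB0 : 0 ≤ B := by positivity
    have cF : ∀ k, Continuous fun t : ℝ => a k * (L k).eval (cos t) * ((L n).eval (cos t) * (sin t) ^ (2 * l)) := fun k =>
      (continuous_const.mul (cont_eval_cos (L k))).mul ((cont_eval_cos (L n)).mul cw)
    have H := intervalIntegral.hasSum_integral_of_dominated_convergence (μ := volume) (a := 0) (b := π)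
      (F := fun k t => a k * (L k).eval (cos t) * ((L n).eval (cos t) * (sin t) ^ (2 * l)))
      (f := fun t => s (cos t) * ((L n).eval (cos t) * (sin t) ^ (2 * l)))
      (fun k _ => C0 * (|a k| * (1 + (k:ℝ)) ^ l) * B)
      (fun k => (cF k).aestronglyMeasurable)
      (fun k => Filter.Eventually.of_forall fun t ht => by
        rw [Set.uIoc_of_le pi_pos.le] at ht
        have hs0 : 0 ≤ sin t := sin_nonneg_of_mem_Icc ⟨ht.1.le, ht.2⟩
        rw [norm_mul]
        refine mul_le_mul (hbd k t) ?_ (norm_nonneg _) (by positivity)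
        rw [norm_eq_abs, abs_mul, abs_of_nonneg (rpow_nonneg hs0 _)]
        refine (mul_le_of_le_one_right (abs_nonneg _) (rpow_le_one hs0 (sin_le_one t) (by positivity))).trans (hsup n t))
      (Filter.Eventually.of_forall fun t _ => hs2.mul_right B)
      (by simp)
      (Filter.Eventually.of_forall fun t _ => (hst t).mul_right _)
    have e : ∀ k, ∫ t in (0:ℝ)..π, a k * (L k).eval (cos t) * ((L n).eval (cos t) * (sin t) ^ (2 * l)) =
        if k = n then κ * a n else 0 := by
      intro k
      have h1 := S.orth k n
      unfold gip at h1
      have h2 : ∀ t : ℝ, a k * (L k).eval (cos t) * ((L n).eval (cos t) * (sin t) ^ (2 * l)) =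
        a k * ((L k).eval (cos t) * (L n).eval (cos t) * (sin t) ^ (2 * l)) := fun t => by ring
      simp_rw [h2]
      rw [intervalIntegral.integral_const_mul, h1]
      split_ifs with h
      · rw [h]; ring
      · simp
    simp only [e] at H
    have h3 := H.unique (hasSum_ite_eq n (κ * a n))
    rw [← h3]
    congr 1; ext t; ring
  have hu : ∀ n, ∫ t in (0:ℝ)..π, u (cos t) * (L n).eval (cos t) * (sin t) ^ (2 * l) = κ * a n := by
    intro n
    rw [ha, rc, ← hκ, mul_inv_cancel_left₀ hκ0.ne']
  have := S.complete (cu.sub cs) (fun n => by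
    have e : ∀ t : ℝ, (u (cos t) - s (cos t)) * (L n).eval (cos t) * (sin t) ^ (2 * l) =
      u (cos t) * (L n).eval (cos t) * (sin t) ^ (2 * l) - s (cos t) * (L n).eval (cos t) * (sin t) ^ (2 * l) :=
      fun t => by ring
    simp only [Pi.sub_apply]
    simp_rw [e]
    rw [intervalIntegral.integral_sub ((cf n u cu).intervalIntegrable _ _) ((cf n s cs).intervalIntegrable _ _),
      hu, key, sub_self]) t
  simp only [Pi.sub_apply] at this
  rw [sub_eq_zero.1 this]
  exact hst t

end

section

def pCM (G : Polynomial ℝ) : C(Set.Icc (-1 : ℝ) 1, ℂ) :=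
  ⟨fun x => ((G.eval (x : ℝ) : ℝ) : ℂ), Complex.continuous_ofReal.comp (G.continuous.comp continuous_subtype_val)⟩

lemma pCM_mem {L : ℕ → Polynomial ℝ} {J : Finset ℕ} {G : Polynomial ℝ} (h : G ∈ Submodule.span ℝ (L '' (J : Set ℕ))) :
    pCM G ∈ Submodule.span ℂ (gegCM L '' (J : Set ℕ)) := by
  induction h using Submodule.span_induction with
  | mem x hx =>
    obtain ⟨k, hk, rfl⟩ := hx
    exact Submodule.subset_span ⟨k, hk, rfl⟩
  | zero =>
    have : pCM 0 = 0 := by ext x; simp [pCM]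
    rw [this]; exact Submodule.zero_mem _
  | add x y _ _ hx hy =>
    have : pCM (x + y) = pCM x + pCM y := by ext z; simp [pCM]
    rw [this]; exact Submodule.add_mem _ hx hy
  | smul a x _ hx =>
    have : pCM (a • x) = (a : ℂ) • pCM x := by ext z; simp [pCM]
    rw [this]; exact Submodule.smul_mem _ _ hx

lemma final_upper {α θ r : ℝ} {L : ℕ → Polynomial ℝ} (hθ1 : 0 < θ) (hθ2 : θ ≤ 1) (hα : -(1 / 2 : ℝ) < α)
    (hr : α + 1 / 2 < r) (S : GSys (α + 1 / 2) (∫ t in (0:ℝ)..π, (sin t) ^ (2 * (α + 1 / 2))) L) :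
    ∃ C : ℝ, 0 < C ∧ ∀ n : ℕ, 1 ≤ n → ∀ f ∈ gegWienerClass α r θ L, ∃ h ∈ gegSparseAll L n,
      ‖f - h‖ ≤ C * (n : ℝ) ^ (-(r + 1 / θ - 1 / 2) : ℝ) := by
  classical
  obtain ⟨C, hC, hup⟩ := S.upper hr hθ1 hθ2
  refine ⟨2 * C, by positivity, ?_⟩
  intro n hn f hf
  set l := α + 1 / 2 with hl
  have hl0 := S.hl
  obtain ⟨hf1, hf2⟩ := hf
  have cf : Continuous fun x => f (clampI x) := f.continuous.comp cont_clampI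
  have main : ∀ u : ℝ → ℝ, Continuous u → (∀ k, |rc l L u k| ≤ ‖gegCoef α L f k‖) → ∃ G, Sp L (n / 2) G ∧
      ∀ t, |u (cos t) - G.eval (cos t)| ≤ C * (n : ℝ) ^ (-(r + 1 / θ - 1 / 2) : ℝ) := by
    intro u cu hu
    have ha : ∀ s : Finset ℕ, ∑ k ∈ s, ((1 + (k:ℝ)) ^ r * |rc l L u k|) ^ θ ≤ 1 := by
      intro s
      refine le_trans ?_ ((hf1.sum_le_tsum s (fun k _ => by positivity)).trans hf2)
      apply Finset.sum_le_sum
      intro k _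
      have := hu k
      gcongr
    have hs : Summable fun k : ℕ => |rc l L u k| * (1 + (k:ℝ)) ^ l := by
      have h0 : Summable fun k : ℕ => ((1 + (k:ℝ)) ^ r * |rc l L u k|) ^ θ :=
        summable_of_sum_le (fun k => by positivity) ha
      refine Summable.of_nonneg_of_le (fun k => by positivity) (fun k => ?_) h0
      set A := (1 + (k:ℝ)) ^ r * |rc l L u k| with hA
      have hA0 : 0 ≤ A := by positivity
      have h1 : A ^ θ ≤ 1 := by simpa using ha {k}
      have h2 : A ≤ 1 := by
        by_contra h
        push Not at h
        linarith [one_lt_rpow h hθ1]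
      have h3 : A ≤ A ^ θ := by
        rcases hA0.eq_or_lt with h0 | h0
        · rw [← h0]; positivity
        · conv_lhs => rw [← rpow_one A]
          exact rpow_le_rpow_of_exponent_ge h0 h2 hθ2
      refine le_trans ?_ h3
      rw [hA, mul_comm]
      have hk : (1:ℝ) ≤ 1 + k := by have : (0:ℝ) ≤ k := by positivity
                                    linarith
      exact mul_le_mul_of_nonneg_right (rpow_le_rpow_of_exponent_le hk hr.le) (abs_nonneg _)
    obtain ⟨G, M0, hG, hb⟩ := hup n hn (rc l L u) ha
    refine ⟨G, hG, fun t => ?_⟩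
    have h1 := (S.repr rfl cu hs t).tendsto_sum_nat
    have h2 := (h1.sub_const (G.eval (cos t))).abs
    refine le_of_tendsto h2 ?_
    filter_upwards [Filter.eventually_ge_atTop M0] with M hM
    have := hb M hM t
    rw [Polynomial.eval_sub, Polynomial.eval_finsetSum] at this
    simpa only [Polynomial.eval_mul, Polynomial.eval_C] using this
  have hco : ∀ k, gegCoef α L f k = ↑(rc l L (fun x => (f (clampI x)).re) k) + ↑(rc l L (fun x => (f (clampI x)).im) k) * Complex.I := gegCoef_eq hα L f
  obtain ⟨G1, ⟨J1, hJ1, hG1⟩, hb1⟩ := main (fun x => (f (clampI x)).re) (Complex.continuous_re.comp cf) (fun k => by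
    have e : (gegCoef α L f k).re = rc l L (fun x => (f (clampI x)).re) k := by
      rw [hco k, Complex.add_re, Complex.ofReal_re, Complex.re_ofReal_mul, Complex.I_re, mul_zero, add_zero]
    rw [← e]
    exact Complex.abs_re_le_norm _)
  obtain ⟨G2, ⟨J2, hJ2, hG2⟩, hb2⟩ := main (fun x => (f (clampI x)).im) (Complex.continuous_im.comp cf) (fun k => by
    have e : (gegCoef α L f k).im = rc l L (fun x => (f (clampI x)).im) k := by
      rw [hco k, Complex.add_im, Complex.ofReal_im, Complex.im_ofReal_mul, Complex.I_im, mul_one, zero_add]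
    rw [← e]
    exact Complex.abs_im_le_norm _)
  have hcard : (J1 ∪ J2).card ≤ n := (Finset.card_union_le _ _).trans (by omega)
  obtain ⟨J, hJs, hJc⟩ := Infinite.exists_superset_card_eq (J1 ∪ J2) n hcard
  refine ⟨pCM G1 + Complex.I • pCM G2, ⟨J, hJc, ?_⟩, ?_⟩
  · refine Submodule.add_mem _ ?_ (Submodule.smul_mem _ _ ?_)
    · exact Submodule.span_mono (Set.image_mono (by
        exact_mod_cast Finset.subset_union_left.trans hJs)) (pCM_mem hG1)
    · exact Submodule.span_mono (Set.image_mono (by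
        exact_mod_cast Finset.subset_union_right.trans hJs)) (pCM_mem hG2)
  · rw [ContinuousMap.norm_le _ (by positivity)]
    intro x
    have hx : cos (arccos (x:ℝ)) = x := cos_arccos x.2.1 x.2.2
    have hcl : clampI (x:ℝ) = x := by
      apply Subtype.ext
      simp [clampI, x.2.1, x.2.2]
    have h1 := hb1 (arccos x)
    have h2 := hb2 (arccos x)
    simp only [hx, hcl] at h1 h2
    refine (Complex.norm_le_abs_re_add_abs_im _).trans ?_
    have e1 : ((f - (pCM G1 + Complex.I • pCM G2)) x).re = (f x).re - G1.eval (x:ℝ) := by simp [pCM]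
    have e2 : ((f - (pCM G1 + Complex.I • pCM G2)) x).im = (f x).im - G2.eval (x:ℝ) := by simp [pCM]
    rw [e1, e2]
    linarith

end

section

lemma clampI_coe (x : Set.Icc (-1 : ℝ) 1) : clampI (x:ℝ) = x := by
  apply Subtype.ext
  simp [clampI, x.2.1, x.2.2]

lemma clampI_cos (t : ℝ) : ((clampI (cos t) : Set.Icc (-1 : ℝ) 1) : ℝ) = cos t := by
  simp [clampI, neg_one_le_cos t, cos_le_one t]

lemma gegCoef_pCM {α : ℝ} {L : ℕ → Polynomial ℝ} (hα : -(1 / 2 : ℝ) < α)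
    (S : GSys (α + 1 / 2) (∫ t in (0:ℝ)..π, (sin t) ^ (2 * (α + 1 / 2))) L) (N : ℕ) (b : ℕ → ℝ) (k : ℕ) :
    gegCoef α L (pCM (∑ j ∈ Finset.range N, Polynomial.C (b j) * L j)) k = ((if k < N then b k else 0 : ℝ) : ℂ) := by
  rw [gegCoef_eq hα]
  have h1 : rc (α + 1 / 2) L (fun x => ((pCM (∑ j ∈ Finset.range N, Polynomial.C (b j) * L j)) (clampI x)).re) k =
      if k < N then b k else 0 := by
    have h := S.hκ
    have e : rc (α + 1 / 2) L (fun x => ((pCM (∑ j ∈ Finset.range N, Polynomial.C (b j) * L j)) (clampI x)).re) k =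
        (∫ t in (0:ℝ)..π, (sin t) ^ (2 * (α + 1 / 2)))⁻¹ *
          gip (α + 1 / 2) (∑ j ∈ Finset.range N, Polynomial.C (b j) * L j) (L k) := by
      unfold rc gip
      simp only [pCM, ContinuousMap.coe_mk, Complex.ofReal_re, clampI_cos]
    rw [e, gip_sum S.hl]
    simp only [gip_smul, S.orth]
    set κ := ∫ t in (0:ℝ)..π, (sin t) ^ (2 * (α + 1 / 2))
    simp only [mul_ite, mul_zero, Finset.sum_ite_eq', Finset.mem_range]
    split_ifs
    · field_simp
    · rfl
  have h2 : rc (α + 1 / 2) L (fun x => ((pCM (∑ j ∈ Finset.range N, Polynomial.C (b j) * L j)) (clampI x)).im) k = 0 := by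
    unfold rc
    simp [pCM]
  rw [h1, h2, Complex.ofReal_zero, zero_mul, add_zero]

lemma lower_sq {α : ℝ} {L : ℕ → Polynomial ℝ}
    (S : GSys (α + 1 / 2) (∫ t in (0:ℝ)..π, (sin t) ^ (2 * (α + 1 / 2))) L) (n : ℕ) (b : ℕ → ℝ) (m : ℝ) (hm : 0 ≤ m)
    (hb : ∀ k < 2 * n, m ≤ b k) (h : C(Set.Icc (-1 : ℝ) 1, ℂ)) (hh : h ∈ gegSparseAll L n) :
    n * m ^ 2 ≤ ‖pCM (∑ j ∈ Finset.range (2 * n), Polynomial.C (b j) * L j) - h‖ ^ 2 := by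
  classical
  obtain ⟨J, hJ, hs⟩ := hh
  rw [Submodule.mem_span_image_finset_iff_exists_fun'] at hs
  obtain ⟨c, hc⟩ := hs
  set E := ‖pCM (∑ j ∈ Finset.range (2 * n), Polynomial.C (b j) * L j) - h‖ with hE
  obtain ⟨M, hM⟩ : ∃ M, J ∪ Finset.range (2 * n) ⊆ Finset.range M :=
    Finset.exists_nat_subset_range _
  set d : ℕ → ℝ := fun k => (if k ∈ Finset.range (2 * n) then b k else 0) - (if k ∈ J then (c k).re else 0) with hd
  set e := ∑ k ∈ Finset.range M, Polynomial.C (d k) * L k with he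
  have hev : ∀ x : Set.Icc (-1 : ℝ) 1, e.eval (x:ℝ) =
      ((pCM (∑ j ∈ Finset.range (2 * n), Polynomial.C (b j) * L j) - h) x).re := by
    intro x
    have a1 : (h x).re = ∑ k ∈ J, (c k).re * (L k).eval (x:ℝ) := by
      rw [← hc]
      simp [gegCM, ContinuousMap.sum_apply, Complex.re_sum]
    have a2 : ∑ k ∈ Finset.range M, (if k ∈ Finset.range (2 * n) then b k else 0) * (L k).eval (x:ℝ) =
        ∑ k ∈ Finset.range (2 * n), b k * (L k).eval (x:ℝ) := by
      simp only [ite_mul, zero_mul]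
      rw [← Finset.sum_filter, Finset.filter_mem_eq_inter, Finset.inter_eq_right.2 (Finset.subset_union_right.trans hM)]
    have a3 : ∑ k ∈ Finset.range M, (if k ∈ J then (c k).re else 0) * (L k).eval (x:ℝ) =
        ∑ k ∈ J, (c k).re * (L k).eval (x:ℝ) := by
      simp only [ite_mul, zero_mul]
      rw [← Finset.sum_filter, Finset.filter_mem_eq_inter, Finset.inter_eq_right.2 (Finset.subset_union_left.trans hM)]
    rw [ContinuousMap.sub_apply, Complex.sub_re, a1, ← a3]
    have a4 : (pCM (∑ j ∈ Finset.range (2 * n), Polynomial.C (b j) * L j) x).re =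
        ∑ k ∈ Finset.range (2 * n), b k * (L k).eval (x:ℝ) := by
      simp [pCM, Polynomial.eval_finsetSum]
    rw [a4, ← a2, he, Polynomial.eval_finsetSum, ← Finset.sum_sub_distrib]
    apply Finset.sum_congr rfl
    intro k _
    simp only [hd, Polynomial.eval_mul, Polynomial.eval_C]
    ring
  have hbd : ∀ t : ℝ, |e.eval (cos t)| ≤ E := by
    intro t
    have h1 := hev (clampI (cos t))
    rw [clampI_cos] at h1
    rw [h1]
    exact (Complex.abs_re_le_norm _).trans (ContinuousMap.norm_coe_le_norm _ _)
  have hp := S.parseval M d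
  rw [← he] at hp
  have hκ := S.hκ
  have hl := S.hl
  have hle : gip (α + 1 / 2) e e ≤ E ^ 2 * ∫ t in (0:ℝ)..π, (sin t) ^ (2 * (α + 1 / 2)) := by
    unfold gip
    rw [← intervalIntegral.integral_const_mul]
    apply intervalIntegral.integral_mono_on pi_pos.le (gip_integrable hl _ _ _ _)
    · exact (continuous_const.mul (cont_sin_rpow (by positivity))).intervalIntegrable _ _
    · intro t ht
      have := sin_nonneg_of_mem_Icc ht
      have h2 : e.eval (cos t) * e.eval (cos t) ≤ E ^ 2 := by
        rw [← sq, ← sq_abs]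
        have := hbd t
        gcongr
      exact mul_le_mul_of_nonneg_right h2 (by positivity)
  rw [hp, mul_comm] at hle
  have hle2 := le_of_mul_le_mul_right hle hκ
  refine le_trans ?_ hle2
  have hK : n ≤ (Finset.range (2 * n) \ J).card := by
    have := Finset.le_card_sdiff J (Finset.range (2 * n))
    rw [Finset.card_range, hJ] at this
    omega
  have hsub : Finset.range (2 * n) \ J ⊆ Finset.range M :=
    Finset.sdiff_subset.trans (Finset.subset_union_right.trans hM)
  refine le_trans ?_ (Finset.sum_le_sum_of_subset_of_nonneg hsub (fun k _ _ => sq_nonneg (d k)))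
  have h3 : ∀ k ∈ Finset.range (2 * n) \ J, m ^ 2 ≤ d k ^ 2 := by
    intro k hk
    rw [Finset.mem_sdiff] at hk
    have : d k = b k := by simp only [hd]; rw [if_pos hk.1, if_neg hk.2, sub_zero]
    rw [this]
    have := hb k (Finset.mem_range.1 hk.1)
    gcongr
  have h4 := Finset.card_nsmul_le_sum _ _ _ h3
  rw [nsmul_eq_mul] at h4
  refine le_trans ?_ h4
  have : (n:ℝ) ≤ ((Finset.range (2 * n) \ J).card : ℝ) := by exact_mod_cast hK
  gcongr

lemma final_lower {α θ r : ℝ} {L : ℕ → Polynomial ℝ} (hθ1 : 0 < θ) (hα : -(1 / 2 : ℝ) < α)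
    (hr : α + 1 / 2 < r) (S : GSys (α + 1 / 2) (∫ t in (0:ℝ)..π, (sin t) ^ (2 * (α + 1 / 2))) L) (n : ℕ) (hn : 1 ≤ n) :
    ∃ f ∈ gegWienerClass α r θ L, ∀ h ∈ gegSparseAll L n,
      (2:ℝ) ^ (-(r + 1 / θ)) * (n : ℝ) ^ (-(r + 1 / θ - 1 / 2) : ℝ) ≤ ‖f - h‖ := by
  have hn0 : (0:ℝ) < n := by exact_mod_cast hn
  have hr0 : 0 < r := by linarith
  set b : ℕ → ℝ := fun k => (2 * (n:ℝ)) ^ (-(1 / θ)) * (1 + (k:ℝ)) ^ (-r) with hb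
  refine ⟨pCM (∑ j ∈ Finset.range (2 * n), Polynomial.C (b j) * L j), ?_, ?_⟩
  · have key : ∀ k : ℕ, ((1 + (k : ℝ)) ^ r * ‖gegCoef α L (pCM (∑ j ∈ Finset.range (2 * n), Polynomial.C (b j) * L j)) k‖) ^ θ
        = if k ∈ Finset.range (2 * n) then (2 * (n:ℝ))⁻¹ else 0 := by
      intro k
      rw [gegCoef_pCM hα S, Complex.norm_real]
      simp only [Finset.mem_range]
      split_ifs with hk
      · have hk1 : (0:ℝ) < 1 + k := by positivity
        rw [norm_of_nonneg (by positivity)]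
        simp only [hb]
        rw [mul_left_comm, ← rpow_add hk1, add_neg_cancel, rpow_zero, mul_one, ← rpow_mul (by positivity)]
        rw [show -(1 / θ) * θ = -1 by field_simp, rpow_neg_one]
      · rw [norm_zero, mul_zero, zero_rpow hθ1.ne']
    refine ⟨?_, ?_⟩
    · simp only [key]
      exact summable_of_ne_finset_zero (s := Finset.range (2 * n)) (fun k hk => if_neg hk)
    · simp only [key]
      rw [tsum_eq_sum (s := Finset.range (2 * n)) (fun k hk => if_neg hk), Finset.sum_congr rfl (fun k hk => if_pos hk)]
      rw [Finset.sum_const, Finset.card_range, nsmul_eq_mul]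
      push_cast
      rw [mul_inv_cancel₀ (by positivity)]
  · intro h hh
    have h1 := lower_sq S n b ((2 * (n:ℝ)) ^ (-(r + 1 / θ))) (by positivity) (by
      intro k hk
      simp only [hb]
      rw [show -(r + 1 / θ) = -(1 / θ) + -r by ring, rpow_add (by positivity)]
      have : (1:ℝ) + k ≤ 2 * n := by
        have : 1 + k ≤ 2 * n := by omega
        exact_mod_cast this
      have := rpow_le_rpow_of_nonpos (by positivity) this (neg_nonpos.2 hr0.le)
      gcongr) h hh
    have e : (2:ℝ) ^ (-(r + 1 / θ)) * (n : ℝ) ^ (-(r + 1 / θ - 1 / 2) : ℝ) =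
        (2 * (n:ℝ)) ^ (-(r + 1 / θ)) * √(n:ℝ) := by
      rw [mul_rpow (by norm_num) hn0.le, sqrt_eq_rpow, mul_assoc, ← rpow_add hn0]
      congr 2
      ring
    rw [e]
    refine (sq_le_sq₀ (by positivity) (norm_nonneg _)).1 ?_
    rw [mul_pow, sq_sqrt hn0.le, mul_comm]
    exact h1


end

/-- sharp asymptotic order of the best `n`-term approximation
`σ_n(A^r_{α,θ}, B_α)_∞ ≍ n^{-(r + 1/θ - 1/2)}` in the uniform norm. -/
theorem stmt19 (θ : ℝ) (hθ1 : 0 < θ) (hθ2 : θ ≤ 1)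
    (α : ℝ) (hα : -(1 / 2 : ℝ) < α) (r : ℝ) (hr : α + 1 / 2 < r)
    (L : ℕ → Polynomial ℝ)
    (hdeg : ∀ n, (L n).natDegree = n)
    (hlead : ∀ n, 0 < (L n).leadingCoeff)
    (horth : ∀ i j, (∫ x in Set.Ioo (-1 : ℝ) 1,
        (L i).eval x * (L j).eval x * gegWeight α x) = if i = j then 1 else 0) :
    ∃ c₁ C₂ : ℝ, 0 < c₁ ∧ 0 < C₂ ∧ ∀ n : ℕ, 1 ≤ n →
      c₁ * (n : ℝ) ^ (-(r + 1 / θ - 1 / 2) : ℝ) ≤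
        (⨆ f : gegWienerClass α r θ L, ⨅ h : gegSparseAll L n,
          ‖(f : C(Set.Icc (-1 : ℝ) 1, ℂ)) - (h : C(Set.Icc (-1 : ℝ) 1, ℂ))‖) ∧
      (⨆ f : gegWienerClass α r θ L, ⨅ h : gegSparseAll L n,
          ‖(f : C(Set.Icc (-1 : ℝ) 1, ℂ)) - (h : C(Set.Icc (-1 : ℝ) 1, ℂ))‖) ≤
        C₂ * (n : ℝ) ^ (-(r + 1 / θ - 1 / 2) : ℝ) := by
  have S := mkGSys hα L hdeg hlead horth
  obtain ⟨C, hC, hup⟩ := final_upper hθ1 hθ2 hα hr S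
  refine ⟨(2:ℝ) ^ (-(r + 1 / θ)), C, by positivity, hC, fun n hn => ?_⟩
  have hub : ∀ f : gegWienerClass α r θ L, (⨅ h : gegSparseAll L n,
      ‖(f : C(Set.Icc (-1 : ℝ) 1, ℂ)) - (h : C(Set.Icc (-1 : ℝ) 1, ℂ))‖) ≤
        C * (n : ℝ) ^ (-(r + 1 / θ - 1 / 2) : ℝ) := by
    intro f
    obtain ⟨h, hh, hle⟩ := hup n hn f f.2
    refine le_trans ?_ hle
    exact ciInf_le (f := fun h : gegSparseAll L n =>
      ‖(f : C(Set.Icc (-1 : ℝ) 1, ℂ)) - (h : C(Set.Icc (-1 : ℝ) 1, ℂ))‖)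
      ⟨0, by rintro _ ⟨h, rfl⟩; exact norm_nonneg _⟩ ⟨h, hh⟩
  refine ⟨?_, Real.iSup_le hub (by positivity)⟩
  obtain ⟨f, hf, hlow⟩ := final_lower hθ1 hα hr S n hn
  obtain ⟨h0, hh0, _⟩ := hup n hn f hf
  have : Nonempty (gegSparseAll L n) := ⟨⟨h0, hh0⟩⟩
  refine le_trans ?_ (le_ciSup (f := fun f : gegWienerClass α r θ L => ⨅ h : gegSparseAll L n,
      ‖(f : C(Set.Icc (-1 : ℝ) 1, ℂ)) - (h : C(Set.Icc (-1 : ℝ) 1, ℂ))‖)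
      ⟨_, by rintro _ ⟨f, rfl⟩; exact hub f⟩ ⟨f, hf⟩)
  exact le_ciInf fun h => hlow h h.2
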